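/- If e(R/I) = 3, then pd(R/I) ≤ 4. -/

import Mathlib

noncomputable section

open MvPolynomial Filter CategoryTheory

/-- The height of an ideal `J`: the infimum of the heights of the prime ideals containing it. -/
def idealHeight {R : Type} [CommRing R] (J : Ideal R) : ℕ∞ :=
  ⨅ p ∈ {p : {q : Ideal R // q.IsPrime} | J ≤ p.1}, Order.height p

/-- `pdQuotLE J n` holds iff `R ⧸ J` admits a projective resolution of length at most `n`,
i.e. the projective dimension of `R ⧸ J` as an `R`-module is at most `n`. -/
def pdQuotLE {R : Type} [CommRing R] (J : Ideal R) (n : ℕ) : Prop :=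
  ∃ P : ProjectiveResolution (ModuleCat.of R (R ⧸ J)),
    ∀ i, n < i → Limits.IsZero (P.complex.X i)

/-- The `p`-primary component of `J` for `p` a minimal prime of `J`:
the saturation of `J` at `p`. -/
def primaryComponent {R : Type} [CommRing R] (J p : Ideal R) : Ideal R :=
  ⨆ (s : R) (_ : s ∉ p), Submodule.colon J (Ideal.span {s})

/-- The unmixed part `J^un` of `J`: the intersection of the primary components of `J`
corresponding to the minimal primes of `J` of minimal height. -/
def unmixedPart {R : Type} [CommRing R] (J : Ideal R) : Ideal R :=
  ⨅ p ∈ {p : Ideal R | p.IsPrime ∧ J ≤ p ∧ idealHeight p = idealHeight J},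
    primaryComponent J p

/-- A linear prime: a prime ideal generated by forms of degree one. -/
def IsLinearPrime {k : Type} [CommSemiring k] {N : ℕ} (p : Ideal (MvPolynomial (Fin N) k)) : Prop :=
  p.IsPrime ∧ ∃ S : Set (MvPolynomial (Fin N) k), (∀ ℓ ∈ S, ℓ.IsHomogeneous 1) ∧ p = Ideal.span S

/-- A homogeneous ideal: an ideal generated by homogeneous elements. -/
def IsHomogeneousIdeal {k : Type} [CommSemiring k] {N : ℕ}
    (J : Ideal (MvPolynomial (Fin N) k)) : Prop :=
  ∃ S : Set (MvPolynomial (Fin N) k), (∀ g ∈ S, ∃ d, g.IsHomogeneous d) ∧ J = Ideal.span S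

/-- `[B]_n`: the ideal generated by all forms of degree `n` belonging to `B`. -/
def degreePart {k : Type} [CommSemiring k] {N : ℕ} (B : Ideal (MvPolynomial (Fin N) k)) (n : ℕ) :
    Ideal (MvPolynomial (Fin N) k) :=
  Ideal.span {f | f ∈ B ∧ f.IsHomogeneous n}

/-- The Hilbert–Samuel function of `R/J` with respect to the irrelevant maximal ideal:
`n ↦ length (R / (J + 𝔪^n)) = dim_k (R / (J + 𝔪^n))`. -/
def hilbertSamuelFn {k : Type} [Field k] {N : ℕ} (J : Ideal (MvPolynomial (Fin N) k))
    (n : ℕ) : ℕ :=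
  Module.finrank k
    (MvPolynomial (Fin N) k ⧸
      (J ⊔ (Ideal.span (Set.range (MvPolynomial.X : Fin N → MvPolynomial (Fin N) k))) ^ n))

/-- `HasMultiplicity J d e`: the quotient `R/J` has Krull dimension `d` and Hilbert–Samuel
multiplicity `e`, expressed through the asymptotics `d! · HS_J(n) / n^d → e` of the
Hilbert–Samuel function. -/
def HasMultiplicity {k : Type} [Field k] {N : ℕ} (J : Ideal (MvPolynomial (Fin N) k))
    (d e : ℕ) : Prop :=
  Tendsto (fun n : ℕ => (Nat.factorial d : ℝ) * (hilbertSamuelFn J n : ℝ) / (n : ℝ) ^ d)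
    atTop (nhds (e : ℝ))

/-- An ideal of `R` is extended from a subalgebra `A` if it is generated by elements of `A`. -/
def extendedFrom {k R : Type} [CommRing k] [CommRing R] [Algebra k R]
    (K : Ideal R) (A : Subalgebra k R) : Prop :=
  ∃ S : Set R, S ⊆ (A : Set R) ∧ K = Ideal.span S

end

section
open CategoryTheory

namespace S8
set_option linter.unusedSectionVars false
universe u v
section
variable {C : Type u} [Category.{v} C] [Abelian C] [EnoughProjectives C]

noncomputable def spliceπ {K : C} (Q : ProjectiveResolution K) : Q.complex.X 0 ⟶ K :=
  (ChainComplex.toSingle₀Equiv Q.complex K Q.π).1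

lemma spliceπ_w {K : C} (Q : ProjectiveResolution K) : Q.complex.d 1 0 ≫ spliceπ Q = 0 :=
  (ChainComplex.toSingle₀Equiv Q.complex K Q.π).2

lemma spliceπ_epi {K : C} (Q : ProjectiveResolution K) : Epi (spliceπ Q) :=
  inferInstanceAs (Epi (Q.π.f 0))

lemma spliceπ_exact {K : C} (Q : ProjectiveResolution K) :
    (ShortComplex.mk (Q.complex.d 1 0) (spliceπ Q) (spliceπ_w Q)).Exact := by
  apply ShortComplex.exact_of_g_is_cokernel
  exact Q.isColimitCokernelCofork

lemma exists_splice (S : ShortComplex C) (hS : S.ShortExact) [Projective S.X₂]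
    (Q : ProjectiveResolution S.X₁) :
    ∃ P : ProjectiveResolution S.X₃, ∀ i, Nonempty (P.complex.X (i+1) ≅ Q.complex.X i) := by
  have := hS.mono_f
  have := hS.epi_g
  have he := spliceπ_epi Q
  have w : Q.complex.d 1 0 ≫ (spliceπ Q ≫ S.f) = 0 := by
    rw [← Category.assoc, spliceπ_w, Limits.zero_comp]
  let cx := ChainComplex.augment Q.complex (spliceπ Q ≫ S.f) w
  have w0 : cx.d 1 0 ≫ S.g = 0 := by
    show (spliceπ Q ≫ S.f) ≫ S.g = 0
    simp
  have ex0 : (ShortComplex.mk (spliceπ Q ≫ S.f) S.g (by simp)).Exact := by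
    let α : ShortComplex.mk (spliceπ Q ≫ S.f) S.g (by simp) ⟶ S :=
      { τ₁ := spliceπ Q, τ₂ := 𝟙 _, τ₃ := 𝟙 _ }
    rw [ShortComplex.exact_iff_of_epi_of_isIso_of_mono α]
    exact hS.exact
  have ex1 : (ShortComplex.mk (Q.complex.d 1 0) (spliceπ Q ≫ S.f) w).Exact := by
    let α : ShortComplex.mk (Q.complex.d 1 0) (spliceπ Q) (spliceπ_w Q) ⟶
      ShortComplex.mk (Q.complex.d 1 0) (spliceπ Q ≫ S.f) w :=
      { τ₁ := 𝟙 _, τ₂ := 𝟙 _, τ₃ := S.f }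
    rw [← ShortComplex.exact_iff_of_epi_of_isIso_of_mono α]
    exact spliceπ_exact Q
  have hg : ((ChainComplex.toSingle₀Equiv cx S.X₃).symm ⟨S.g, w0⟩).f 0 = S.g :=
    ChainComplex.toSingle₀Equiv_symm_apply_f_zero _ _
  refine ⟨{ complex := cx
            projective := ?_
            π := (ChainComplex.toSingle₀Equiv _ _).symm ⟨S.g, w0⟩
            quasiIso := ⟨fun n => ?_⟩ }, fun i => ⟨Iso.refl _⟩⟩
  · rintro (_|n)
    · exact inferInstanceAs (Projective S.X₂)
    · exact Q.projective n
  · cases n with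
    | zero =>
      rw [ChainComplex.quasiIsoAt₀_iff, ShortComplex.quasiIso_iff_of_zeros']
      · refine (ShortComplex.exact_and_epi_g_iff_of_iso ?_).2 ⟨ex0, by dsimp; infer_instance⟩
        exact ShortComplex.isoMk (Iso.refl _) (Iso.refl _) (Iso.refl _)
          ((Category.id_comp (spliceπ Q ≫ S.f)).trans (Category.comp_id (spliceπ Q ≫ S.f)).symm)
          ((Category.id_comp S.g).trans (hg.symm.trans (Category.comp_id _).symm))
      all_goals rfl
    | succ n =>
      rw [quasiIsoAt_iff_exactAt' _ _ (ChainComplex.exactAt_succ_single_obj _ _)]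
      rw [HomologicalComplex.exactAt_iff' _ (n + 1 + 1) (n + 1) n (by simp) (by simp)]
      cases n with
      | zero => exact ex1
      | succ n => exact Q.exact_succ n

lemma exists_resolution (n : ℕ) (X : C) (h : HasProjectiveDimensionLE X n) :
    ∃ P : ProjectiveResolution X, ∀ i, n < i → Limits.IsZero (P.complex.X i) := by
  induction n generalizing X with
  | zero =>
    have : Projective X := (projective_iff_hasProjectiveDimensionLE_zero X).2 h
    refine ⟨ProjectiveResolution.self X, ?_⟩
    intro i hi
    apply HomologicalComplex.isZero_single_obj_X
    omega
  | succ n ih =>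
    let S : ShortComplex C := ShortComplex.mk (Limits.kernel.ι (Projective.π X)) (Projective.π X) (by simp)
    have hS : S.ShortExact :=
      { exact := ShortComplex.exact_of_f_is_kernel _ (Limits.kernelIsKernel _)
        mono_f := inferInstanceAs (Mono (Limits.kernel.ι (Projective.π X)))
        epi_g := inferInstanceAs (Epi (Projective.π X)) }
    have hp : Projective S.X₂ := inferInstanceAs (Projective (Projective.over X))
    have h1 := (hS.hasProjectiveDimensionLT_X₃_iff n hp).1 h
    obtain ⟨Q, hQ⟩ := ih _ h1
    obtain ⟨P, hP⟩ := exists_splice S hS Q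
    refine ⟨P, fun i hi => ?_⟩
    obtain ⟨j, rfl⟩ : ∃ j, i = j+1 := ⟨i-1, by omega⟩
    exact (hQ j (by omega)).of_iso (hP j).some
end
end S8
end

section
open CategoryTheory

namespace S8
universe u
open TensorProduct Polynomial

abbrev pdLE (R : Type u) [CommRing R] (M : Type u) [AddCommGroup M] [Module R M] (n : ℕ) : Prop :=
  HasProjectiveDimensionLE (ModuleCat.of R M) n

section
variable {R : Type u} [CommRing R]
variable {M M₁ M₂ M₃ : Type u} [AddCommGroup M] [Module R M] [AddCommGroup M₁] [Module R M₁]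
  [AddCommGroup M₂] [Module R M₂] [AddCommGroup M₃] [Module R M₃]

def scOf (f : M₁ →ₗ[R] M₂) (g : M₂ →ₗ[R] M₃) (h : Function.Exact f g) :
    ShortComplex (ModuleCat.{u} R) :=
  ShortComplex.mk (ModuleCat.ofHom f) (ModuleCat.ofHom g) (by
    ext x
    exact (h (f x)).2 ⟨x, rfl⟩)

lemma scOf_shortExact (f : M₁ →ₗ[R] M₂) (g : M₂ →ₗ[R] M₃) (h : Function.Exact f g)
    (hf : Function.Injective f) (hg : Function.Surjective g) : (scOf f g h).ShortExact :=
  { exact := (ShortComplex.ShortExact.moduleCat_exact_iff_function_exact _).2 h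
    mono_f := (ModuleCat.mono_iff_injective _).2 hf
    epi_g := (ModuleCat.epi_iff_surjective _).2 hg }

lemma pdLE_X3 (f : M₁ →ₗ[R] M₂) (g : M₂ →ₗ[R] M₃) (h : Function.Exact f g)
    (hf : Function.Injective f) (hg : Function.Surjective g) (n : ℕ)
    (h1 : pdLE R M₁ n) (h2 : pdLE R M₂ (n+1)) : pdLE R M₃ (n+1) :=
  (scOf_shortExact f g h hf hg).hasProjectiveDimensionLT_X₃ (n+1) h1 h2

lemma pdLE_X1 (f : M₁ →ₗ[R] M₂) (g : M₂ →ₗ[R] M₃) (h : Function.Exact f g)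
    (hf : Function.Injective f) (hg : Function.Surjective g) (n : ℕ)
    (h2 : pdLE R M₂ n) (h3 : pdLE R M₃ (n+1)) : pdLE R M₁ n :=
  (scOf_shortExact f g h hf hg).hasProjectiveDimensionLT_X₁ (n+1) h2 h3

lemma pdLE_zero_iff : pdLE R M 0 ↔ Module.Projective R M := by
  rw [IsProjective.iff_projective]
  exact (projective_iff_hasProjectiveDimensionLE_zero (ModuleCat.of R M)).symm

lemma pdLE_mono {n m : ℕ} (hnm : n ≤ m) (h : pdLE R M n) : pdLE R M m :=
  hasProjectiveDimensionLT_of_ge _ (n+1) (m+1) (by omega)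

lemma pdLE_equiv (e : M₁ ≃ₗ[R] M₂) {n : ℕ} (h : pdLE R M₁ n) : pdLE R M₂ n :=
  ModuleCat.hasProjectiveDimensionLE_of_linearEquiv.{u,u} (M := ModuleCat.of R M₁)
    (N := ModuleCat.of R M₂) e n

lemma lT_exact (T : Type u) [CommRing T] [Algebra R T] (f : M₁ →ₗ[R] M₂) (g : M₂ →ₗ[R] M₃)
    (h : Function.Exact f g) (hg : Function.Surjective g) :
    Function.Exact (f.baseChange T) (g.baseChange T) :=
  lTensor_exact T h hg

lemma exists_pres (M : Type u) [AddCommGroup M] [Module R M] :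
    ∃ (K F : Type u) (_ : AddCommGroup K) (_ : AddCommGroup F) (_ : Module R K) (_ : Module R F)
      (f : K →ₗ[R] F) (g : F →ₗ[R] M), Module.Projective R F ∧ Function.Exact f g ∧
        Function.Injective f ∧ Function.Surjective g :=
  ⟨LinearMap.ker (Finsupp.linearCombination R (id : M → M)), M →₀ R, inferInstance, inferInstance,
    inferInstance, inferInstance, Submodule.subtype _, Finsupp.linearCombination R id,
    inferInstance, LinearMap.exact_subtype_ker_map _, Submodule.injective_subtype _,
    Finsupp.linearCombination_id_surjective R M⟩

lemma pdLE_baseChange (T : Type u) [CommRing T] [Algebra R T] [Module.Flat R T] (n : ℕ)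
    (M : Type u) [AddCommGroup M] [Module R M]
    (h : pdLE R M n) : pdLE T (T ⊗[R] M) n := by
  induction n generalizing M with
  | zero =>
    rw [pdLE_zero_iff] at h ⊢
    infer_instance
  | succ n ih =>
    obtain ⟨K, F, iK, iF, mK, mF, f, g, hp, hex, hf, hg⟩ := exists_pres (R := R) M
    have hK : pdLE R K n := pdLE_X1 f g hex hf hg n
      (pdLE_mono (Nat.zero_le _) (pdLE_zero_iff.2 hp)) h
    have hKT := ih _ hK
    have hp2 : Module.Projective T (T ⊗[R] F) := inferInstance
    refine pdLE_X3 (f.baseChange T) (g.baseChange T) (lT_exact T f g hex hg) ?_ ?_ n hKT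
      (pdLE_mono (Nat.zero_le _) (pdLE_zero_iff.2 hp2))
    · exact Module.Flat.lTensor_preserves_injective_linearMap f hf
    · exact LinearMap.lTensor_surjective T hg

end

section poly
variable {S : Type u} [CommRing S] {M : Type u} [AddCommGroup M] [Module S M] [Module S[X] M]
  [IsScalarTower S S[X] M]

variable (S M) in
noncomputable def xM : M →ₗ[S] M := (LinearMap.lsmul S[X] M X).restrictScalars S

variable (S M) in
noncomputable def phiM : (S[X] ⊗[S] M) →ₗ[S[X]] (S[X] ⊗[S] M) :=
  (X : S[X]) • LinearMap.id - (xM S M).baseChange S[X]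

lemma phiM_tmul (p : S[X]) (m : M) :
    phiM S M (p ⊗ₜ m) = (X * p) ⊗ₜ m - p ⊗ₜ ((X : S[X]) • m) := by
  simp [phiM, xM, smul_tmul']

variable (S M) in
noncomputable def epsM : (S[X] ⊗[S] M) →ₗ[S[X]] M := LinearMap.liftBaseChange S[X] LinearMap.id

lemma epsM_tmul (p : S[X]) (m : M) : epsM S M (p ⊗ₜ m) = p • m := by
  simp [epsM]

lemma epsM_surj : Function.Surjective (epsM S M) := fun m => ⟨1 ⊗ₜ m, by simp [epsM_tmul]⟩

lemma eps_phi (u : S[X] ⊗[S] M) : epsM S M (phiM S M u) = 0 := by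
  induction u with
  | zero => simp
  | add x y hx hy => simp [hx, hy]
  | tmul p m => rw [phiM_tmul, map_sub, epsM_tmul, epsM_tmul, ← mul_smul, mul_comm, sub_self]

lemma mem_range_phi_X (n : ℕ) (m : M) :
    ((X : S[X])^n) ⊗ₜ[S] m - 1 ⊗ₜ ((X : S[X])^n • m) ∈ LinearMap.range (phiM S M) := by
  induction n generalizing m with
  | zero => simp
  | succ n ih =>
    have h1 := ih ((X : S[X]) • m)
    have h2 : phiM S M (((X : S[X])^n) ⊗ₜ m) ∈ LinearMap.range (phiM S M) := ⟨_, rfl⟩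
    have := add_mem h1 h2
    rw [phiM_tmul] at this
    convert this using 1
    rw [← mul_smul, ← pow_succ, ← pow_succ']
    abel

lemma mem_range_phi (u : S[X] ⊗[S] M) :
    u - 1 ⊗ₜ (epsM S M u) ∈ LinearMap.range (phiM S M) := by
  induction u with
  | zero => simp
  | add x y hx hy =>
    have := add_mem hx hy
    convert this using 1
    rw [map_add, tmul_add]; abel
  | tmul p m =>
    induction p using Polynomial.induction_on' with
    | add p q hp hq =>
      have := add_mem hp hq
      convert this using 1
      simp only [epsM_tmul, add_tmul, add_smul, tmul_add, map_add]; abel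
    | monomial n a =>
      have h := mem_range_phi_X (S := S) n (a • m)
      convert h using 1
      rw [epsM_tmul, ← C_mul_X_pow_eq_monomial, ← smul_eq_C_mul, smul_tmul, smul_assoc, smul_comm]

lemma phi_inj : Function.Injective (phiM S M) := by
  rw [injective_iff_map_eq_zero]
  intro u hu
  let e : S[X] ⊗[S] M ≃ₗ[S] (ℕ →₀ M) := TensorProduct.equivFinsuppOfBasisLeft (Polynomial.basisMonomials S)
  have he : ∀ p m i, e (p ⊗ₜ m) i = p.coeff i • m := by
    intro p m i
    simp [e, TensorProduct.equivFinsuppOfBasisLeft_apply_tmul_apply]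
    rfl
  have key : ∀ v : S[X] ⊗[S] M, ∀ n, e (phiM S M v) (n+1) = e v n - (X : S[X]) • e v (n+1) := by
    intro v n
    induction v with
    | zero => simp
    | add x y hx hy => simp only [map_add, Finsupp.add_apply, hx, hy, smul_add]; abel
    | tmul p m =>
      rw [phiM_tmul, map_sub, Finsupp.sub_apply, he, he, he, he, coeff_X_mul, smul_comm]
  have h1 : ∀ n, e u n = (X : S[X]) • e u (n+1) := by
    intro n
    have := key u n
    rw [hu, map_zero, Finsupp.zero_apply] at this
    exact (sub_eq_zero.1 this.symm)
  have h2 : ∀ k n, e u n = (X : S[X])^k • e u (n+k) := by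
    intro k
    induction k with
    | zero => simp
    | succ k ih => intro n; rw [ih, h1 (n+k), ← mul_smul, ← pow_succ, add_assoc]
  have h3 : e u = 0 := by
    ext n
    obtain ⟨b, hb⟩ := (e u).support.bddAbove
    rw [h2 (b+1) n, Finsupp.notMem_support_iff.1, smul_zero, Finsupp.zero_apply]
    intro hmem
    have := hb hmem
    omega
  exact e.map_eq_zero_iff.1 h3

lemma pdLE_polynomial (n : ℕ) (h : pdLE S M n) : pdLE S[X] M (n+1) := by
  have h1 : pdLE S[X] (S[X] ⊗[S] M) n := pdLE_baseChange S[X] n M h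
  refine pdLE_X3 (phiM S M) (epsM S M) ?_ phi_inj epsM_surj n h1 (pdLE_mono (Nat.le_succ n) h1)
  intro u
  constructor
  · intro hu
    have := mem_range_phi u
    rw [hu, tmul_zero, sub_zero] at this
    exact this
  · rintro ⟨v, rfl⟩
    exact eps_phi v
end poly
end S8
end

section
open CategoryTheory

namespace S8
universe u
open TensorProduct Polynomial

section
variable {R : Type u} [CommRing R] [IsDomain R]

lemma pdLE_self : pdLE R R 0 := pdLE_zero_iff.2 inferInstance

lemma pdLE_quot1 (f : R) (hf : f ≠ 0) : pdLE R (R ⧸ Ideal.span {f}) 1 := by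
  refine pdLE_X3 (LinearMap.lsmul R R f) (Submodule.mkQ (Ideal.span {f})) ?_ ?_
    (Submodule.mkQ_surjective _) 0 pdLE_self (pdLE_mono (Nat.zero_le _) pdLE_self)
  · intro y
    rw [Submodule.mkQ_apply, Submodule.Quotient.mk_eq_zero, Ideal.mem_span_singleton']
    constructor
    · rintro ⟨a, rfl⟩; exact ⟨a, by simp [mul_comm]⟩
    · rintro ⟨a, rfl⟩; exact ⟨a, by simp [mul_comm]⟩
  · intro a b hab
    simpa [hf] using hab

lemma pdLE_quot2 (f g : R) (hf : f ≠ 0) (hfg : ∀ a, f ∣ g * a → f ∣ a) :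
    pdLE R (R ⧸ Ideal.span {f, g}) 2 := by
  have hle : Ideal.span {f} ≤ Ideal.span {f, g} := Ideal.span_mono (by simp)
  refine pdLE_X3 (LinearMap.lsmul R (R ⧸ Ideal.span {f}) g)
    (Submodule.factor hle) ?_ ?_
    (Submodule.factor_surjective hle) 1 (pdLE_quot1 f hf) (pdLE_mono (Nat.le_succ _) (pdLE_quot1 f hf))
  · intro y
    obtain ⟨y, rfl⟩ := Submodule.Quotient.mk_surjective _ y
    have : Submodule.factor hle (Submodule.Quotient.mk y) = Submodule.Quotient.mk y := rfl
    rw [this, Submodule.Quotient.mk_eq_zero, Ideal.mem_span_pair]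
    constructor
    · rintro ⟨a, b, rfl⟩
      refine ⟨Submodule.Quotient.mk b, ?_⟩
      rw [LinearMap.lsmul_apply, ← Submodule.Quotient.mk_smul, Submodule.Quotient.eq,
        Ideal.mem_span_singleton]
      exact ⟨-a, by simp; ring⟩
    · rintro ⟨b, hb⟩
      obtain ⟨b, rfl⟩ := Submodule.Quotient.mk_surjective _ b
      rw [LinearMap.lsmul_apply, ← Submodule.Quotient.mk_smul, Submodule.Quotient.eq,
        Ideal.mem_span_singleton] at hb
      obtain ⟨c, hc⟩ := hb
      refine ⟨-c, b, ?_⟩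
      simp only [smul_eq_mul] at hc
      linear_combination hc
  · rw [injective_iff_map_eq_zero]
    intro y hy
    obtain ⟨y, rfl⟩ := Submodule.Quotient.mk_surjective _ y
    rw [LinearMap.lsmul_apply, ← Submodule.Quotient.mk_smul, Submodule.Quotient.mk_eq_zero,
        Ideal.mem_span_singleton] at hy
    rw [Submodule.Quotient.mk_eq_zero, Ideal.mem_span_singleton]
    exact hfg _ hy

/-- the annihilator of `h` in `R/(f,g)`. -/
def annQ (f g h : R) : Submodule R (R ⧸ Ideal.span {f, g}) :=
  LinearMap.ker (LinearMap.lsmul R (R ⧸ Ideal.span {f, g}) h)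

lemma pdLE_quot3 (f g h : R) (hf : f ≠ 0) (hfg : ∀ a, f ∣ g * a → f ∣ a)
    (hM : pdLE R (annQ f g h) 2) : pdLE R (R ⧸ Ideal.span {f, g, h}) 4 := by
  have hle : Ideal.span {f, g} ≤ Ideal.span {f, g, h} :=
    Ideal.span_mono (by intro x; simp; tauto)
  let μ := LinearMap.lsmul R (R ⧸ Ideal.span {f, g}) h
  have h2 := pdLE_quot2 f g hf hfg
  have hr : pdLE R (LinearMap.range μ) 3 := by
    refine pdLE_X3 (annQ f g h).subtype μ.rangeRestrict ?_ (Submodule.injective_subtype _)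
      μ.surjective_rangeRestrict 2 hM (pdLE_mono (Nat.le_succ _) h2)
    intro y
    constructor
    · intro hy
      exact ⟨⟨y, congrArg Subtype.val hy⟩, rfl⟩
    · rintro ⟨y, rfl⟩
      exact Subtype.ext y.2
  refine pdLE_X3 (LinearMap.range μ).subtype (Submodule.factor hle) ?_
    (Submodule.injective_subtype _) (Submodule.factor_surjective hle) 3 hr
    (pdLE_mono (by omega) h2)
  intro y
  obtain ⟨y, rfl⟩ := Submodule.Quotient.mk_surjective _ y
  have : Submodule.factor hle (Submodule.Quotient.mk y) = Submodule.Quotient.mk y := rfl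
  rw [this, Submodule.Quotient.mk_eq_zero]
  constructor
  · intro hy
    rw [Ideal.mem_span_insert] at hy
    obtain ⟨a, z, hz, rfl⟩ := hy
    rw [Ideal.mem_span_pair] at hz
    obtain ⟨b, c, rfl⟩ := hz
    refine ⟨⟨μ (Submodule.Quotient.mk c), ⟨_, rfl⟩⟩, ?_⟩
    show μ (Submodule.Quotient.mk c) = _
    rw [LinearMap.lsmul_apply, ← Submodule.Quotient.mk_smul, Submodule.Quotient.eq,
        Ideal.mem_span_pair]
    exact ⟨-a, -b, by simp; ring⟩
  · rintro ⟨⟨_, ⟨c, rfl⟩⟩, hc⟩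
    obtain ⟨c, rfl⟩ := Submodule.Quotient.mk_surjective _ c
    change μ (Submodule.Quotient.mk c) = _ at hc
    rw [LinearMap.lsmul_apply, ← Submodule.Quotient.mk_smul, Submodule.Quotient.eq] at hc
    have h3 := hle hc
    have h4 : h * c ∈ Ideal.span {f, g, h} := Ideal.mul_mem_right _ _ (Ideal.subset_span (by simp))
    have := sub_mem h4 h3
    simpa using this
end

lemma pdLE_main {A : Type u} [CommRing A] [IsDomain A] (f g h : A[X][X]) (hf : f ≠ 0)
    (hfg : ∀ a, f ∣ g * a → f ∣ a) (hM : Module.Projective A (annQ f g h)) :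
    pdLE A[X][X] (A[X][X] ⧸ Ideal.span {f, g, h}) 4 := by
  apply pdLE_quot3 f g h hf hfg
  have h0 : pdLE A (annQ f g h) 0 := pdLE_zero_iff.2 hM
  exact pdLE_polynomial 1 (pdLE_polynomial 0 h0)

/-- transport along a ring isomorphism -/
lemma pdLE_of_ringEquiv {R R' : Type u} [CommRing R] [CommRing R'] (e : R ≃+* R')
    (I : Ideal R) (I' : Ideal R') (hI : I' = I.map (e : R →+* R')) (n : ℕ)
    (h : pdLE R' (R' ⧸ I') n) :
    pdLE R (R ⧸ I) n := by
  let q : (R ⧸ I) ≃+* (R' ⧸ I') := Ideal.quotientEquiv I I' e hI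
  letI := RingHomInvPair.of_ringEquiv e.symm
  letI := RingHomInvPair.symm (RingHomClass.toRingHom e.symm) (RingHomClass.toRingHom e.symm.symm)
  let e' : ModuleCat.of R' (R' ⧸ I') ≃ₛₗ[RingHomClass.toRingHom e.symm] ModuleCat.of R (R ⧸ I) :=
    { q.symm.toAddEquiv with
      map_smul' := by
        intro r x
        obtain ⟨x, rfl⟩ := Ideal.Quotient.mk_surjective x
        show q.symm (Ideal.Quotient.mk I' (r * x)) = _
        rw [map_mul, map_mul]
        rfl }
  have : HasProjectiveDimensionLE (ModuleCat.of R' (R' ⧸ I')) n := h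
  exact ModuleCat.hasProjectiveDimensionLE_of_semiLinearEquiv.{u,u} e.symm e' n
end S8
end

section
namespace S8
universe u
open Polynomial

section
variable {A S : Type u} [CommRing A] [CommRing S] [Algebra A S]

/-- coefficient of `X^(n-1)` of the remainder mod `p`, `n = deg p`. -/
noncomputable def tauP (p : S[X]) : S[X] →ₗ[S] S :=
  (lcoeff S (p.natDegree - 1)).comp (modByMonicHom p)

lemma tauP_apply (p x : S[X]) : tauP p x = (x %ₘ p).coeff (p.natDegree - 1) := rfl

lemma tauP_dvd {p : S[X]} (hp : p.Monic) {x : S[X]} (h : p ∣ x) : tauP p x = 0 := by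
  rw [tauP_apply, (modByMonic_eq_zero_iff_dvd hp).2 h, coeff_zero]

lemma tauP_lt {p x : S[X]} (hp : p.Monic) (h : x.degree < p.degree) :
    tauP p x = x.coeff (p.natDegree - 1) := by
  nontriviality S
  rw [tauP_apply, (modByMonic_eq_self_iff hp).2 h]

lemma tauP_C_mul (p : S[X]) (c : S) (x : S[X]) : tauP p (C c * x) = c * tauP p x := by
  rw [← smul_eq_C_mul, map_smul, smul_eq_mul]

lemma tauP_inj {p : S[X]} (hp : p.Monic) (hn : 1 ≤ p.natDegree) (a : S[X])
    (h : ∀ x, tauP p (a * x) = 0) : p ∣ a := by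
  nontriviality S
  rw [← modByMonic_eq_zero_iff_dvd hp]
  by_contra hr
  set r := a %ₘ p with hrdef
  have hlt : r.natDegree < p.natDegree :=
    natDegree_modByMonic_lt a hp (by rintro rfl; simp at hn)
  have h1 : tauP p (r * X ^ (p.natDegree - 1 - r.natDegree)) = 0 := by
    rw [← h (X ^ (p.natDegree - 1 - r.natDegree))]
    have : a * X ^ (p.natDegree - 1 - r.natDegree) = r * X ^ (p.natDegree - 1 - r.natDegree)
      + p * (a /ₘ p * X ^ (p.natDegree - 1 - r.natDegree)) := by
      have := modByMonic_add_div a p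
      conv_lhs => rw [← this]
      ring
    rw [this, map_add, tauP_dvd hp (Dvd.intro _ rfl), add_zero]
  have hnd : (r * X ^ (p.natDegree - 1 - r.natDegree)).natDegree = p.natDegree - 1 := by
    rw [natDegree_mul_X_pow]; · omega
    · exact hr
  rw [tauP_lt hp (degree_lt_degree (by omega))] at h1
  have h3 : p.natDegree - 1 = r.natDegree + (p.natDegree - 1 - r.natDegree) := by omega
  have h2 : (r * X ^ (p.natDegree - 1 - r.natDegree)).coeff (p.natDegree - 1) = r.leadingCoeff := by
    conv_lhs => rw [h3]
    simp
  rw [h2] at h1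
  exact hr (leadingCoeff_eq_zero.1 h1)

lemma tauP_surj [Nontrivial S] {p : S[X]} (hp : p.Monic) (σ : S →ₗ[A] A) (φ : S[X] →ₗ[A] A)
    (hφ : ∀ x, φ (p * x) = 0) (hrep : ∀ x : S[X], ∃ c : S, ∀ y : S, φ (C y * x) = σ (c * y)) :
    ∃ g : S[X], ∀ x, φ x = σ (tauP p (g * x)) := by
  have key : ∀ m, m ≤ p.natDegree → ∃ g : S[X], ∀ j < m, ∀ y : S,
      φ (C y * X ^ j) = σ (tauP p (g * (C y * X ^ j))) := by
    intro m
    induction m with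
    | zero => intro _; exact ⟨0, by simp⟩
    | succ m ih =>
      intro hm
      obtain ⟨g, hg⟩ := ih (by omega)
      obtain ⟨c, hc⟩ := hrep (X ^ m)
      have hcoef : ∀ (e : S) j y, j < m + 1 → tauP p (C e * X ^ (p.natDegree - 1 - m) * (C y * X ^ j)) =
          if j = m then e * y else 0 := by
        intro e j y hj
        have : C e * X ^ (p.natDegree - 1 - m) * (C y * X ^ j) =
          C (e * y) * X ^ (p.natDegree - 1 - m + j) := by
          rw [C_mul, pow_add]; ring
        rw [this, tauP_lt hp, coeff_C_mul_X_pow]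
        · congr 1
          simp only [eq_iff_iff]; omega
        · refine lt_of_le_of_lt (degree_C_mul_X_pow_le _ _) ?_
          rw [degree_eq_natDegree hp.ne_zero]
          exact_mod_cast (by omega)
      refine ⟨g + C (c - tauP p (g * X ^ m)) * X ^ (p.natDegree - 1 - m), ?_⟩
      intro j hj y
      rw [add_mul, map_add, hcoef _ _ _ hj]
      split_ifs with h
      · subst h
        have : g * (C y * X ^ j) = C y * (g * X ^ j) := by ring
        rw [hc, this, tauP_C_mul]
        congr 1; ring
      · rw [add_zero]; exact hg j (by omega) y
  obtain ⟨g, hg⟩ := key _ le_rfl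
  refine ⟨g, fun x => ?_⟩
  have hx := modByMonic_add_div x p
  have h1 : φ x = φ (x %ₘ p) := by
    conv_lhs => rw [← hx]
    rw [map_add, hφ, add_zero]
  have h2 : tauP p (g * x) = tauP p (g * (x %ₘ p)) := by
    conv_lhs => rw [← hx]
    rw [mul_add, map_add, tauP_dvd hp (x := g * (p * (x /ₘ p))) ⟨g * (x /ₘ p), by ring⟩, add_zero]
  rw [h1, h2]
  have hdeg : (x %ₘ p).degree < p.natDegree := by
    rw [← degree_eq_natDegree hp.ne_zero]; exact degree_modByMonic_lt _ hp
  have hlt : ∀ i ∈ (x %ₘ p).support, i < p.natDegree := by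
    intro i hi
    have := le_degree_of_mem_supp i hi
    exact_mod_cast lt_of_le_of_lt this hdeg
  rw [(x %ₘ p).as_sum_support_C_mul_X_pow, Finset.mul_sum, map_sum, map_sum, map_sum]
  exact Finset.sum_congr rfl fun i hi => hg i (hlt i hi) _
end

section dual
variable {A : Type u} [CommRing A] [IsDomain A] {f g h' u : A[X][X]} {δ : A[X]}

structure DualData (f g h' u : A[X][X]) (δ : A[X]) : Prop where
  hf : f.Monic
  hf1 : 1 ≤ f.natDegree
  hδ : δ.Monic
  hδ1 : 1 ≤ δ.natDegree
  rel : C δ = u * f + h' * g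

lemma DualData.δreg (D : DualData f g h' u δ) {z : A[X][X]} (h : f ∣ C δ * z) : f ∣ z := by
  rw [← modByMonic_eq_zero_iff_dvd D.hf] at h ⊢
  rw [← smul_eq_C_mul, smul_modByMonic] at h
  exact (smul_eq_zero.1 h).resolve_left D.hδ.ne_zero

lemma DualData.greg (D : DualData f g h' u δ) {z : A[X][X]} (h : f ∣ g * z) : f ∣ z := by
  apply D.δreg
  obtain ⟨c, hc⟩ := h
  exact ⟨u * z + h' * c, by rw [D.rel]; linear_combination h' * hc⟩

lemma DualData.hreg (D : DualData f g h' u δ) {z : A[X][X]} (h : f ∣ h' * z) : f ∣ z := by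
  apply D.δreg
  obtain ⟨c, hc⟩ := h
  exact ⟨u * z + g * c, by rw [D.rel]; linear_combination g * hc⟩

noncomputable def lamP (f : A[X][X]) (δ : A[X]) : A[X][X] →ₗ[A] A :=
  (tauP δ).comp ((tauP f).restrictScalars A)

lemma lamP_apply (x : A[X][X]) : lamP f δ x = tauP δ (tauP f x) := rfl

/-- if `x ↦ σ(τ(b x))` kills everything then `b ≡ δ c` mod `f`. -/
lemma DualData.div (D : DualData f g h' u δ) (b : A[X][X]) (hb : ∀ x, lamP f δ (b * x) = 0) :
    ∃ c, f ∣ b - C δ * c := by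
  have h1 : ∀ x, δ ∣ tauP f (b * x) := by
    intro x
    apply tauP_inj D.hδ D.hδ1
    intro y
    have := hb (C y * x)
    rw [lamP_apply, show b * (C y * x) = C y * (b * x) by ring, tauP_C_mul, mul_comm] at this
    exact this
  choose w hw using h1
  let ψ : A[X][X] →ₗ[A[X]] A[X] :=
    { toFun := w
      map_add' := fun x y => by
        apply mul_left_cancel₀ D.hδ.ne_zero
        rw [mul_add, ← hw, ← hw, ← hw, mul_add, map_add]
      map_smul' := fun c x => by
        apply mul_left_cancel₀ D.hδ.ne_zero
        rw [← hw, RingHom.id_apply, mul_smul_comm, map_smul, smul_eq_mul, smul_eq_mul,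
          mul_left_comm, ← hw] }
  have hψ : ∀ x, tauP f (b * x) = δ * ψ x := hw
  obtain ⟨c, hc⟩ := tauP_surj (A := A[X]) D.hf LinearMap.id ψ (by
      intro x
      apply mul_left_cancel₀ D.hδ.ne_zero
      rw [← hψ, mul_zero, tauP_dvd D.hf ⟨b * x, by ring⟩]) (by
      intro x
      refine ⟨ψ x, fun y => ?_⟩
      rw [← smul_eq_C_mul, map_smul, smul_eq_mul, mul_comm]; rfl)
  refine ⟨c, ?_⟩
  apply tauP_inj D.hf D.hf1
  intro x
  rw [sub_mul, map_sub, hψ, hc, mul_assoc, tauP_C_mul, LinearMap.id_apply, sub_self]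

lemma DualData.kills (D : DualData f g h' u δ) {a : A[X][X]} (ha : a ∈ Ideal.span {f, g}) :
    lamP f δ (h' * a) = 0 := by
  rw [Ideal.mem_span_pair] at ha
  obtain ⟨b, c, rfl⟩ := ha
  have : h' * (b * f + c * g) = C δ * c + f * (h' * b - u * c) := by
    rw [D.rel]; ring
  rw [this, map_add, lamP_apply, lamP_apply, tauP_dvd D.hf ⟨_, rfl⟩, tauP_C_mul,
    tauP_dvd D.hδ ⟨_, rfl⟩, map_zero, add_zero]

lemma DualData.inj (D : DualData f g h' u δ) (a : A[X][X])
    (ha : ∀ x, lamP f δ (h' * (a * x)) = 0) : a ∈ Ideal.span {f, g} := by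
  obtain ⟨c, hc⟩ := D.div (h' * a) (fun x => by rw [mul_assoc]; exact ha x)
  have : f ∣ h' * (a - g * c) := by
    obtain ⟨e, he⟩ := hc
    exact ⟨e + u * c, by rw [D.rel] at he; linear_combination he⟩
  obtain ⟨e, he⟩ := D.hreg this
  rw [Ideal.mem_span_pair]
  exact ⟨e, c, by linear_combination -he⟩

lemma DualData.surj (D : DualData f g h' u δ) (φ : A[X][X] →ₗ[A] A)
    (hφ : ∀ x ∈ Ideal.span {f, g}, φ x = 0) : ∃ a, ∀ x, φ x = lamP f δ (h' * (a * x)) := by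
  have hδm : C δ ∈ Ideal.span {f, g} := by
    rw [Ideal.mem_span_pair]; exact ⟨u, h', D.rel.symm⟩
  obtain ⟨b, hb⟩ := tauP_surj D.hf (tauP δ) φ
    (fun x => hφ _ (Ideal.mul_mem_right _ _ (Ideal.subset_span (by simp)))) (by
      intro x
      let φ' : A[X] →ₗ[A] A := 
        { toFun := fun y => φ (C y * x)
          map_add' := fun y z => by rw [C_add, add_mul, map_add]
          map_smul' := fun c y => by
            rw [RingHom.id_apply, ← map_smul, ← smul_mul_assoc, smul_C] }
      obtain ⟨c, hc⟩ := tauP_surj D.hδ (LinearMap.id : A →ₗ[A] A) φ' (by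
          intro y
          show φ (C (δ * y) * x) = 0
          rw [C_mul, mul_assoc]
          exact hφ _ (Ideal.mul_mem_right _ _ hδm)) (by
          intro y
          refine ⟨φ' y, fun z => ?_⟩
          rw [← smul_eq_C_mul, map_smul, smul_eq_mul, mul_comm]; rfl)
      exact ⟨c, hc⟩)
  have h0 : ∀ x, lamP f δ (b * g * x) = 0 := by
    intro x
    rw [lamP_apply, mul_assoc, ← hb]
    exact hφ _ (Ideal.mul_mem_right _ _ (Ideal.subset_span (by simp)))
  obtain ⟨c, hc⟩ := D.div _ h0
  have : f ∣ g * (b - h' * c) := by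
    obtain ⟨e, he⟩ := hc
    exact ⟨e + u * c, by rw [D.rel] at he; linear_combination he⟩
  obtain ⟨e, he⟩ := D.greg this
  refine ⟨c, fun x => ?_⟩
  have hbe : b * x = h' * (c * x) + f * (e * x) := by linear_combination x * he
  rw [hb, hbe, lamP_apply, map_add, tauP_dvd D.hf ⟨_, rfl⟩, add_zero]

lemma DualData.equiv (D : DualData f g h' u δ) (h : A[X][X]) :
    Nonempty (annQ f g h ≃ₗ[A] ((A[X][X] ⧸ Ideal.span {f, g, h}) →ₗ[A] A)) := by
  have hle : Ideal.span {f, g} ≤ Ideal.span {f, g, h} :=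
    Ideal.span_mono (by intro x; simp; tauto)
  let Ψ0 : A[X][X] →ₗ[A] (A[X][X] →ₗ[A] A) :=
    { toFun := fun a => (lamP f δ).comp ((LinearMap.mulLeft A (h' * a)))
      map_add' := fun a b => by ext x : 1; simp [mul_add, add_mul, mul_assoc]
      map_smul' := fun c a => by
        ext x : 1
        simp only [LinearMap.comp_apply, LinearMap.mulLeft_apply, RingHom.id_apply,
          LinearMap.smul_apply, mul_smul_comm, smul_mul_assoc, map_smul] }
  have hΨ0 : ∀ a x, Ψ0 a x = lamP f δ (h' * (a * x)) := fun a x => by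
    show lamP f δ (h' * a * x) = _
    rw [mul_assoc]
  have hker : (Ideal.span {f, g}).restrictScalars A ≤ LinearMap.ker Ψ0 := by
    intro a ha
    rw [LinearMap.mem_ker]
    ext x : 1
    rw [hΨ0]
    exact D.kills (Ideal.mul_mem_right _ _ ha)
  let Ψ : (A[X][X] ⧸ Ideal.span {f, g}) →ₗ[A] (A[X][X] →ₗ[A] A) :=
    Submodule.liftQ ((Ideal.span {f, g}).restrictScalars A) Ψ0 hker
  have hΨ : ∀ a x, Ψ (Submodule.Quotient.mk a) x = lamP f δ (h' * (a * x)) := hΨ0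
  have hΨi : Function.Injective Ψ := by
    rw [injective_iff_map_eq_zero]
    intro a ha
    obtain ⟨a, rfl⟩ := Submodule.Quotient.mk_surjective _ a
    rw [Submodule.Quotient.mk_eq_zero]
    apply D.inj
    intro x
    rw [← hΨ, ha]; rfl
  let pc : ((A[X][X] ⧸ Ideal.span {f, g, h}) →ₗ[A] A) →ₗ[A] (A[X][X] →ₗ[A] A) :=
    LinearMap.lcomp A A ((Submodule.mkQ (Ideal.span {f, g, h})).restrictScalars A)
  have hpc : ∀ φ x, pc φ x = φ (Submodule.Quotient.mk x) := fun _ _ => rfl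
  have hpci : Function.Injective pc := by
    intro φ ψ hh
    apply LinearMap.ext
    intro x
    obtain ⟨x, rfl⟩ := Submodule.Quotient.mk_surjective _ x
    rw [← hpc, ← hpc, hh]
  have hrange : ((annQ f g h).restrictScalars A).map Ψ = LinearMap.range pc := by
    ext φ
    constructor
    · rintro ⟨a, ha, rfl⟩
      obtain ⟨a, rfl⟩ := Submodule.Quotient.mk_surjective _ a
      have ha' : h * a ∈ Ideal.span {f, g} := by
        change h • (Submodule.Quotient.mk a : A[X][X] ⧸ Ideal.span {f, g}) = 0 at ha
        rw [← Submodule.Quotient.mk_smul, Submodule.Quotient.mk_eq_zero] at ha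
        exact ha
      refine ⟨Submodule.liftQ ((Ideal.span {f, g, h}).restrictScalars A)
        (Ψ (Submodule.Quotient.mk a)) ?_, ?_⟩
      · intro x hx
        rw [LinearMap.mem_ker, hΨ]
        apply D.kills
        change x ∈ Ideal.span {f, g, h} at hx
        rw [Ideal.mem_span_insert] at hx
        obtain ⟨p, z, hz, rfl⟩ := hx
        rw [Ideal.mem_span_pair] at hz
        obtain ⟨q, r, rfl⟩ := hz
        have hf : f ∈ Ideal.span {f, g} := Ideal.subset_span (by simp)
        have hg : g ∈ Ideal.span {f, g} := Ideal.subset_span (by simp)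
        have := add_mem (add_mem (Ideal.mul_mem_left _ (a * p) hf) (Ideal.mul_mem_left _ (a * q) hg))
          (Ideal.mul_mem_left _ r ha')
        convert this using 1; ring
      · ext x : 1
        rfl
    · rintro ⟨φ, rfl⟩
      have hk : ∀ x ∈ Ideal.span {f, g, h}, pc φ x = 0 := by
        intro x hx
        rw [hpc, (Submodule.Quotient.mk_eq_zero _).2 hx, map_zero]
      obtain ⟨a, ha⟩ := D.surj (pc φ) (fun x hx => hk x (hle hx))
      refine ⟨Submodule.Quotient.mk a, ?_, ?_⟩
      · change h • (Submodule.Quotient.mk a : A[X][X] ⧸ Ideal.span {f, g}) = 0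
        rw [← Submodule.Quotient.mk_smul, Submodule.Quotient.mk_eq_zero]
        apply D.inj
        intro x
        rw [show h • a * x = a * (h * x) by simp; ring, ← ha]
        exact hk _ (Ideal.mul_mem_right _ _ (Ideal.subset_span (by simp)))
      · ext x : 1
        rw [hΨ, ha]
  let e1 := Submodule.equivMapOfInjective Ψ hΨi ((annQ f g h).restrictScalars A)
  let e2 := LinearEquiv.ofEq _ _ hrange
  let e3 := (LinearEquiv.ofInjective pc hpci).symm
  exact ⟨(e1.trans e2).trans e3⟩

/-- Main output of the homological part. -/
lemma DualData.pd (D : DualData f g h' u δ) (h : A[X][X])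
    (hproj : Module.Projective A ((A[X][X] ⧸ Ideal.span {f, g, h}) →ₗ[A] A)) :
    pdLE A[X][X] (A[X][X] ⧸ Ideal.span {f, g, h}) 4 := by
  obtain ⟨e⟩ := D.equiv h
  exact pdLE_main f g h D.hf.ne_zero (fun a ha => D.greg ha) (Module.Projective.of_equiv e.symm)
end dual
end S8
end

section
namespace S8
section linsub
variable {k : Type} [Field k] {d : ℕ}

theorem exists_linEquiv (y : Fin (d+1) → k) (hy : y ≠ 0) :
    ∃ e : (Fin (d+1) → k) ≃ₗ[k] (Fin (d+1) → k), e (Pi.single 0 1) = y := by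
  obtain ⟨j, hj⟩ := Function.ne_iff.1 hy
  let e : (Fin (d+1) → k) →ₗ[k] (Fin (d+1) → k) :=
    { toFun := fun x i => x (Equiv.swap 0 j i) + (y i - (Pi.single j 1 : Fin (d+1) → k) i) * x 0
      map_add' := by intro x z; ext i; simp; ring
      map_smul' := by intro c x; ext i; simp; ring }
  have hinj : Function.Injective e := by
    rw [injective_iff_map_eq_zero]
    intro x hx
    have h1 : ∀ i, x (Equiv.swap 0 j i) + (y i - (Pi.single j 1 : Fin (d+1) → k) i) * x 0 = 0 :=
      fun i => congrFun hx i
    have h0 : x 0 = 0 := by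
      have := h1 j
      simp at this
      have h2 : y j * x 0 = 0 := by linear_combination this
      exact (mul_eq_zero.1 h2).resolve_left hj
    funext i
    have := h1 (Equiv.swap 0 j i)
    simpa [h0] using this
  refine ⟨LinearEquiv.ofInjectiveEndo e hinj, ?_⟩
  funext i
  change (Pi.single 0 1 : Fin (d+1) → k) (Equiv.swap 0 j i) +
    (y i - (Pi.single j 1 : Fin (d+1) → k) i) * (Pi.single 0 1 : Fin (d+1) → k) 0 = y i
  by_cases h : i = j
  · subst h; simp
  · by_cases h' : i = 0
    · subst h'; simp [Pi.single_apply, h, Ne.symm h]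
    · simp [Pi.single_apply, h, h', Equiv.swap_apply_of_ne_of_ne h' h]

/-- linear substitution -/
noncomputable def linHom (e : (Fin d → k) →ₗ[k] (Fin d → k)) :
    MvPolynomial (Fin d) k →ₐ[k] MvPolynomial (Fin d) k :=
  MvPolynomial.aeval (fun i => ∑ j, MvPolynomial.C (e (Pi.single j 1) i) * MvPolynomial.X j)

theorem eval_linHom (e : (Fin d → k) →ₗ[k] (Fin d → k)) (x : Fin d → k)
    (p : MvPolynomial (Fin d) k) :
    MvPolynomial.eval x (linHom e p) = MvPolynomial.eval (e x) p := by
  have : ((MvPolynomial.aeval x : MvPolynomial (Fin d) k →ₐ[k] k).comp (linHom e)) =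
      (MvPolynomial.aeval (e x)) := by
    ext i
    simp only [AlgHom.comp_apply, linHom, MvPolynomial.aeval_X, map_sum, map_mul,
      MvPolynomial.aeval_C, Algebra.algebraMap_self, RingHom.id_apply]
    conv_rhs => rw [← Finset.univ_sum_single x]
    rw [map_sum, Finset.sum_apply]
    refine Finset.sum_congr rfl fun j _ => ?_
    have : (Pi.single j (x j) : Fin d → k) = x j • Pi.single j 1 := by
      rw [← Pi.single_smul]; simp
    rw [this, map_smul, Pi.smul_apply, smul_eq_mul, mul_comm]
  exact DFunLike.congr_fun this p

theorem linHom_hom (e : (Fin d → k) →ₗ[k] (Fin d → k)) {p : MvPolynomial (Fin d) k} {n : ℕ}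
    (hp : p.IsHomogeneous n) : (linHom e p).IsHomogeneous n := by
  have := hp.aeval (fun i => ∑ j, MvPolynomial.C (e (Pi.single j 1) i) * MvPolynomial.X j) (n := 1)
    (fun i => MvPolynomial.IsHomogeneous.sum _ _ _ fun j _ => by
      simpa using (MvPolynomial.isHomogeneous_C _ _).mul (MvPolynomial.isHomogeneous_X k j))
  rw [one_mul] at this
  exact this

/-- linear automorphism -/
noncomputable def linSub [Infinite k] (e : (Fin d → k) ≃ₗ[k] (Fin d → k)) :
    MvPolynomial (Fin d) k ≃ₐ[k] MvPolynomial (Fin d) k :=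
  AlgEquiv.ofAlgHom (linHom e) (linHom e.symm)
    (by apply AlgHom.ext; intro p; apply MvPolynomial.funext; intro x
        simp [eval_linHom])
    (by apply AlgHom.ext; intro p; apply MvPolynomial.funext; intro x
        simp [eval_linHom])

theorem eval_linSub [Infinite k] (e : (Fin d → k) ≃ₗ[k] (Fin d → k)) (x : Fin d → k)
    (p : MvPolynomial (Fin d) k) :
    MvPolynomial.eval x (linSub e p) = MvPolynomial.eval (e x) p := eval_linHom _ _ _

theorem linSub_hom [Infinite k] (e : (Fin d → k) ≃ₗ[k] (Fin d → k)) {p : MvPolynomial (Fin d) k}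
    {n : ℕ} (hp : p.IsHomogeneous n) : (linSub e p).IsHomogeneous n := linHom_hom _ hp

theorem linSub_symm [Infinite k] (e : (Fin d → k) ≃ₗ[k] (Fin d → k)) :
    (linSub e).symm = linSub e.symm := rfl
end linsub

section nss
variable {k : Type} [Field k] [IsAlgClosed k] {d : ℕ}

theorem exists_pt (π b : MvPolynomial (Fin (d+2)) k) (hπ : π = 0 ∨ Prime π) (hb : ¬ π ∣ b) :
    ∃ y : Fin (d+2) → k, y ≠ 0 ∧ MvPolynomial.eval y π = 0 ∧ MvPolynomial.eval y b ≠ 0 := by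
  by_contra hcon
  push Not at hcon
  have hpr : (Ideal.span {π}).IsPrime := by
    rcases hπ with rfl | h
    · simpa using Ideal.isPrime_bot
    · exact (Ideal.span_singleton_prime h.ne_zero).2 h
  have key : ∀ i, π ∣ MvPolynomial.X i := by
    intro i
    have h1 : b * MvPolynomial.X i ∈ (Ideal.span {π}).radical := by
      rw [← MvPolynomial.vanishingIdeal_zeroLocus_eq_radical (K := k),
        MvPolynomial.mem_vanishingIdeal_iff]
      intro x hx
      rw [MvPolynomial.zeroLocus_span] at hx
      have hx' : MvPolynomial.eval x π = 0 := by simpa using hx π rfl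
      by_cases h0 : x = 0
      · simp [h0]
      · have := hcon x h0 hx'
        rw [map_mul]
        have h2 : MvPolynomial.aeval x b = MvPolynomial.eval x b := rfl
        rw [h2, this, zero_mul]
    rw [hpr.radical] at h1
    have := (hpr.mem_or_mem h1).resolve_left (fun h => hb (Ideal.mem_span_singleton.1 h))
    exact Ideal.mem_span_singleton.1 this
  have k0 := key 0
  have k1 := key 1
  rcases hπ with rfl | h
  · rw [zero_dvd_iff] at k0
    exact MvPolynomial.X_ne_zero _ k0
  · have hX : Irreducible (MvPolynomial.X 0 : MvPolynomial (Fin (d+2)) k) :=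
      (MvPolynomial.X_prime).irreducible
    have := (h.irreducible.associated_of_dvd hX k0).symm.dvd.trans k1
    rw [MvPolynomial.X_dvd_X] at this
    simp at this
end nss

section order
open Polynomial
variable {A W : Type} [CommRing A] [CommRing W] [IsDomain W]

/-- a T^i goes to φ(a) T^i z^i -/
noncomputable def thetaHom (φ : A →+* W[X]) : A[X] →+* W[X][X] :=
  eval₂RingHom ((mapRingHom (C : W →+* W[X])).comp φ) (C X * X)

theorem coeff_thetaHom (φ : A →+* W[X]) (P : A[X]) (e i : ℕ) :
    ((thetaHom φ P).coeff e).coeff i = if i ≤ e then (φ (P.coeff i)).coeff (e - i) else 0 := by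
  induction P using Polynomial.induction_on' with
  | add p q hp hq =>
    simp only [map_add, coeff_add, hp, hq]
    split_ifs <;> simp
  | monomial n a =>
    have : thetaHom φ (monomial n a) = (φ a).map C * C (X^n) * X^n := by
      simp [thetaHom, mul_pow, mul_assoc]
    rw [this, coeff_mul_X_pow']
    by_cases h : n ≤ e
    · rw [if_pos h, coeff_mul_C, coeff_map, coeff_C_mul, coeff_X_pow, coeff_monomial]
      by_cases hi : i = n
      · subst hi; simp [h]
      · simp [hi, Ne.symm hi]
    · rw [if_neg h, coeff_monomial]
      by_cases hi : i = n
      · subst hi; simp [h]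
      · simp [Ne.symm hi]

theorem thetaHom_coeff_ne (φ : A →+* W[X]) {P : A[X]} (hP : P.Monic) :
    (thetaHom φ P).coeff P.natDegree ≠ 0 := by
  intro h
  have := coeff_thetaHom φ P P.natDegree P.natDegree
  rw [h] at this
  simp [hP] at this

theorem order_lower (φ : A →+* W[X]) {P R : A[X]} (hP : P.Monic) (hR : R.Monic)
    (h : ∀ i ≤ (P*R).natDegree, X^((P*R).natDegree - i) ∣ φ ((P*R).coeff i)) :
    ∀ i ≤ P.natDegree, X^(P.natDegree - i) ∣ φ (P.coeff i) := by
  have hP' := thetaHom_coeff_ne φ hP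
  have hR' := thetaHom_coeff_ne φ hR
  have hF' := thetaHom_coeff_ne φ (hP.mul hR)
  have hdeg : (P*R).natDegree = P.natDegree + R.natDegree := hP.natDegree_mul hR
  have h1 : (thetaHom φ P).natTrailingDegree ≤ P.natDegree := natTrailingDegree_le_of_ne_zero hP'
  have h2 : (thetaHom φ R).natTrailingDegree ≤ R.natDegree := natTrailingDegree_le_of_ne_zero hR'
  have h3 : (P*R).natDegree ≤ (thetaHom φ (P*R)).natTrailingDegree := by
    apply le_natTrailingDegree
    · intro h0; rw [h0] at hF'; simp at hF'
    · intro e he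
      ext i
      rw [coeff_thetaHom]
      split_ifs with hi
      · rw [X_pow_dvd_iff.1 (h i (by omega)) (e - i) (by omega)]; simp
      · simp
  rw [map_mul, natTrailingDegree_mul (by intro h0; rw [h0] at hP'; simp at hP')
    (by intro h0; rw [h0] at hR'; simp at hR')] at h3
  intro i hi
  rw [X_pow_dvd_iff]
  intro e he
  have := coeff_thetaHom φ P (e + i) i
  rw [coeff_eq_zero_of_lt_natTrailingDegree (n := e + i) (by omega)] at this
  simpa using this.symm

theorem order_upper (φ : A →+* W[X]) {P R : A[X]} (hP : P.Monic) (hR : R.Monic)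
    (h : ∀ i ≤ (P*R).natDegree, (φ ((P*R).coeff i)).natDegree ≤ (P*R).natDegree - i) :
    ∀ i ≤ P.natDegree, (φ (P.coeff i)).natDegree ≤ P.natDegree - i := by
  have hP' := thetaHom_coeff_ne φ hP
  have hR' := thetaHom_coeff_ne φ hR
  have hdeg : (P*R).natDegree = P.natDegree + R.natDegree := hP.natDegree_mul hR
  have h1 : P.natDegree ≤ (thetaHom φ P).natDegree := le_natDegree_of_ne_zero hP'
  have h2 : R.natDegree ≤ (thetaHom φ R).natDegree := le_natDegree_of_ne_zero hR'
  have h3 : (thetaHom φ (P*R)).natDegree ≤ (P*R).natDegree := by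
    rw [natDegree_le_iff_coeff_eq_zero]
    intro e he
    ext i
    rw [coeff_thetaHom]
    split_ifs with hi
    · by_cases hi' : i ≤ (P*R).natDegree
      · rw [coeff_eq_zero_of_natDegree_lt]
        · simp
        · have := h i hi'; omega
      · rw [coeff_eq_zero_of_natDegree_lt (n := i) (by omega)]; simp
    · simp
  rw [map_mul, natDegree_mul (by intro h0; rw [h0] at hP'; simp at hP')
    (by intro h0; rw [h0] at hR'; simp at hR')] at h3
  intro i hi
  rw [natDegree_le_iff_coeff_eq_zero]
  intro e he
  have := coeff_thetaHom φ P (e + i) i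
  rw [coeff_eq_zero_of_natDegree_lt (n := e + i) (by omega)] at this
  simpa using this.symm
end order

section comps
open Polynomial
variable {k : Type} [Field k] {d : ℕ}

/-- X_i goes to X_i z -/
noncomputable def compHom (k : Type) [Field k] (d : ℕ) :
    MvPolynomial (Fin d) k →ₐ[k] (MvPolynomial (Fin d) k)[X] :=
  MvPolynomial.aeval (fun i => C (MvPolynomial.X i) * X)

theorem compHom_hom {p : MvPolynomial (Fin d) k} {n : ℕ} (hp : p.IsHomogeneous n) :
    compHom k d p = monomial n p := by
  rw [← C_mul_X_pow_eq_monomial]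
  conv_rhs => rw [p.as_sum, map_sum, Finset.sum_mul]
  conv_lhs => rw [p.as_sum, map_sum]
  refine Finset.sum_congr rfl fun m hm => ?_
  have hm' : ∑ i, m i = n := by
    have := hp (MvPolynomial.mem_support_iff.1 hm)
    rw [← this, Finsupp.weight_apply, Finsupp.sum_fintype] <;> simp
  rw [compHom, MvPolynomial.aeval_monomial, Finsupp.prod_fintype _ _ (by simp)]
  simp only [mul_pow, Finset.prod_mul_distrib, Finset.prod_pow_eq_pow_sum, hm']
  rw [← mul_assoc]
  congr 1
  rw [MvPolynomial.monomial_eq, map_mul, Finsupp.prod_fintype _ _ (by simp), map_prod]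
  simp only [map_pow]
  rfl

theorem compHom_coeff (p : MvPolynomial (Fin d) k) (n : ℕ) :
    (compHom k d p).coeff n = MvPolynomial.homogeneousComponent n p := by
  conv_lhs => rw [← p.sum_homogeneousComponent, map_sum]
  simp only [fun i => compHom_hom (MvPolynomial.homogeneousComponent_isHomogeneous i p)]
  rw [finsetSum_coeff]
  simp only [coeff_monomial]
  rw [Finset.sum_ite_eq']
  split_ifs with h
  · rfl
  · rw [MvPolynomial.homogeneousComponent_eq_zero]
    simpa using h

theorem isHom_of_comp {p : MvPolynomial (Fin d) k} {n : ℕ}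
    (h1 : X^n ∣ compHom k d p) (h2 : (compHom k d p).natDegree ≤ n) : p.IsHomogeneous n := by
  have : MvPolynomial.homogeneousComponent n p = p := by
    conv_rhs => rw [← p.sum_homogeneousComponent]
    symm
    by_cases h : n ≤ p.totalDegree
    · refine Finset.sum_eq_single n ?_ (by simp; omega)
      intro b _ hb
      rw [← compHom_coeff]
      rcases lt_or_gt_of_ne hb with hb | hb
      · exact X_pow_dvd_iff.1 h1 b hb
      · exact coeff_eq_zero_of_natDegree_lt (by omega)
    · rw [MvPolynomial.homogeneousComponent_eq_zero n p (by omega)]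
      refine Finset.sum_eq_zero fun i hi => ?_
      rw [← compHom_coeff]
      simp at hi
      exact X_pow_dvd_iff.1 h1 i (by omega)
  rw [← this]
  exact MvPolynomial.homogeneousComponent_isHomogeneous n p
end comps
end S8
end

section
namespace S8
open Polynomial
section cone
variable {k : Type} [Field k] {d : ℕ} {L : Type} [Field L] [Algebra k L]

/-- x satisfies a homogeneous monic equation -/
def HomInt {d : ℕ} {L : Type} [CommRing L] [Algebra k L] (ι : MvPolynomial (Fin d) k →ₐ[k] L)
    (x : L) : Prop :=
  ∃ H : (MvPolynomial (Fin d) k)[X], H.Monic ∧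
    (∀ i ≤ H.natDegree, (H.coeff i).IsHomogeneous (H.natDegree - i)) ∧
    H.eval₂ (ι : MvPolynomial (Fin d) k →+* L) x = 0

/-- y1 to 1, others times z -/
noncomputable def phi2 (k : Type) [Field k] (d : ℕ) :
    MvPolynomial (Fin (d+1)) k →+* (MvPolynomial (Fin d) k)[X] :=
  (eval₂RingHom (compHom k d : MvPolynomial (Fin d) k →+* _) 1).comp
    (MvPolynomial.finSuccEquiv k d : MvPolynomial (Fin (d+1)) k →+* _)

theorem phi2_coeff_zero (p : MvPolynomial (Fin (d+1)) k) :
    (phi2 k d p).coeff 0 = MvPolynomial.C (MvPolynomial.eval (Pi.single 0 1) p) := by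
  have : (constantCoeff.comp (phi2 k d)) =
      MvPolynomial.C.comp (MvPolynomial.eval (Pi.single 0 1)) := by
    ext1
    · ext1 a
      simp [phi2, compHom, MvPolynomial.finSuccEquiv_apply]
    · rename_i i
      induction i using Fin.cases with
      | zero => simp [phi2, compHom, MvPolynomial.finSuccEquiv_X_zero]
      | succ i => simp [phi2, compHom, MvPolynomial.finSuccEquiv_X_succ]
  exact RingHom.congr_fun this p

theorem phi2_mem {p : MvPolynomial (Fin (d+1)) k} {n : ℕ}
    (hp : p ∈ (RingHom.ker (MvPolynomial.eval (Pi.single 0 1 : Fin (d+1) → k)))^n) :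
    X^n ∣ phi2 k d p := by
  rw [← Ideal.mem_span_singleton, ← Ideal.span_singleton_pow]
  have h : (RingHom.ker (MvPolynomial.eval (Pi.single 0 1 : Fin (d+1) → k))).map (phi2 k d) ≤
      Ideal.span {X} := by
    rw [Ideal.map_le_iff_le_comap]
    intro q hq
    rw [Ideal.mem_comap, Ideal.mem_span_singleton, X_dvd_iff, phi2_coeff_zero,
      (RingHom.mem_ker).1 hq, map_zero]
  have := Ideal.mem_map_of_mem (phi2 k d) hp
  rw [Ideal.map_pow] at this
  exact Ideal.pow_right_mono h n this

theorem finSuccEquiv_rename (q : MvPolynomial (Fin d) k) :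
      MvPolynomial.finSuccEquiv k d (MvPolynomial.rename Fin.succ q) = C q := by
    induction q using MvPolynomial.induction_on with
    | C a => simp [MvPolynomial.finSuccEquiv_apply]
    | add p q hp hq => simp [hp, hq]
    | mul_X p i hp => simp [hp, MvPolynomial.finSuccEquiv_X_succ]

theorem phi2_hom {p : MvPolynomial (Fin (d+1)) k} {n : ℕ} (hp : p.IsHomogeneous n)
    (h : X^n ∣ phi2 k d p) : ∃ q : MvPolynomial (Fin d) k, p = MvPolynomial.rename Fin.succ q := by
  have hbig : ∀ e, n < e → (MvPolynomial.finSuccEquiv k d p).coeff e = 0 := by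
    intro e he
    by_contra h0
    have := MvPolynomial.totalDegree_coeff_finSuccEquiv_add_le p e h0
    have := hp.totalDegree_le
    omega
  have h1 : phi2 k d p = ∑ e ∈ Finset.range (n+1),
      monomial (n - e) ((MvPolynomial.finSuccEquiv k d p).coeff e) := by
    change eval₂ _ 1 (MvPolynomial.finSuccEquiv k d p) = _
    rw [eval₂_eq_sum_range' (n := n+1)]
    · refine Finset.sum_congr rfl fun e he => ?_
      rw [one_pow, mul_one]
      apply compHom_hom
      apply MvPolynomial.IsHomogeneous.finSuccEquiv_coeff_isHomogeneous hp
      have := Finset.mem_range.1 he; omega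
    · rw [Nat.lt_succ_iff, natDegree_le_iff_coeff_eq_zero]
      exact hbig
  refine ⟨(MvPolynomial.finSuccEquiv k d p).coeff 0, ?_⟩
  apply (MvPolynomial.finSuccEquiv k d).injective
  rw [finSuccEquiv_rename]
  ext1 e
  rw [coeff_C]
  split_ifs with he
  · rw [he]
  · by_cases hen : n < e
    · exact hbig e hen
    · have h2 := X_pow_dvd_iff.1 h (n - e) (by omega)
      rw [h1, finsetSum_coeff] at h2
      rw [Finset.sum_eq_single e] at h2
      · simpa using h2
      · intro b hb hbe
        rw [coeff_monomial, if_neg]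
        have := Finset.mem_range.1 hb; omega
      · intro h3; simp at h3; omega

theorem cone (ι : MvPolynomial (Fin (d+1)) k →ₐ[k] L) (hι : Function.Injective ι) (v : L)
    (hv : HomInt ι v) (F : (MvPolynomial (Fin (d+1)) k)[X]) (hF : F.Monic)
    (hFc : ∀ i, F.coeff i ∈
      (RingHom.ker (MvPolynomial.eval (Pi.single 0 1 : Fin (d+1) → k)))^(F.natDegree - i))
    (hFv : F.eval₂ (ι : MvPolynomial (Fin (d+1)) k →+* L) v = 0) :
    ∃ P : (MvPolynomial (Fin d) k)[X], P.Monic ∧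
      P.eval₂ ((ι : MvPolynomial (Fin (d+1)) k →+* L).comp
        (MvPolynomial.rename Fin.succ : MvPolynomial (Fin d) k →ₐ[k] _)) v = 0 := by
  obtain ⟨H, hH, hHc, hHv⟩ := hv
  letI : Algebra (MvPolynomial (Fin (d+1)) k) L := (ι : _ →+* L).toAlgebra
  have : FaithfulSMul (MvPolynomial (Fin (d+1)) k) L := by
    rw [faithfulSMul_iff_algebraMap_injective]; exact hι
  have hintg : IsIntegral (MvPolynomial (Fin (d+1)) k) v := ⟨H, hH, hHv⟩
  set P := minpoly (MvPolynomial (Fin (d+1)) k) v with hP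
  have hPm : P.Monic := minpoly.monic hintg
  obtain ⟨R1, hR1⟩ : P ∣ H := minpoly.isIntegrallyClosed_dvd hintg hHv
  obtain ⟨R2, hR2⟩ : P ∣ F := minpoly.isIntegrallyClosed_dvd hintg hFv
  have hR1m : R1.Monic := hPm.of_mul_monic_left (hR1 ▸ hH)
  have hR2m : R2.Monic := hPm.of_mul_monic_left (hR2 ▸ hF)
  have hhom : ∀ i ≤ P.natDegree, (P.coeff i).IsHomogeneous (P.natDegree - i) := by
    intro i hi
    apply isHom_of_comp
    · refine order_lower (compHom k (d+1)).toRingHom hPm hR1m ?_ i hi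
      rw [← hR1]
      intro i hi
      change _ ∣ compHom k (d+1) _
      rw [compHom_hom (hHc i hi), ← C_mul_X_pow_eq_monomial]
      exact dvd_mul_left _ _
    · refine order_upper (compHom k (d+1)).toRingHom hPm hR1m ?_ i hi
      rw [← hR1]
      intro i hi
      change (compHom k (d+1) _).natDegree ≤ _
      rw [compHom_hom (hHc i hi)]
      exact natDegree_monomial_le _
  have hq : ∀ i, ∃ q : MvPolynomial (Fin d) k, P.coeff i = MvPolynomial.rename Fin.succ q := by
    intro i
    by_cases hi : i ≤ P.natDegree
    · apply phi2_hom (hhom i hi)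
      refine order_lower (phi2 k d) hPm hR2m ?_ i hi
      rw [← hR2]
      intro i hi
      exact phi2_mem (hFc i)
    · exact ⟨0, by rw [coeff_eq_zero_of_natDegree_lt (by omega), map_zero]⟩
  have hl : P ∈ lifts (MvPolynomial.rename Fin.succ :
      MvPolynomial (Fin d) k →ₐ[k] MvPolynomial (Fin (d+1)) k).toRingHom := by
    rw [lifts_iff_coeff_lifts]
    intro i
    obtain ⟨q, hq⟩ := hq i
    exact ⟨q, hq.symm⟩
  obtain ⟨q, hq1, -, hq3⟩ := lifts_and_natDegree_eq_and_monic hl hPm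
  refine ⟨q, hq3, ?_⟩
  rw [← eval₂_map]
  erw [hq1]
  exact minpoly.aeval _ v
end cone
end S8
end

section
namespace S8
open Polynomial
section lin
variable {k : Type} [Field k] {d : ℕ} {L L' : Type} [Field L] [Algebra k L]
  [Field L'] [Algebra k L']

/-- A to L'[X] -/
noncomputable def bigTheta (ι' : MvPolynomial (Fin d) k →ₐ[k] L') :
    MvPolynomial (Fin (d+1)) k →+* L'[X] :=
  (mapRingHom (ι' : MvPolynomial (Fin d) k →+* L')).comp
    (MvPolynomial.finSuccEquiv k d : MvPolynomial (Fin (d+1)) k →+* _)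

theorem bigTheta_coeff (ι' : MvPolynomial (Fin d) k →ₐ[k] L') (a : MvPolynomial (Fin (d+1)) k)
    (e : ℕ) : (bigTheta ι' a).coeff e = ι' ((MvPolynomial.finSuccEquiv k d a).coeff e) := by
  simp [bigTheta]

theorem fse_natDegree_le {p : MvPolynomial (Fin (d+1)) k} {n : ℕ} (hp : p.IsHomogeneous n) :
    (MvPolynomial.finSuccEquiv k d p).natDegree ≤ n := by
  rw [natDegree_le_iff_coeff_eq_zero]
  intro e he
  by_contra h0
  have := MvPolynomial.totalDegree_coeff_finSuccEquiv_add_le p e h0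
  have := hp.totalDegree_le
  omega

theorem lin [IsAlgClosed k] (ι : MvPolynomial (Fin (d+1)) k →ₐ[k] L)
    (ι' : MvPolynomial (Fin d) k →ₐ[k] L')
    (j : L' →ₐ[k] L) (y : L) (hy : ∀ p : L'[X], p.eval₂ (j : L' →+* L) y = 0 → p = 0)
    (hcomp : ∀ a, (bigTheta ι' a).eval₂ (j : L' →+* L) y = ι a)
    (hfrac : ∀ x : L, ∃ p q : L'[X], x = p.eval₂ (j : L' →+* L) y / q.eval₂ (j : L' →+* L) y)
    (w : L) (hw : HomInt ι w) :
    ∃ (c : k) (w0 : L'), w = algebraMap k L c * y + j w0 ∧ HomInt ι' w0 := by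
  obtain ⟨H, hH, hHc, hHv⟩ := hw
  have hcomp' : (eval₂RingHom (j : L' →+* L) y).comp (bigTheta ι') =
      (ι : MvPolynomial (Fin (d+1)) k →+* L) := RingHom.ext hcomp
  set m := H.natDegree with hm
  obtain ⟨p, hp⟩ : ∃ p : L'[X], p.eval₂ (j : L' →+* L) y = w := by
    let _ : Algebra L'[X] L := (eval₂RingHom (j : L' →+* L) y).toAlgebra
    have : FaithfulSMul L'[X] L := by
      rw [faithfulSMul_iff_algebraMap_injective, injective_iff_map_eq_zero]
      exact hy
    have : IsFractionRing L'[X] L := IsFractionRing.of_field L'[X] L hfrac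
    have hintg : IsIntegral L'[X] w := by
      refine ⟨H.map (bigTheta ι'), hH.map _, ?_⟩
      rw [eval₂_map]
      rw [← hHv, ← hcomp']
      rfl
    exact (IsIntegrallyClosed.isIntegral_iff (R := L'[X]) (K := L)).1 hintg
  have h0 : eval₂ (bigTheta ι') p H = 0 := by
    apply hy
    change eval₂RingHom (j : L' →+* L) y _ = 0
    rw [hom_eval₂]
    rw [← hHv, ← hcomp', coe_eval₂RingHom, hp]
  have hΘ : ∀ i ≤ m, (bigTheta ι' (H.coeff i)).natDegree ≤ m - i := by
    intro i hi
    exact natDegree_map_le.trans (fse_natDegree_le (hHc i hi))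
  have h0' : ∑ i ∈ Finset.range (m+1), bigTheta ι' (H.coeff i) * p^i = 0 := by
    rw [← h0, eval₂_eq_sum_range]
  have hHm : H.coeff m = 1 := hH
  have hm0 : m ≠ 0 := by
    intro hm0
    rw [hm0] at h0' hHm
    simp [hHm] at h0'
  have hdeg : p.natDegree ≤ 1 := by
    by_contra hD
    push Not at hD
    have h1 := congrArg (fun q => q.coeff (p.natDegree * m)) h0'
    simp only [finsetSum_coeff, coeff_zero] at h1
    rw [Finset.sum_range_succ, Finset.sum_eq_zero, zero_add, hHm, map_one, one_mul,
      mul_comm p.natDegree, coeff_pow_mul_natDegree] at h1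
    · have := pow_eq_zero_iff hm0 |>.1 h1
      rw [leadingCoeff_eq_zero] at this
      rw [this] at hD
      simp at hD
    · intro i hi
      have hi := Finset.mem_range.1 hi
      apply coeff_eq_zero_of_natDegree_lt
      refine lt_of_le_of_lt natDegree_mul_le ?_
      have h2 := hΘ i hi.le
      have h3 : (p^i).natDegree ≤ i * p.natDegree := natDegree_pow_le
      obtain ⟨r, hr⟩ : ∃ r, m = i + r := ⟨m - i, by omega⟩
      have hr0 : 0 < r := by omega
      have : m - i = r := by omega
      rw [this] at h2
      rw [hr]
      nlinarith
  obtain ⟨w1, w0, hpw⟩ : ∃ w1 w0 : L', p = C w1 * X + C w0 :=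
    exists_eq_X_add_C_of_natDegree_le_one hdeg
  have hw1 : ∃ c : k, algebraMap k L' c = w1 := by
    let κ : ℕ → k := fun i =>
      MvPolynomial.coeff 0 ((MvPolynomial.finSuccEquiv k d (H.coeff i)).coeff (m - i))
    have hκ : ∀ i ≤ m, (bigTheta ι' (H.coeff i)).coeff (m - i) = algebraMap k L' (κ i) := by
      intro i hi
      rw [bigTheta_coeff]
      have h1 := (hHc i hi).finSuccEquiv_coeff_isHomogeneous (m - i) 0 (by omega)
      have h2 := MvPolynomial.totalDegree_eq_zero_iff_eq_C.1 (Nat.le_zero.1 h1.totalDegree_le)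
      rw [h2]
      exact ι'.commutes _
    have hintg : IsIntegral k w1 := by
      refine ⟨∑ i ∈ Finset.range (m+1), monomial i (κ i), ?_, ?_⟩
      · apply monic_of_natDegree_le_of_coeff_eq_one m
        · apply natDegree_sum_le_of_forall_le
          intro i hi
          exact (natDegree_monomial_le _).trans (by have := Finset.mem_range.1 hi; omega)
        · rw [finsetSum_coeff, Finset.sum_eq_single m]
          · simp [κ, hHm]
          · intro b _ hb
            rw [coeff_monomial, if_neg hb]
          · simp
      · rw [eval₂_finsetSum]
        have h1 := congrArg (fun q => q.coeff m) h0'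
        simp only [finsetSum_coeff, coeff_zero] at h1
        rw [← h1]
        refine Finset.sum_congr rfl fun i hi => ?_
        have hi : i ≤ m := by have := Finset.mem_range.1 hi; omega
        rw [eval₂_monomial, ← hκ i hi]
        have h3 : (p^i).natDegree ≤ i := by
          refine natDegree_pow_le.trans ?_
          nlinarith
        have h4 := coeff_mul_add_eq_of_natDegree_le (hΘ i hi) h3
        rw [Nat.sub_add_cancel hi] at h4
        rw [h4]
        congr 1
        have h5 := coeff_pow_of_natDegree_le hdeg (m := i)
        rw [mul_one] at h5
        rw [h5, hpw]
        simp
    exact minpoly.mem_range_of_degree_eq_one k w1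
      (IsAlgClosed.degree_eq_one_of_irreducible k (minpoly.irreducible hintg))
  obtain ⟨c, hc⟩ := hw1
  refine ⟨c, w0, ?_, ?_⟩
  · rw [← hp, hpw]
    simp only [eval₂_add, eval₂_mul, eval₂_C, eval₂_X, ← hc]
    simp
  · refine ⟨H.map ((constantCoeff).comp
      (MvPolynomial.finSuccEquiv k d : MvPolynomial (Fin (d+1)) k →+* _)), hH.map _, ?_, ?_⟩
    · rw [hH.natDegree_map]
      intro i hi
      rw [coeff_map]
      exact (hHc i hi).finSuccEquiv_coeff_isHomogeneous 0 (m - i) (by omega)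
    · rw [eval₂_map]
      have h1 := congrArg (constantCoeff) h0
      rw [hom_eval₂, map_zero] at h1
      have h2 : constantCoeff p = w0 := by rw [hpw]; simp
      rw [h2] at h1
      rw [← h1]
      congr 1
      apply RingHom.ext; intro a
      simp [bigTheta]
end lin
end S8
end

section
namespace S8
open Polynomial
section step
variable {k : Type} [Field k] {d : ℕ} {L : Type} [Field L] [Algebra k L]

/-- hypotheses of the domain lemma -/
structure DomHyp (ι : MvPolynomial (Fin d) k →ₐ[k] L) (s t : L) : Prop where
  inj : Function.Injective ι
  hr : ∀ x : Fin 4 → L, ∃ a : Fin 4 → MvPolynomial (Fin d) k, a ≠ 0 ∧ ∑ i, ι (a i) * x i = 0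
  H : ∀ (a b : k) (l : MvPolynomial (Fin d) k), l.IsHomogeneous 1 →
    HomInt ι (a • s + b • t + ι l)
  nlr : ∀ (a b : k) (l : MvPolynomial (Fin d) k), a • s + b • t = ι l → a = 0 ∧ b = 0

/-- conclusion of the domain lemma -/
structure DomConc (ι : MvPolynomial (Fin d) k →ₐ[k] L) (s t : L) : Prop where
  li : ∀ a b c, ι a + ι b * s + ι c * t = 0 → a = 0 ∧ b = 0 ∧ c = 0
  ss : ∃ a b c, s * s = ι a + ι b * s + ι c * t
  st : ∃ a b c, s * t = ι a + ι b * s + ι c * t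
  tt : ∃ a b c, t * t = ι a + ι b * s + ι c * t

theorem mem_range_of_integral {A : Type} [CommRing A] [IsDomain A] [IsIntegrallyClosed A]
    (ι : A →+* L) (hι : Function.Injective ι) (x : L)
    (H : A[X]) (hH : H.Monic) (hx : H.eval₂ ι x = 0) (a b : A) (hab : ι a + ι b * x = 0)
    (h0 : ¬ (a = 0 ∧ b = 0)) : ∃ c, x = ι c := by
  let _ : Algebra A L := ι.toAlgebra
  have : FaithfulSMul A L := by
    rw [faithfulSMul_iff_algebraMap_injective]; exact hι
  have hintg : IsIntegral A x := ⟨H, hH, hx⟩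
  have hd : minpoly A x ∣ C b * X + C a := by
    apply minpoly.isIntegrallyClosed_dvd hintg
    simp only [map_add, map_mul, aeval_C, aeval_X]
    rw [add_comm]; exact hab
  have hne : C b * X + C a ≠ 0 := by
    intro h
    have h1 := congrArg (fun p => p.coeff 0) h
    have h2 := congrArg (fun p => p.coeff 1) h
    simp at h1 h2
    exact h0 ⟨h1, h2⟩
  have hle : (minpoly A x).natDegree ≤ 1 := (natDegree_le_of_dvd hd hne).trans natDegree_linear_le
  obtain ⟨p, q, hpq⟩ := exists_eq_X_add_C_of_natDegree_le_one hle
  have hpos := minpoly.natDegree_pos hintg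
  have hmon := minpoly.monic hintg
  have h1 : (minpoly A x).natDegree = 1 := by omega
  have hp : p = 1 := by
    have := hmon.coeff_natDegree
    rw [h1, hpq] at this
    simpa using this
  have := minpoly.aeval A x
  rw [hpq, hp] at this
  simp only [map_one, one_mul, map_add, aeval_X, aeval_C] at this
  refine ⟨-q, ?_⟩
  rw [map_neg]
  exact eq_neg_of_add_eq_zero_left this

/-- relative algebraic closure -/
noncomputable def algCl (ι0 : MvPolynomial (Fin d) k →ₐ[k] L) : IntermediateField k L :=
  letI : Algebra (MvPolynomial (Fin d) k) L := ι0.toRingHom.toAlgebra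
  { carrier := {x | IsAlgebraic (MvPolynomial (Fin d) k) x}
    mul_mem' := fun ha hb => ha.mul hb
    add_mem' := fun ha hb => ha.add hb
    algebraMap_mem' := fun c => by
      have : algebraMap k L c = algebraMap (MvPolynomial (Fin d) k) L (MvPolynomial.C c) :=
        (ι0.commutes c).symm
      rw [this]
      exact isAlgebraic_algebraMap _
    inv_mem' := fun x hx => IsAlgebraic.inv hx }

theorem mem_algCl (ι0 : MvPolynomial (Fin d) k →ₐ[k] L) (x : L) :
    x ∈ algCl ι0 ↔ ∃ P : (MvPolynomial (Fin d) k)[X], P ≠ 0 ∧ P.eval₂ ι0.toRingHom x = 0 := Iff.rfl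

theorem range_mem_algCl (ι0 : MvPolynomial (Fin d) k →ₐ[k] L) (a) : ι0 a ∈ algCl ι0 := by
  rw [mem_algCl]
  refine ⟨X - C a, X_sub_C_ne_zero a, ?_⟩
  simp

/-- restricted map -/
noncomputable def algClMap (ι0 : MvPolynomial (Fin d) k →ₐ[k] L) :
    MvPolynomial (Fin d) k →ₐ[k] algCl ι0 where
  toFun a := ⟨ι0 a, range_mem_algCl ι0 a⟩
  map_one' := Subtype.ext (map_one _)
  map_zero' := Subtype.ext (map_zero _)
  map_add' a b := Subtype.ext (map_add _ a b)
  map_mul' a b := Subtype.ext (map_mul _ a b)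
  commutes' c := Subtype.ext (ι0.commutes c)

theorem algCl_transc (ι0 : MvPolynomial (Fin d) k →ₐ[k] L) (y : L)
    (hy : ∀ P : (MvPolynomial (Fin d) k)[X], P.eval₂ ι0.toRingHom y = 0 → P = 0) (p : (algCl ι0)[X])
    (hp : p.eval₂ ((algCl ι0).val : algCl ι0 →+* L) y = 0) : p = 0 := by
  by_contra h
  let _ : Algebra (MvPolynomial (Fin d) k) L := ι0.toRingHom.toAlgebra
  let _ : Algebra (MvPolynomial (Fin d) k) (algCl ι0) := (algClMap ι0).toRingHom.toAlgebra
  have : IsScalarTower (MvPolynomial (Fin d) k) (algCl ι0) L :=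
    IsScalarTower.of_algebraMap_eq (fun a => rfl)
  have : Algebra.IsAlgebraic (MvPolynomial (Fin d) k) (algCl ι0) := by
    constructor
    intro x
    obtain ⟨P, hP, hPx⟩ := (mem_algCl ι0 x).1 x.2
    refine ⟨P, hP, ?_⟩
    apply Subtype.ext
    have : (algebraMap (algCl ι0) L) (aeval x P) = aeval (algebraMap (algCl ι0) L x) P :=
      (aeval_algebraMap_apply L x P).symm
    exact this.trans hPx
  have h1 : IsAlgebraic (algCl ι0) y := ⟨p, h, hp⟩
  obtain ⟨P, hP, hPx⟩ := h1.restrictScalars (MvPolynomial (Fin d) k)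
  exact hP (hy P hPx)

theorem smul_X_hom (c : k) (i : Fin d) : (MvPolynomial.C c * MvPolynomial.X i :
    MvPolynomial (Fin d) k).IsHomogeneous 1 := by
  simpa using (MvPolynomial.isHomogeneous_C _ c).mul (MvPolynomial.isHomogeneous_X k i)

theorem step [IsAlgClosed k] (ι : MvPolynomial (Fin (d+1)) k →ₐ[k] L) (s t : L)
    (hyp : DomHyp ι s t)
    (IH : ∀ (L' : Type) [Field L'] [Algebra k L'] (ι' : MvPolynomial (Fin d) k →ₐ[k] L') (s t : L'),
      DomHyp ι' s t → DomConc ι' s t)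
    (v : L) (hv : HomInt ι v) (hvr : ∀ a, v ≠ ι a) (P : (MvPolynomial (Fin d) k)[X]) (hP : P.Monic)
    (hPv : P.eval₂ (ι.comp (MvPolynomial.rename Fin.succ)).toRingHom v = 0) : DomConc ι s t := by
  set ι0 := ι.comp (MvPolynomial.rename Fin.succ : MvPolynomial (Fin d) k →ₐ[k] _) with hι0
  set y := ι (MvPolynomial.X 0) with hydef
  set ι' := algClMap ι0 with hι'
  set j := (algCl ι0).val with hj
  have hji : Function.Injective j := j.toRingHom.injective
  have hjι : ∀ a, j (ι' a) = ι (MvPolynomial.rename Fin.succ a) := fun a => rfl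
  have hι'i : Function.Injective ι' := by
    intro a b hab
    have : ι (MvPolynomial.rename Fin.succ a) = ι (MvPolynomial.rename Fin.succ b) := by
      rw [← hjι, ← hjι, hab]
    exact MvPolynomial.rename_injective _ (Fin.succ_injective _) (hyp.inj this)
  have hcomp0 : ∀ a : MvPolynomial (Fin (d+1)) k,
      (MvPolynomial.finSuccEquiv k d a).eval₂ ι0.toRingHom y = ι a := by
    intro a
    have : (eval₂RingHom ι0.toRingHom y).comp
        (MvPolynomial.finSuccEquiv k d : MvPolynomial (Fin (d+1)) k →+* _) = ι.toRingHom := by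
      ext1
      · ext1 c
        simp [MvPolynomial.finSuccEquiv_apply, hι0]
      · rename_i i
        induction i using Fin.cases with
        | zero => simp [MvPolynomial.finSuccEquiv_X_zero, hydef]
        | succ i => simp [MvPolynomial.finSuccEquiv_X_succ, hι0]
    exact RingHom.congr_fun this a
  have hy : ∀ p : (algCl ι0)[X], p.eval₂ (j : algCl ι0 →+* L) y = 0 → p = 0 := by
    apply algCl_transc
    intro P hP
    have h1 := hcomp0 ((MvPolynomial.finSuccEquiv k d).symm P)
    rw [AlgEquiv.apply_symm_apply, hP] at h1
    have h2 := hyp.inj (h1.symm.trans (map_zero ι).symm)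
    simpa using h2
  have hcomp : ∀ a, (bigTheta ι' a).eval₂ (j : algCl ι0 →+* L) y = ι a := by
    intro a
    rw [← hcomp0]
    change eval₂ _ _ (map _ _) = _
    rw [eval₂_map]
    rfl
  have hvm : v ∈ algCl ι0 := (mem_algCl _ _).2 ⟨P, hP.ne_zero, hPv⟩
  obtain ⟨Hv, hHv, -, hHv0⟩ := hv
  have hv2 : ∀ a b, ι a + ι b * v = 0 → a = 0 ∧ b = 0 := by
    intro a b hab
    by_contra h0
    obtain ⟨c, hc⟩ := mem_range_of_integral (ι : _ →+* L) hyp.inj v Hv hHv hHv0 a b hab h0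
    exact hvr c hc
  have hfrac : ∀ x : L, ∃ p q : (algCl ι0)[X],
      x = p.eval₂ (j : algCl ι0 →+* L) y / q.eval₂ (j : algCl ι0 →+* L) y := by
    intro x
    obtain ⟨a, ha, hax⟩ := hyp.hr ![1, v, x, v * x]
    simp [Fin.sum_univ_four] at hax
    have hne : ι (a 2) + ι (a 3) * v ≠ 0 := by
      intro h
      have h2 := hv2 _ _ h
      have h3 : ι (a 0) + ι (a 1) * v = 0 := by linear_combination hax - x * h
      have h4 := hv2 _ _ h3
      apply ha
      funext i
      fin_cases i
      · exact h4.1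
      · exact h4.2
      · exact h2.1
      · exact h2.2
    refine ⟨-(bigTheta ι' (a 0) + bigTheta ι' (a 1) * C ⟨v, hvm⟩),
      bigTheta ι' (a 2) + bigTheta ι' (a 3) * C ⟨v, hvm⟩, ?_⟩
    simp only [eval₂_neg, eval₂_add, eval₂_mul, eval₂_C, hcomp]
    have hjv : (j : algCl ι0 →+* L) ⟨v, hvm⟩ = v := rfl
    rw [hjv, eq_div_iff hne]
    linear_combination hax
  have LIN := lin ι ι' j y hy hcomp hfrac
  have hC : ∀ c : k, ι (MvPolynomial.C c) = algebraMap k L c := fun c => ι.commutes c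
  have hjc : ∀ c : k, j (algebraMap k (algCl ι0) c) = algebraMap k L c := fun c => j.commutes c
  obtain ⟨κ, s0, hs, -⟩ := LIN s (by
    have := hyp.H 1 0 0 (MvPolynomial.isHomogeneous_zero _ _ _)
    simpa using this)
  obtain ⟨κ', t0, ht, -⟩ := LIN t (by
    have := hyp.H 0 1 0 (MvPolynomial.isHomogeneous_zero _ _ _)
    simpa using this)
  have hyp' : DomHyp ι' s0 t0 := by
    refine ⟨hι'i, ?_, ?_, ?_⟩
    · intro x
      obtain ⟨a, ha, hax⟩ := hyp.hr (fun i => j (x i))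
      have h1 : ∑ i, bigTheta ι' (a i) * C (x i) = 0 := by
        apply hy
        rw [eval₂_finsetSum, ← hax]
        refine Finset.sum_congr rfl fun i _ => ?_
        rw [eval₂_mul, hcomp, eval₂_C]
        rfl
      obtain ⟨i, hi⟩ := Function.ne_iff.1 ha
      have hi2 : MvPolynomial.finSuccEquiv k d (a i) ≠ 0 := by
        intro h
        apply hi
        simpa using h
      have : ∃ e, (MvPolynomial.finSuccEquiv k d (a i)).coeff e ≠ 0 := by
        by_contra h
        push Not at h
        exact hi2 (Polynomial.ext (by simpa using h))
      obtain ⟨e, he⟩ := this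
      refine ⟨fun i => (MvPolynomial.finSuccEquiv k d (a i)).coeff e, ?_, ?_⟩
      · intro h
        exact he (congrFun h i)
      · have h2 := congrArg (fun p => p.coeff e) h1
        simp only [finsetSum_coeff, coeff_mul_C, bigTheta_coeff, coeff_zero] at h2
        exact h2
    · intro a b l hl
      have h1 := hyp.H a b (MvPolynomial.rename Fin.succ l -
        MvPolynomial.C (a * κ + b * κ') * MvPolynomial.X 0)
        ((hl.rename_isHomogeneous).sub (smul_X_hom _ _))
      have h2 : a • s + b • t + ι (MvPolynomial.rename Fin.succ l -
          MvPolynomial.C (a * κ + b * κ') * MvPolynomial.X 0) = j (a • s0 + b • t0 + ι' l) := by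
        simp only [map_add, map_sub, map_mul, hjι, hs, ht, hC, ← hydef, Algebra.smul_def,
          hjc]
        ring
      rw [h2] at h1
      obtain ⟨c, w0, hw, hw0⟩ := LIN _ h1
      have h3 := hy (C (algebraMap k _ c) * X + C (w0 - (a • s0 + b • t0 + ι' l))) (by
        simp only [eval₂_add, eval₂_mul, eval₂_C, eval₂_X, RingHom.coe_coe, hjc,
          C_sub, eval₂_sub, hw]
        ring)
      have h4 := congrArg (fun p => p.coeff 0) h3
      simp only [coeff_add, mul_coeff_zero, coeff_X_zero, mul_zero, coeff_C_zero, zero_add,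
        coeff_zero] at h4
      rw [sub_eq_zero] at h4
      rwa [← h4]
    · intro a b l h
      apply hyp.nlr a b (MvPolynomial.rename Fin.succ l +
        MvPolynomial.C (a * κ + b * κ') * MvPolynomial.X 0)
      have h2 := congrArg j h
      simp only [map_add, map_mul, hjι, Algebra.smul_def, hjc] at h2
      simp only [map_add, map_mul, hC, ← hydef, hs, ht, Algebra.smul_def]
      linear_combination h2
  have conc := IH _ ι' s0 t0 hyp'
  have hD : ∀ x : algCl ι0, (∃ a b c, x = ι' a + ι' b * s0 + ι' c * t0) →
      ∃ a b c, j x = ι a + ι b * s + ι c * t := by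
    rintro x ⟨a, b, c, h⟩
    refine ⟨MvPolynomial.rename Fin.succ a - MvPolynomial.rename Fin.succ b *
      (MvPolynomial.C κ * MvPolynomial.X 0) - MvPolynomial.rename Fin.succ c *
      (MvPolynomial.C κ' * MvPolynomial.X 0), MvPolynomial.rename Fin.succ b,
      MvPolynomial.rename Fin.succ c, ?_⟩
    rw [h]
    simp only [map_add, map_mul, map_sub, hjι, hC, ← hydef, hs, ht]
    ring
  refine ⟨?_, ?_, ?_, ?_⟩
  · intro a b c h
    have h1 : bigTheta ι' (a + b * (MvPolynomial.C κ * MvPolynomial.X 0) +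
        c * (MvPolynomial.C κ' * MvPolynomial.X 0)) + bigTheta ι' b * C s0 +
        bigTheta ι' c * C t0 = 0 := by
      apply hy
      simp only [eval₂_add, eval₂_mul, eval₂_C, hcomp]
      rw [hs, ht] at h
      simp only [map_add, map_mul, hC, ← hydef, RingHom.coe_coe]
      linear_combination h
    have h2 : ∀ e, ((MvPolynomial.finSuccEquiv k d (a + b * (MvPolynomial.C κ * MvPolynomial.X 0) +
        c * (MvPolynomial.C κ' * MvPolynomial.X 0))).coeff e = 0) ∧
        (MvPolynomial.finSuccEquiv k d b).coeff e = 0 ∧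
        (MvPolynomial.finSuccEquiv k d c).coeff e = 0 := by
      intro e
      apply conc.li
      have h3 := congrArg (fun p => p.coeff e) h1
      simp only [coeff_add, coeff_mul_C, bigTheta_coeff, coeff_zero] at h3
      exact h3
    have hz : ∀ p : MvPolynomial (Fin (d+1)) k,
        (∀ e, (MvPolynomial.finSuccEquiv k d p).coeff e = 0) → p = 0 := by
      intro p hp
      have : MvPolynomial.finSuccEquiv k d p = 0 := Polynomial.ext (by simpa using hp)
      simpa using this
    have hb := hz _ (fun e => (h2 e).2.1)
    have hc := hz _ (fun e => (h2 e).2.2)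
    have ha := hz _ (fun e => (h2 e).1)
    refine ⟨?_, hb, hc⟩
    simpa [hb, hc] using ha
  · obtain ⟨a, b, c, h⟩ := hD _ conc.ss
    refine ⟨a - MvPolynomial.C κ^2 * MvPolynomial.X 0 ^2,
      b + 2 * (MvPolynomial.C κ * MvPolynomial.X 0), c, ?_⟩
    rw [map_mul] at h
    simp only [map_add, map_mul, map_sub, map_pow, hC, ← hydef, map_ofNat]
    rw [hs] at h ⊢
    linear_combination h
  · obtain ⟨a, b, c, h⟩ := hD _ conc.st
    refine ⟨a - MvPolynomial.C κ * MvPolynomial.C κ' * MvPolynomial.X 0 ^2,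
      b + (MvPolynomial.C κ' * MvPolynomial.X 0), c + (MvPolynomial.C κ * MvPolynomial.X 0), ?_⟩
    rw [map_mul] at h
    simp only [map_add, map_mul, map_sub, map_pow, hC, ← hydef, map_ofNat]
    rw [hs, ht] at h ⊢
    linear_combination h
  · obtain ⟨a, b, c, h⟩ := hD _ conc.tt
    refine ⟨a - MvPolynomial.C κ'^2 * MvPolynomial.X 0 ^2, b,
      c + 2 * (MvPolynomial.C κ' * MvPolynomial.X 0), ?_⟩
    rw [map_mul] at h
    simp only [map_add, map_mul, map_sub, map_pow, hC, ← hydef, map_ofNat]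
    rw [ht] at h ⊢
    linear_combination h
end step
end S8
end

section
namespace S8
open Polynomial
section main
variable {k : Type} [Field k] {d : ℕ} {L : Type} [Field L] [Algebra k L]

theorem HomInt.integral {ι : MvPolynomial (Fin d) k →ₐ[k] L} {x : L} (h : HomInt ι x) :
    ∃ H : (MvPolynomial (Fin d) k)[X], H.Monic ∧ H.eval₂ ι.toRingHom x = 0 := by
  obtain ⟨H, h1, _, h3⟩ := h
  exact ⟨H, h1, h3⟩

theorem HomInt.comp [Infinite k] {ι : MvPolynomial (Fin d) k →ₐ[k] L} {x : L} (h : HomInt ι x)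
    (e : (Fin d → k) ≃ₗ[k] (Fin d → k)) : HomInt (ι.comp (linSub e).toAlgHom) x := by
  obtain ⟨H, h1, h2, h3⟩ := h
  refine ⟨H.map ((linSub e).symm : _ →+* MvPolynomial (Fin d) k), h1.map _, ?_, ?_⟩
  · rw [h1.natDegree_map]
    intro i hi
    rw [coeff_map]
    exact linSub_hom e.symm (h2 i hi)
  · rw [eval₂_map, ← h3]
    congr 1
    apply RingHom.ext
    intro a
    simp

theorem DomHyp.comp [Infinite k] {ι : MvPolynomial (Fin d) k →ₐ[k] L} {s t : L} (h : DomHyp ι s t)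
    (e : (Fin d → k) ≃ₗ[k] (Fin d → k)) : DomHyp (ι.comp (linSub e).toAlgHom) s t := by
  refine ⟨h.inj.comp (linSub e).injective, ?_, ?_, ?_⟩
  · intro x
    obtain ⟨a, ha, hax⟩ := h.hr x
    refine ⟨fun i => (linSub e).symm (a i), ?_, ?_⟩
    · intro h0
      apply ha
      funext i
      have := congrFun h0 i
      simpa using this
    · rw [← hax]
      refine Finset.sum_congr rfl fun i _ => ?_
      simp
  · intro a b l hl
    exact (h.H a b _ (linSub_hom e hl)).comp e
  · intro a b l hl
    exact h.nlr a b _ hl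

theorem DomConc.of_comp [Infinite k] {ι : MvPolynomial (Fin d) k →ₐ[k] L} {s t : L}
    (e : (Fin d → k) ≃ₗ[k] (Fin d → k)) (h : DomConc (ι.comp (linSub e).toAlgHom) s t) :
    DomConc ι s t := by
  refine ⟨?_, ?_, ?_, ?_⟩
  · intro a b c hh
    have := h.li ((linSub e).symm a) ((linSub e).symm b) ((linSub e).symm c) (by simpa using hh)
    simpa using this
  · obtain ⟨a, b, c, h⟩ := h.ss
    exact ⟨_, _, _, h⟩
  · obtain ⟨a, b, c, h⟩ := h.st
    exact ⟨_, _, _, h⟩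
  · obtain ⟨a, b, c, h⟩ := h.tt
    exact ⟨_, _, _, h⟩

/-- the subring generated -/
def Bsub (ι : MvPolynomial (Fin d) k →ₐ[k] L) (s t : L) : Set L :=
  letI : Algebra (MvPolynomial (Fin d) k) L := ι.toRingHom.toAlgebra
  (Algebra.adjoin (MvPolynomial (Fin d) k) {s, t} : Set L)

theorem Bsub_eq (ι : MvPolynomial (Fin d) k →ₐ[k] L) (s t : L) :
    Bsub ι s t = (Subring.closure (Set.range ι ∪ {s, t}) : Set L) := by
  let _ : Algebra (MvPolynomial (Fin d) k) L := ι.toRingHom.toAlgebra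
  have := Algebra.adjoin_eq_ring_closure (R := MvPolynomial (Fin d) k) ({s, t} : Set L)
  exact congrArg (fun S : Subring L => (S : Set L)) this

theorem core0 [IsAlgClosed k] (ι : MvPolynomial (Fin (d+1)) k →ₐ[k] L) (s t : L)
    (hyp : DomHyp ι s t)
    (IH : ∀ (L' : Type) [Field L'] [Algebra k L'] (ι' : MvPolynomial (Fin d) k →ₐ[k] L') (s t : L'),
      DomHyp ι' s t → DomConc ι' s t)
    (π a b c : MvPolynomial (Fin (d+1)) k) (hπ : MvPolynomial.eval (Pi.single 0 1) π = 0)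
    (hbc : ¬ (MvPolynomial.eval (Pi.single 0 1) b = 0 ∧ MvPolynomial.eval (Pi.single 0 1) c = 0))
    (w : L) (hw : w ∈ Bsub ι s t) (h : ι a + ι b * s + ι c * t = ι π * w) : DomConc ι s t := by
  set a0 := MvPolynomial.eval (Pi.single 0 1) a with ha0
  set b0 := MvPolynomial.eval (Pi.single 0 1) b with hb0
  set c0 := MvPolynomial.eval (Pi.single 0 1) c with hc0
  have hC : ∀ c : k, ι (MvPolynomial.C c) = algebraMap k L c := fun c => ι.commutes c
  have hv : HomInt ι (b0 • s + c0 • t + ι (MvPolynomial.C a0 * MvPolynomial.X 0)) :=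
    hyp.H _ _ _ (smul_X_hom _ _)
  set v := b0 • s + c0 • t + ι (MvPolynomial.C a0 * MvPolynomial.X 0) with hvdef
  have hvr : ∀ q, v ≠ ι q := by
    intro q hq
    apply hbc
    apply hyp.nlr b0 c0 (q - MvPolynomial.C a0 * MvPolynomial.X 0)
    rw [map_sub, ← hq, hvdef]
    ring
  have hsI := (hyp.H 1 0 0 (MvPolynomial.isHomogeneous_zero _ _ _)).integral
  have htI := (hyp.H 0 1 0 (MvPolynomial.isHomogeneous_zero _ _ _)).integral
  simp only [one_smul, zero_smul, map_zero, add_zero, zero_add] at hsI htI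
  obtain ⟨F, hF, hFc, hFv⟩ : ∃ F : (MvPolynomial (Fin (d+1)) k)[X], F.Monic ∧ (∀ i, F.coeff i ∈
      (RingHom.ker (MvPolynomial.eval (Pi.single 0 1 : Fin (d+1) → k)))^(F.natDegree - i)) ∧
      F.eval₂ (ι : MvPolynomial (Fin (d+1)) k →+* L) v = 0 := by
    let _ : Algebra (MvPolynomial (Fin (d+1)) k) L := ι.toRingHom.toAlgebra
    let B := Algebra.adjoin (MvPolynomial (Fin (d+1)) k) {s, t}
    have hfin : Module.Finite (MvPolynomial (Fin (d+1)) k) B :=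
      Algebra.finite_adjoin_of_finite_of_isIntegral (Set.toFinite _) (by
        rintro x (rfl | rfl)
        · exact hsI
        · exact htI)
    have hsB : s ∈ B := Algebra.subset_adjoin (by simp)
    have htB : t ∈ B := Algebra.subset_adjoin (by simp)
    let I := RingHom.ker (MvPolynomial.eval (Pi.single 0 1 : Fin (d+1) → k))
    let vB : B := (MvPolynomial.C a0 * MvPolynomial.X 0 - a) • 1 +
      (MvPolynomial.C b0 - b) • (⟨s, hsB⟩ : B) + (MvPolynomial.C c0 - c) • (⟨t, htB⟩ : B) +
      π • (⟨w, hw⟩ : B)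
    have hvB : (vB : L) = v := by
      change ι (MvPolynomial.C a0 * MvPolynomial.X 0 - a) * 1 + ι (MvPolynomial.C b0 - b) * s +
        ι (MvPolynomial.C c0 - c) * t + ι π * w = v
      rw [← h, hvdef]
      simp only [map_sub, hC, Algebra.smul_def]
      ring
    have hvI : ∀ x : B, vB * x ∈ I • (⊤ : Submodule (MvPolynomial (Fin (d+1)) k) B) := by
      intro x
      have : vB * x = (MvPolynomial.C a0 * MvPolynomial.X 0 - a) • x +
        (MvPolynomial.C b0 - b) • ((⟨s, hsB⟩ : B) * x) +
        (MvPolynomial.C c0 - c) • ((⟨t, htB⟩ : B) * x) +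
        π • ((⟨w, hw⟩ : B) * x) := by
        simp only [vB, add_mul, smul_mul_assoc, one_mul]
      rw [this]
      refine Submodule.add_mem _ (Submodule.add_mem _ (Submodule.add_mem _ ?_ ?_) ?_) ?_ <;>
        refine Submodule.smul_mem_smul ?_ trivial <;> simp [I, RingHom.mem_ker, ha0, hb0, hc0, hπ]
    obtain ⟨F, hF, -, hFc, hF0⟩ :=
      LinearMap.exists_monic_and_natDegree_eq_and_coeff_mem_pow_and_aeval_eq_zero
      (MvPolynomial (Fin (d+1)) k) (LinearMap.mulLeft (MvPolynomial (Fin (d+1)) k) vB) I (by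
        rintro _ ⟨x, rfl⟩
        exact hvI x)
    refine ⟨F, hF, hFc, ?_⟩
    have h1 : aeval vB F = 0 := by
      have h2 : (Algebra.lmul (MvPolynomial (Fin (d+1)) k) B) (aeval vB F) = 0 := by
        rw [← aeval_algHom_apply]
        exact hF0
      have := congrArg (fun f => f 1) h2
      simpa using this
    have h3 := congrArg (algebraMap B L) h1
    rw [← aeval_algebraMap_apply, map_zero] at h3
    have h4 : algebraMap B L vB = v := hvB
    rw [h4] at h3
    exact h3
  obtain ⟨P, hP, hPv⟩ := cone ι hyp.inj v hv F hF hFc hFv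
  exact step ι s t hyp IH v hv hvr P hP hPv

theorem core [IsAlgClosed k] (ι : MvPolynomial (Fin (d+2)) k →ₐ[k] L) (s t : L)
    (hyp : DomHyp ι s t)
    (IH : ∀ (L' : Type) [Field L'] [Algebra k L'] (ι' : MvPolynomial (Fin (d+1)) k →ₐ[k] L')
      (s t : L'), DomHyp ι' s t → DomConc ι' s t)
    (π a b c : MvPolynomial (Fin (d+2)) k) (hπ : π = 0 ∨ Prime π)
    (hbc : ¬ (π ∣ b ∧ π ∣ c))
    (w : L) (hw : w ∈ Bsub ι s t) (h : ι a + ι b * s + ι c * t = ι π * w) : DomConc ι s t := by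
  obtain ⟨y, hy0, hyπ, hy⟩ : ∃ y : Fin (d+2) → k, y ≠ 0 ∧ MvPolynomial.eval y π = 0 ∧
      ¬ (MvPolynomial.eval y b = 0 ∧ MvPolynomial.eval y c = 0) := by
    by_cases hb : π ∣ b
    · obtain ⟨y, h1, h2, h3⟩ := exists_pt π c hπ (fun hc => hbc ⟨hb, hc⟩)
      exact ⟨y, h1, h2, fun h => h3 h.2⟩
    · obtain ⟨y, h1, h2, h3⟩ := exists_pt π b hπ hb
      exact ⟨y, h1, h2, fun h => h3 h.1⟩
  obtain ⟨e, he⟩ := exists_linEquiv y hy0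
  have hι : ∀ p, (ι.comp (linSub e.symm).toAlgHom) (linSub e p) = ι p := by
    intro p
    change ι ((linSub e).symm (linSub e p)) = ι p
    rw [AlgEquiv.symm_apply_apply]
  apply DomConc.of_comp e.symm
  refine core0 _ s t (hyp.comp e.symm) IH (linSub e π) (linSub e a) (linSub e b) (linSub e c)
    ?_ ?_ w ?_ ?_
  · rw [eval_linSub, he, hyπ]
  · rw [eval_linSub, eval_linSub, he]
    exact hy
  · rw [Bsub_eq] at hw ⊢
    have : Set.range (ι.comp (linSub e.symm).toAlgHom) = Set.range ι := by
      ext x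
      constructor
      · rintro ⟨p, rfl⟩; exact ⟨_, rfl⟩
      · rintro ⟨p, rfl⟩; exact ⟨_, hι p⟩
    rwa [this]
  · rw [hι, hι, hι, hι, h]

theorem hom_zero {n : ℕ} (hn : n ≠ 0) {p : MvPolynomial (Fin 0) k} (hp : p.IsHomogeneous n) :
    p = 0 := by
  ext m
  rw [hp.coeff_eq_zero]
  · simp
  · have : m = 0 := Subsingleton.elim _ _
    rw [this]; simp; omega

theorem hom_one {n : ℕ} {p : MvPolynomial (Fin 1) k} (hp : p.IsHomogeneous n) :
    p = MvPolynomial.C (MvPolynomial.coeff (Finsupp.single 0 n) p) * MvPolynomial.X 0 ^ n := by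
  rw [MvPolynomial.C_mul_X_pow_eq_monomial]
  ext m
  rw [MvPolynomial.coeff_monomial]
  split_ifs with h
  · rw [h]
  · apply hp.coeff_eq_zero
    intro hm
    apply h
    rw [← hm]
    refine Finsupp.ext fun i => ?_
    have : i = 0 := Subsingleton.elim _ _
    subst this
    simp [Finsupp.degree_eq_sum]

theorem dom [IsAlgClosed k] : ∀ (d : ℕ) (L : Type) [Field L] [Algebra k L]
    (ι : MvPolynomial (Fin d) k →ₐ[k] L) (s t : L), DomHyp ι s t → DomConc ι s t
  | 0 => by
    intro L _ _ ι s t hyp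
    exfalso
    have hs := hyp.H 1 0 0 (MvPolynomial.isHomogeneous_zero _ _ _)
    simp only [one_smul, zero_smul, map_zero, add_zero] at hs
    obtain ⟨H, h1, h2, h3⟩ := hs
    rw [eval₂_eq_sum_range, Finset.sum_range_succ, Finset.sum_eq_zero, zero_add,
      h1.coeff_natDegree, map_one, one_mul] at h3
    · have hs : s = 0 := eq_zero_of_pow_eq_zero h3
      have := hyp.nlr 1 0 0 (by simp [hs])
      simp at this
    · intro i hi
      have hi := Finset.mem_range.1 hi
      rw [hom_zero (by omega) (h2 i hi.le)]
      simp
  | 1 => by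
    intro L _ _ ι s t hyp
    exfalso
    have hs := hyp.H 1 0 0 (MvPolynomial.isHomogeneous_zero _ _ _)
    simp only [one_smul, zero_smul, map_zero, add_zero] at hs
    obtain ⟨H, h1, h2, h3⟩ := hs
    set m := H.natDegree with hm
    set y := ι (MvPolynomial.X 0) with hy
    have hy0 : y ≠ 0 := by
      intro h
      have := hyp.inj (h.trans (map_zero ι).symm)
      exact MvPolynomial.X_ne_zero _ this
    let κ : ℕ → k := fun i => MvPolynomial.coeff (Finsupp.single 0 (m - i)) (H.coeff i)
    have hintg : IsIntegral k (s / y) := by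
      refine ⟨∑ i ∈ Finset.range (m+1), monomial i (κ i), ?_, ?_⟩
      · apply monic_of_natDegree_le_of_coeff_eq_one m
        · apply natDegree_sum_le_of_forall_le
          intro i hi
          exact (natDegree_monomial_le _).trans (by have := Finset.mem_range.1 hi; omega)
        · rw [finsetSum_coeff, Finset.sum_eq_single m]
          · simp [κ, hm, h1]
          · intro b _ hb
            rw [coeff_monomial, if_neg hb]
          · simp
      · rw [eval₂_finsetSum]
        have h4 : y^m * ∑ i ∈ Finset.range (m + 1),
            eval₂ (algebraMap k L) (s/y) ((monomial i) (κ i)) = 0 := by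
          rw [← h3, eval₂_eq_sum_range, Finset.mul_sum]
          refine Finset.sum_congr rfl fun i hi => ?_
          have hi : i ≤ m := by have := Finset.mem_range.1 hi; omega
          rw [hom_one (h2 i hi), eval₂_monomial]
          have : ι (MvPolynomial.C (κ i)) = algebraMap k L (κ i) := ι.commutes _
          simp only [map_mul, map_pow, RingHom.coe_coe]
          rw [← hy]
          change _ = ι (MvPolynomial.C (κ i)) * y^(m-i) * s^i
          rw [this, div_pow]
          have h5 : y^m = y^(m-i) * y^i := by rw [← pow_add]; congr 1; omega
          rw [h5]
          field_simp
        exact (mul_eq_zero.1 h4).resolve_left (pow_ne_zero _ hy0)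
    obtain ⟨c, hc⟩ := minpoly.mem_range_of_degree_eq_one k (s/y)
      (IsAlgClosed.degree_eq_one_of_irreducible k (minpoly.irreducible hintg))
    have := hyp.nlr 1 0 (MvPolynomial.C c * MvPolynomial.X 0) (by
      have h6 : ι (MvPolynomial.C c) = algebraMap k L c := ι.commutes _
      rw [map_mul, h6, hc, ← hy]
      field_simp
      simp)
    simp at this
  | (d+2) => by
    intro L _ _ ι s t hyp
    have IH := dom (d+1)
    by_contra hnc
    have hsI := (hyp.H 1 0 0 (MvPolynomial.isHomogeneous_zero _ _ _)).integral
    have htI := (hyp.H 0 1 0 (MvPolynomial.isHomogeneous_zero _ _ _)).integral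
    simp only [one_smul, zero_smul, map_zero, add_zero, zero_add] at hsI htI
    have CORE := fun π a b c h1 h2 w h3 h4 => hnc (core ι s t hyp IH π a b c h1 h2 w h3 h4)
    obtain ⟨B, hB, hBint, hsB, htB⟩ : ∃ B : Subring L, (B : Set L) = Bsub ι s t ∧
        (∀ x ∈ B, ∃ H : (MvPolynomial (Fin (d+2)) k)[X], H.Monic ∧ H.eval₂ ι.toRingHom x = 0) ∧
        s ∈ B ∧ t ∈ B := by
      let _ : Algebra (MvPolynomial (Fin (d+2)) k) L := ι.toRingHom.toAlgebra
      let B := Algebra.adjoin (MvPolynomial (Fin (d+2)) k) {s, t}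
      refine ⟨B.toSubring, rfl, ?_, ?_, ?_⟩
      · intro x hx
        have : B ≤ integralClosure (MvPolynomial (Fin (d+2)) k) L := by
          apply Algebra.adjoin_le
          rintro x (rfl | rfl)
          · exact hsI
          · exact htI
        exact this hx
      · exact Algebra.subset_adjoin (R := MvPolynomial (Fin (d+2)) k) (by simp)
      · exact Algebra.subset_adjoin (R := MvPolynomial (Fin (d+2)) k) (by simp)
    have hιB : ∀ a, ι a ∈ B := by
      intro a
      rw [← SetLike.mem_coe, hB]
      let _ : Algebra (MvPolynomial (Fin (d+2)) k) L := ι.toRingHom.toAlgebra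
      exact Subalgebra.algebraMap_mem (Algebra.adjoin (MvPolynomial (Fin (d+2)) k) {s, t}) a
    have hBm : ∀ x, x ∈ B → x ∈ Bsub ι s t := fun x hx => by rw [← hB]; exact hx
    have li : ∀ a b c, ι a + ι b * s + ι c * t = 0 → a = 0 ∧ b = 0 ∧ c = 0 := by
      intro a b c h
      by_contra h0
      apply CORE 0 a b c (Or.inl rfl) _ 0 (hBm _ (zero_mem _)) (by rw [h]; simp)
      rw [zero_dvd_iff, zero_dvd_iff]
      rintro ⟨rfl, rfl⟩
      simp only [map_zero, zero_mul, add_zero] at h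
      exact h0 ⟨hyp.inj (h.trans (map_zero ι).symm), rfl, rfl⟩
    have key : ∀ h : MvPolynomial (Fin (d+2)) k, h ≠ 0 → ∀ m ∈ B,
        (∃ a b c, ι h * m = ι a + ι b * s + ι c * t) → ∃ a b c, m = ι a + ι b * s + ι c * t := by
      intro h
      induction h using UniqueFactorizationMonoid.induction_on_prime with
      | h₁ => intro h; exact absurd rfl h
      | h₂ x hx =>
        rintro - m hm ⟨a, b, c, h⟩
        obtain ⟨u, hu⟩ := hx.exists_left_inv
        refine ⟨u * a, u * b, u * c, ?_⟩
        have h1 : ι u * ι x = 1 := by rw [← map_mul, hu, map_one]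
        simp only [map_mul]
        linear_combination ι u * h - m * h1
      | h₃ a p ha hp ih =>
        rintro - m hm ⟨a', b, c, h⟩
        apply ih ha m hm
        have hw : ι a * m ∈ B := mul_mem (hιB _) hm
        have hpbc : p ∣ b ∧ p ∣ c := by
          by_contra h0
          refine CORE p a' b c (Or.inr hp) h0 (ι a * m) (hBm _ hw) ?_
          rw [← h, map_mul]; ring
        obtain ⟨⟨b', rfl⟩, ⟨c', rfl⟩⟩ := hpbc
        have hx : ι a * m - ι b' * s - ι c' * t ∈ B :=
          sub_mem (sub_mem hw (mul_mem (hιB _) hsB)) (mul_mem (hιB _) htB)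
        obtain ⟨H, hH, hHx⟩ := hBint _ hx
        obtain ⟨q, hq⟩ := mem_range_of_integral ι.toRingHom hyp.inj _ H hH hHx (-a') p (by
          change ι (-a') + ι p * _ = 0
          simp only [map_mul, map_neg] at h ⊢
          linear_combination h) (fun h0 => hp.ne_zero h0.2)
        refine ⟨q, b', c', ?_⟩
        have hq' : ι a * m - ι b' * s - ι c' * t = ι q := hq
        linear_combination hq'
    have fin : ∀ m ∈ B, ∃ a b c, m = ι a + ι b * s + ι c * t := by
      intro m hm
      obtain ⟨a, ha, hax⟩ := hyp.hr ![1, s, t, m]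
      simp [Fin.sum_univ_four] at hax
      have h3 : a 3 ≠ 0 := by
        intro h3
        rw [h3, map_zero, zero_mul, add_zero] at hax
        have := li _ _ _ hax
        apply ha
        funext i
        fin_cases i
        · exact this.1
        · exact this.2.1
        · exact this.2.2
        · exact h3
      refine key (a 3) h3 m hm ⟨-a 0, -a 1, -a 2, ?_⟩
      simp only [map_neg]
      linear_combination hax
    exact hnc ⟨li, fin _ (mul_mem hsB hsB), fin _ (mul_mem hsB htB), fin _ (mul_mem htB htB)⟩
end main
end S8
end

section
namespace S8
section sat
variable {A : Type} [CommRing A] [IsDomain A] [UniqueFactorizationMonoid A]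
variable {V : Type} [AddCommGroup V] [Module A V]

theorem ufd_dvd (h : A) (hh : h ≠ 0) : ∀ x : A,
    (∀ π : A, Prime π → ∃ a, ¬ π ∣ a ∧ h ∣ a * x) → h ∣ x := by
  induction h using UniqueFactorizationMonoid.induction_on_prime with
  | h₁ => exact absurd rfl hh
  | h₂ u hu => intro x _; exact hu.dvd
  | h₃ h' p hh' hp ih =>
    intro x hx
    obtain ⟨a, ha, hax⟩ := hx p hp
    obtain ⟨x', rfl⟩ : p ∣ x := (hp.dvd_or_dvd ((Dvd.intro _ rfl).trans hax)).resolve_left ha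
    apply mul_dvd_mul_left
    apply ih hh'
    intro π hπ
    obtain ⟨a, ha, hax⟩ := hx π hπ
    refine ⟨a, ha, ?_⟩
    rw [mul_left_comm] at hax
    exact (mul_dvd_mul_iff_left hp.ne_zero).1 hax

/-- membership in the saturation -/
def InSat (B : Submodule A V) (c : V) : Prop := ∀ π : A, Prime π → ∃ a, ¬ π ∣ a ∧ a • c ∈ B

theorem inSat_of_mem {B : Submodule A V} {c : V} (h : c ∈ B) : InSat B c :=
  fun π hπ => ⟨1, fun h1 => hπ.not_unit (isUnit_of_dvd_one h1), by simpa using h⟩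

theorem InSat.add {B : Submodule A V} {c c' : V} (h : InSat B c) (h' : InSat B c') :
    InSat B (c + c') := by
  intro π hπ
  obtain ⟨a, ha, hac⟩ := h π hπ
  obtain ⟨b, hb, hbc⟩ := h' π hπ
  refine ⟨a * b, fun hd => (hπ.dvd_or_dvd hd).elim ha hb, ?_⟩
  rw [smul_add]
  refine B.add_mem ?_ ?_
  · rw [mul_comm, mul_smul]; exact B.smul_mem _ hac
  · rw [mul_smul]; exact B.smul_mem _ hbc

theorem InSat.smul {B : Submodule A V} {c : V} (h : InSat B c) (r : A) :
    InSat B (r • c) := by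
  intro π hπ
  obtain ⟨a, ha, hac⟩ := h π hπ
  refine ⟨a, ha, ?_⟩
  rw [smul_comm]; exact B.smul_mem _ hac

/-- c is in the saturation if coprime multiples are -/
theorem InSat.of_coprime {B : Submodule A V} {c : V} (a b : A)
    (hab : ∀ π : A, Prime π → π ∣ a → π ∣ b → False)
    (ha : InSat B (a • c)) (hb : InSat B (b • c)) : InSat B c := by
  intro π hπ
  by_cases h : π ∣ a
  · obtain ⟨e, he, hec⟩ := hb π hπ
    refine ⟨e * b, fun hd => (hπ.dvd_or_dvd hd).elim he (hab π hπ h), ?_⟩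
    rwa [mul_smul]
  · obtain ⟨e, he, hec⟩ := ha π hπ
    refine ⟨e * a, fun hd => (hπ.dvd_or_dvd hd).elim he h, ?_⟩
    rwa [mul_smul]

/-- dual of B is free -/
theorem dual_projective [Module.IsTorsionFree A V] (B : Submodule A V) {n : ℕ} (c : Fin n → V)
    (hli : LinearIndependent A c) (hB : B ≤ Submodule.span A (Set.range c))
    (hsat : ∀ i, InSat B (c i)) (hmul : ∀ i, ∃ h : A, h ≠ 0 ∧ h • c i ∈ B) :
    Module.Projective A (B →ₗ[A] A) := by
  choose h hh0 hhB using hmul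
  have key : ∀ (φ : B →ₗ[A] A) (i : Fin n), h i ∣ φ ⟨h i • c i, hhB i⟩ := by
    intro φ i
    apply ufd_dvd _ (hh0 i)
    intro π hπ
    obtain ⟨a, ha, hac⟩ := hsat i π hπ
    refine ⟨a, ha, φ ⟨a • c i, hac⟩, ?_⟩
    rw [← smul_eq_mul, ← smul_eq_mul, ← map_smul, ← map_smul]
    congr 1
    apply Subtype.ext
    exact smul_comm _ _ _
  choose val hval using key
  let Φ : (B →ₗ[A] A) →ₗ[A] (Fin n → A) :=
    { toFun := val
      map_add' := by
        intro φ ψ; funext i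
        apply mul_left_cancel₀ (hh0 i)
        simp only [Pi.add_apply, mul_add, ← hval, LinearMap.add_apply]
      map_smul' := by
        intro r φ; funext i
        apply mul_left_cancel₀ (hh0 i)
        simp only [Pi.smul_apply, smul_eq_mul, RingHom.id_apply, ← hval, LinearMap.smul_apply]
        rw [mul_left_comm, ← hval] }
  have hΦ : Function.Bijective Φ := by
    constructor
    · rw [injective_iff_map_eq_zero]
      intro φ hφ
      have hz : ∀ i, φ ⟨h i • c i, hhB i⟩ = 0 := by
        intro i
        rw [hval]
        have : val φ i = 0 := congrFun hφ i
        rw [this, mul_zero]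
      let H := ∏ i, h i
      have hH : H ≠ 0 := Finset.prod_ne_zero_iff.2 fun i _ => hh0 i
      apply LinearMap.ext
      intro b
      obtain ⟨a, ha⟩ := (Submodule.mem_span_range_iff_exists_fun A).1 (hB b.2)
      have h1 : H • b = ∑ i, (a i * ∏ j ∈ Finset.univ.erase i, h j) •
          (⟨h i • c i, hhB i⟩ : B) := by
        apply Subtype.ext
        rw [Submodule.coe_smul, ← ha, Finset.smul_sum, Submodule.coe_sum]
        refine Finset.sum_congr rfl fun i _ => ?_
        rw [Submodule.coe_smul, smul_smul, smul_smul]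
        congr 1
        have : H = h i * ∏ j ∈ Finset.univ.erase i, h j :=
          (Finset.mul_prod_erase _ _ (Finset.mem_univ i)).symm
        rw [this]; ring
      have h2 : H • φ b = 0 := by
        rw [← map_smul, h1, map_sum]
        refine Finset.sum_eq_zero fun i _ => ?_
        rw [map_smul, hz, smul_zero]
      rw [smul_eq_mul] at h2
      exact (mul_eq_zero.1 h2).resolve_left hH
    · intro v
      let E := Module.Basis.span hli
      let ψ : Submodule.span A (Set.range c) →ₗ[A] A := E.constr A v
      refine ⟨ψ.comp (Submodule.inclusion hB), ?_⟩
      funext i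
      apply mul_left_cancel₀ (hh0 i)
      change h i * val _ i = _
      rw [← hval]
      have h3 : Submodule.inclusion hB ⟨h i • c i, hhB i⟩ = h i • E i := by
        apply Subtype.ext
        simp [E, Module.Basis.span_apply]
      rw [LinearMap.comp_apply, h3, map_smul, Module.Basis.constr_basis, smul_eq_mul]
  exact Module.Projective.of_equiv (LinearEquiv.ofBijective Φ hΦ).symm
end sat
end S8
end

section
namespace S8
section linforms
open MvPolynomial
variable {k : Type} [Field k] {d : ℕ}

theorem hom1_eq {l : MvPolynomial (Fin d) k} (hl : l.IsHomogeneous 1) :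
    ∃ a : Fin d → k, l = ∑ i, C (a i) * X i := by
  have h : l ∈ homogeneousSubmodule (Fin d) k 1 := hl
  rw [homogeneousSubmodule_one_eq_span_X, Submodule.mem_span_range_iff_exists_fun] at h
  obtain ⟨c, hc⟩ := h
  exact ⟨c, by simp_rw [← hc, smul_eq_C_mul]⟩

theorem hom1_eval_add {l : MvPolynomial (Fin d) k} (hl : l.IsHomogeneous 1) (x y : Fin d → k)
    (c : k) : eval (x + c • y) l = eval x l + c * eval y l := by
  obtain ⟨a, rfl⟩ := hom1_eq hl
  simp only [map_sum, map_mul, eval_C, eval_X, Pi.add_apply, Pi.smul_apply, smul_eq_mul,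
    Finset.mul_sum, ← Finset.sum_add_distrib]
  refine Finset.sum_congr rfl fun i _ => by ring

theorem hom1_exists_pt {l : MvPolynomial (Fin d) k} (hl : l.IsHomogeneous 1) (h0 : l ≠ 0) :
    ∃ u, eval u l = 1 := by
  obtain ⟨a, rfl⟩ := hom1_eq hl
  obtain ⟨i, hi⟩ : ∃ i, a i ≠ 0 := by
    by_contra hc
    push Not at hc
    simp [hc] at h0
  refine ⟨Pi.single i (a i)⁻¹, ?_⟩
  simp only [map_sum, map_mul, eval_C, eval_X]
  rw [Finset.sum_eq_single i]
  · simp [hi]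
  · intro b _ hb; simp [hb]
  · simp

theorem theta_prime {α β : MvPolynomial (Fin d) k} (u v : Fin d → k)
    (hα : α.IsHomogeneous 1) (hβ : β.IsHomogeneous 1)
    (h1 : α = C (eval u α) * α + C (eval v α) * β)
    (h2 : β = C (eval u β) * α + C (eval v β) * β) :
    (Ideal.span {α, β}).IsPrime ∧ ∀ l : MvPolynomial (Fin d) k, l.IsHomogeneous 1 →
      l ∈ Ideal.span {α, β} → l = C (eval u l) * α + C (eval v l) * β := by
  let θ : MvPolynomial (Fin d) k →ₐ[k] MvPolynomial (Fin d) k :=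
    aeval (fun i => X i - C (u i) * α - C (v i) * β)
  have hlin : ∀ l : MvPolynomial (Fin d) k, l.IsHomogeneous 1 →
      θ l = l - C (eval u l) * α - C (eval v l) * β := by
    intro l hl
    obtain ⟨a, rfl⟩ := hom1_eq hl
    simp only [θ, map_sum, map_mul, eval_C, eval_X, aeval_X, Finset.sum_mul,
      ← Finset.sum_sub_distrib]
    refine Finset.sum_congr rfl fun i _ => ?_
    rw [← algebraMap_eq, AlgHom.commutes]; ring
  have hker : RingHom.ker θ = Ideal.span {α, β} := by
    apply le_antisymm
    · intro p hp
      have : ∀ p, p - θ p ∈ Ideal.span {α, β} := by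
        intro p
        induction p using MvPolynomial.induction_on with
        | C a => rw [← algebraMap_eq, AlgHom.commutes, sub_self]; exact zero_mem _
        | add p q hp hq =>
          have := add_mem hp hq
          convert this using 1
          rw [map_add]; ring
        | mul_X p i hp =>
          have e : p * X i - θ (p * X i) = X i * (p - θ p) + (θ p * C (u i)) * α
            + (θ p * C (v i)) * β := by
            rw [map_mul]
            simp only [θ, aeval_X]; ring
          rw [e]
          refine add_mem (add_mem (Ideal.mul_mem_left _ _ hp) (Ideal.mul_mem_left _ _ ?_))
            (Ideal.mul_mem_left _ _ ?_)
          · exact Ideal.subset_span (by simp)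
          · exact Ideal.subset_span (by simp)
      have h := this p
      rwa [(RingHom.mem_ker).1 hp, sub_zero] at h
    · rw [Ideal.span_le]
      intro l hl
      rcases hl with rfl | hl
      · show θ l = 0
        rw [hlin l hα, sub_sub, ← h1, sub_self]
      · rw [Set.mem_singleton_iff] at hl
        subst hl
        show θ l = 0
        rw [hlin l hβ, sub_sub, ← h2, sub_self]
  refine ⟨hker ▸ RingHom.ker_isPrime θ, fun l hl hm => ?_⟩
  rw [← hker] at hm
  have := hlin l hl
  rw [(RingHom.mem_ker).1 hm, sub_sub] at this
  exact (sub_eq_zero.1 this.symm)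

/-- linear independence of two forms -/
def Indep (α β : MvPolynomial (Fin d) k) : Prop :=
  ∀ a b : k, C a * α + C b * β = 0 → a = 0 ∧ b = 0

theorem Indep.symm {α β : MvPolynomial (Fin d) k} (h : Indep α β) : Indep β α := by
  intro a b hab
  rw [add_comm] at hab
  exact (h b a hab).symm

theorem Indep.ne {α β : MvPolynomial (Fin d) k} (h : Indep α β) : α ≠ 0 := by
  rintro rfl
  have := (h 1 0 (by simp)).1
  exact one_ne_zero this

theorem Indep.pts {α β : MvPolynomial (Fin d) k} (hα : α.IsHomogeneous 1)
    (hβ : β.IsHomogeneous 1) (h : Indep α β) :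
    ∃ u v, eval u α = 1 ∧ eval u β = 0 ∧ eval v α = 0 ∧ eval v β = 1 := by
  obtain ⟨u, hu⟩ := hom1_exists_pt hα h.ne
  have hβ' : (β + C (-eval u β) * α).IsHomogeneous 1 :=
    hβ.add (by simpa using (isHomogeneous_C _ (-eval u β)).mul hα)
  have hne : β + C (-eval u β) * α ≠ 0 := by
    intro h0
    have := (h (-eval u β) 1 (by rw [C_1, one_mul, add_comm]; exact h0)).2
    exact one_ne_zero this
  obtain ⟨v, hv⟩ := hom1_exists_pt hβ' hne
  simp only [map_add, map_mul, eval_C] at hv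
  refine ⟨u + (-eval u β) • (v + (-eval v α) • u), v + (-eval v α) • u, ?_⟩
  simp only [hom1_eval_add hα, hom1_eval_add hβ]
  rw [hu]
  refine ⟨by ring, ?_, by ring, ?_⟩
  · linear_combination (-eval u β) * hv
  · linear_combination hv

theorem Indep.prime {α β : MvPolynomial (Fin d) k} (hα : α.IsHomogeneous 1)
    (hβ : β.IsHomogeneous 1) (h : Indep α β) : (Ideal.span {α, β}).IsPrime := by
  obtain ⟨u, v, h1, h2, h3, h4⟩ := h.pts hα hβ
  exact (theta_prime u v hα hβ (by simp [h1, h3]) (by simp [h2, h4])).1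

theorem Indep.mem {α β l : MvPolynomial (Fin d) k} (hα : α.IsHomogeneous 1)
    (hβ : β.IsHomogeneous 1) (h : Indep α β) (hl : l.IsHomogeneous 1)
    (hm : l ∈ Ideal.span {α, β}) : ∃ a b : k, l = C a * α + C b * β := by
  obtain ⟨u, v, h1, h2, h3, h4⟩ := h.pts hα hβ
  exact ⟨_, _, (theta_prime u v hα hβ (by simp [h1, h3]) (by simp [h2, h4])).2 l hl hm⟩

theorem hom1_prime {α : MvPolynomial (Fin d) k} (hα : α.IsHomogeneous 1) (h : α ≠ 0) :
    Prime α := by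
  obtain ⟨u, hu⟩ := hom1_exists_pt hα h
  have := (theta_prime u 0 hα (isHomogeneous_zero _ _ 1) (by simp [hu]) (by simp)).1
  rw [← Ideal.span_singleton_prime h]
  have e : Ideal.span {α, 0} = Ideal.span {α} := by
    rw [Set.pair_comm, Ideal.span_insert_zero]
  rwa [← e]

theorem Indep.relPrime {α β : MvPolynomial (Fin d) k} (hα : α.IsHomogeneous 1)
    (hβ : β.IsHomogeneous 1) (h : Indep α β) : IsRelPrime α β := by
  rw [(hom1_prime hα h.ne).irreducible.isRelPrime_iff_not_dvd]
  rintro ⟨m, rfl⟩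
  obtain ⟨u, v, h1, h2, h3, h4⟩ := h.pts hα hβ
  rw [map_mul, h3, zero_mul] at h4
  exact zero_ne_one h4

theorem not_indep {α β : MvPolynomial (Fin d) k} (h : ¬ Indep α β) :
    (∃ c : k, α = C c * β) ∨ (∃ c : k, β = C c * α) := by
  unfold Indep at h
  push Not at h
  obtain ⟨a, b, hab, h0⟩ := h
  by_cases ha : a = 0
  · right
    have hb := h0 ha
    refine ⟨0, ?_⟩
    rw [ha, C_0, zero_mul, zero_add] at hab
    rw [C_0, zero_mul]
    refine (mul_eq_zero.1 hab).resolve_left ?_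
    simpa using hb
  · left
    refine ⟨-(a⁻¹ * b), ?_⟩
    have e : C a⁻¹ * C a = (1 : MvPolynomial (Fin d) k) := by
      rw [← C_mul, inv_mul_cancel₀ ha, C_1]
    simp only [map_neg, map_mul]
    linear_combination (-α) * e + C a⁻¹ * hab

theorem unit_C {c : k} (h : c ≠ 0) : IsUnit (C c : MvPolynomial (Fin d) k) :=
  (IsUnit.mk0 c h).map C

theorem unit_hom0 {p : MvPolynomial (Fin d) k} (hp : p.IsHomogeneous 0) (h : p ≠ 0) :
    IsUnit p := by
  have := totalDegree_eq_zero_iff_eq_C.1 (Nat.le_zero.1 hp.totalDegree_le)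
  rw [this]
  apply unit_C
  intro h0
  rw [h0, C_0] at this
  exact h this

theorem hom_factor {p q : MvPolynomial (Fin d) k} {n : ℕ} (h : (p * q).IsHomogeneous n)
    (h0 : p * q ≠ 0) : ∃ a b, a + b = n ∧ p.IsHomogeneous a ∧ q.IsHomogeneous b := by
  have h1 := compHom_hom h
  rw [map_mul] at h1
  have hne : compHom k d p * compHom k d q ≠ 0 := by
    rw [h1]; simpa using h0
  have hp := left_ne_zero_of_mul hne
  have hq := right_ne_zero_of_mul hne
  have e1 := congrArg Polynomial.natDegree h1
  have e2 := congrArg Polynomial.natTrailingDegree h1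
  rw [Polynomial.natDegree_mul hp hq, Polynomial.natDegree_monomial_eq _ h0] at e1
  rw [Polynomial.natTrailingDegree_mul hp hq, Polynomial.natTrailingDegree_monomial h0] at e2
  have l1 := Polynomial.natTrailingDegree_le_natDegree (compHom k d p)
  have l2 := Polynomial.natTrailingDegree_le_natDegree (compHom k d q)
  refine ⟨_, _, e1, isHom_of_comp ?_ le_rfl, isHom_of_comp ?_ le_rfl⟩
  · rw [Polynomial.X_pow_dvd_iff]
    intro i hi
    exact Polynomial.coeff_eq_zero_of_lt_natTrailingDegree (by omega)
  · rw [Polynomial.X_pow_dvd_iff]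
    intro i hi
    exact Polynomial.coeff_eq_zero_of_lt_natTrailingDegree (by omega)

theorem relPrime_rel {A : Type} [CommRing A] [IsDomain A] [UniqueFactorizationMonoid A]
    {α β a b : A} (h : IsRelPrime α β)
    (hab : a * α + b * β = 0) : ∃ g, a = g * β ∧ b = - (g * α) := by
  have h1 : α ∣ b := h.dvd_of_dvd_mul_right ⟨-a, by linear_combination hab⟩
  obtain ⟨g, rfl⟩ := h1
  by_cases hα : α = 0
  · subst hα
    have hu : IsUnit β := isRelPrime_zero_left.1 h
    obtain ⟨c, hc⟩ := hu.exists_left_inv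
    exact ⟨a * c, by rw [mul_assoc, hc, mul_one], by simp⟩
  · refine ⟨-g, ?_, by ring⟩
    apply mul_left_cancel₀ hα
    linear_combination hab

theorem mem_pair {A : Type} [CommRing A] {α β ζ : A} (a b : A) (h : ζ = a * α + b * β) :
    ζ ∈ Ideal.span {α, β} := Ideal.mem_span_pair.2 ⟨a, b, h.symm⟩

/-- algebra for type T -/
theorem algT {α β α2 β2 ζ p q p' : MvPolynomial (Fin d) k}
    (hα : α.IsHomogeneous 1) (hβ : β.IsHomogeneous 1) (hα2 : α2.IsHomogeneous 1)
    (hβ2 : β2.IsHomogeneous 1) (hi : Indep α β)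
    (r1 : p * β2 = q * α2) (r2 : (q - ζ) * β2 = p' * α2)
    (r3 : ζ * α2 = ζ * α - q * α + p * β) (r4 : ζ * β2 = q * β - p' * α)
    (hc : ∀ π, Prime π → π ∣ ζ → π ∣ p → π ∣ q → π ∣ p' → False) (hζ0 : ζ ≠ 0 ∨ p ≠ 0 ∨ q ≠ 0 ∨ p' ≠ 0) :
    IsUnit ζ ∨ ζ ∈ Ideal.span {α, β} := by
  have hP := hi.prime hα hβ
  have mα : α ∈ Ideal.span {α, β} := mem_pair 1 0 (by ring)
  have mβ : β ∈ Ideal.span {α, β} := mem_pair 0 1 (by ring)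
  by_cases h1 : α2 ∈ Ideal.span {α, β}
  swap
  · right
    refine (hP.mem_or_mem (?_ : ζ * α2 ∈ _)).resolve_right h1
    exact mem_pair (ζ - q) p (by rw [r3]; ring)
  by_cases h2 : β2 ∈ Ideal.span {α, β}
  swap
  · right
    refine (hP.mem_or_mem (?_ : ζ * β2 ∈ _)).resolve_right h2
    exact mem_pair (-p') q (by rw [r4]; ring)
  have hrel := hi.relPrime hα hβ
  -- finishing: if zeta divides everything it is a unit
  have hun : ζ ∣ p → ζ ∣ q → ζ ∣ p' → IsUnit ζ := by
    intro d1 d2 d3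
    by_contra hn
    have hz : ζ ≠ 0 := by
      rintro rfl
      simp only [zero_dvd_iff] at d1 d2 d3
      simp [d1, d2, d3] at hζ0
    obtain ⟨π, hπ, hd⟩ := WfDvdMonoid.exists_irreducible_factor hn hz
    exact hc π hπ.prime hd (hd.trans d1) (hd.trans d2) (hd.trans d3)
  by_cases hi2 : Indep α2 β2
  · right
    have hrel2 := hi2.relPrime hα2 hβ2
    obtain ⟨m, hm⟩ : β2 ∣ q := hrel2.symm.dvd_of_dvd_mul_right ⟨p, by linear_combination - r1⟩
    obtain ⟨n, hn⟩ : α2 ∣ q - ζ := hrel2.dvd_of_dvd_mul_right ⟨p', by linear_combination r2⟩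
    have : ζ = m * β2 - n * α2 := by linear_combination hm - hn
    rw [this]
    exact sub_mem (Ideal.mul_mem_left _ _ h2) (Ideal.mul_mem_left _ _ h1)
  -- dependent case, β2 = c α2
  have main : ∀ c : k, β2 = C c * α2 → α2 ≠ 0 → IsUnit ζ ∨ ζ ∈ Ideal.span {α, β} := by
    intro c hcβ h0
    have e1 : q = C c * p := by
      apply mul_right_cancel₀ h0; rw [← r1, hcβ]; ring
    have e2 : p' = C c * (q - ζ) := by
      apply mul_right_cancel₀ h0; rw [← r2, hcβ]; ring
    have e3 : ζ * (α2 - α) = p * (β - C c * α) := by rw [e1] at r3; linear_combination r3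
    have hβ' : (β - C c * α).IsHomogeneous 1 := hβ.sub (by simpa using (isHomogeneous_C _ c).mul hα)
    have hi' : Indep α (β - C c * α) := by
      intro a b hab
      have := hi (a - b * c) b (by simp only [map_sub, map_mul]; linear_combination hab)
      refine ⟨?_, this.2⟩
      have h3 := this.1
      rw [this.2] at h3
      simpa using h3
    have hmem : α2 - α ∈ Ideal.span {α, β - C c * α} := by
      obtain ⟨a, b, hab⟩ := Ideal.mem_span_pair.1 (sub_mem h1 mα)
      exact mem_pair (a + b * C c) b (by rw [← hab]; ring)
    obtain ⟨l, m, hlm⟩ := hi'.mem hα hβ' (hα2.sub hα) hmem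
    have hr' := hi'.relPrime hα hβ'
    by_cases hl : l = 0
    · left
      have hp : p = C m * ζ := by
        apply mul_right_cancel₀ hi'.symm.ne
        rw [← e3, hlm, hl, C_0]; ring
      apply hun
      · exact ⟨_, by rw [hp]; ring⟩
      · rw [e1, hp]; exact ⟨C c * C m, by ring⟩
      · rw [e2, e1, hp]; exact ⟨C c * (C c * C m - 1), by ring⟩
    · right
      have : (β - C c * α) ∣ ζ := by
        have h5 : (β - C c * α) ∣ (ζ * C l) * α := ⟨p - ζ * C m, by
          linear_combination e3 - ζ * hlm⟩
        have h6 := hr'.symm.dvd_of_dvd_mul_right h5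
        exact (unit_C hl).dvd_mul_right.1 h6
      obtain ⟨z, hz⟩ := this
      exact mem_pair (- C c * z) z (by rw [hz]; ring)
  by_cases h0 : α2 = 0
  · by_cases h0' : β2 = 0
    · right
      subst h0 h0'
      obtain ⟨m, hm⟩ : α ∣ q := hrel.dvd_of_dvd_mul_right ⟨p', by linear_combination - r4⟩
      obtain ⟨n, hn⟩ : β ∣ ζ - q := hrel.symm.dvd_of_dvd_mul_right ⟨-p, by linear_combination - r3⟩
      exact mem_pair m n (by linear_combination hm + hn)
    · -- α2 = 0 : p = 0, q = ζ
      subst h0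
      have e1 : p = 0 := by
        apply mul_right_cancel₀ h0'; rw [r1]; ring
      have e2 : q = ζ := by
        apply mul_right_cancel₀ h0'; linear_combination r2
      subst e2
      have e4 : q * (β - β2) = p' * α := by linear_combination - r4
      obtain ⟨l, m, hlm⟩ := hi.mem hα hβ (hβ.sub hβ2) (sub_mem mβ h2)
      by_cases hm : m = 0
      · left
        have : p' = q * C l := by
          apply mul_right_cancel₀ hi.ne
          rw [← e4, hlm, hm, C_0]; ring
        apply hun
        · rw [e1]; exact dvd_zero _
        · exact dvd_rfl
        · exact ⟨_, this⟩
      · right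
        have h5 : α ∣ (q * C m) * β := ⟨p' - q * C l, by linear_combination e4 - q * hlm⟩
        have h6 := (unit_C hm).dvd_mul_right.1 (hrel.dvd_of_dvd_mul_right h5)
        obtain ⟨z, hz⟩ := h6
        exact mem_pair z 0 (by rw [hz]; ring)
  · rcases not_indep hi2 with ⟨c, hc'⟩ | ⟨c, hc'⟩
    · have hc0 : c ≠ 0 := by rintro rfl; simp at hc'; exact h0 hc'
      refine main c⁻¹ ?_ h0
      rw [hc', ← mul_assoc, ← C_mul, inv_mul_cancel₀ hc0, C_1, one_mul]
    · exact main c hc' h0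

/-- algebra for type L -/
theorem algL {α β ζ η a b Q0 Q1 Q2 : MvPolynomial (Fin d) k}
    (hrel : IsRelPrime α β) (ha : a.IsHomogeneous 2) (hb : b.IsHomogeneous 2)
    (hab0 : ¬ (a = 0 ∧ b = 0)) (hab : a * α + b * β = 0)
    (hη : IsRelPrime η ζ)
    (hg : ∀ g, a = g * β → b = - (g * α) →
      g * ζ = - ((Q0 * α ^ 2 + Q1 * (α * β) + Q2 * β ^ 2) * η)) :
    ζ ∈ Ideal.span {α, β} := by
  obtain ⟨g, h1, h2⟩ := relPrime_rel hrel hab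
  have h3 := hg g h1 h2
  have mα : α ∈ Ideal.span {α, β} := mem_pair 1 0 (by ring)
  have mβ : β ∈ Ideal.span {α, β} := mem_pair 0 1 (by ring)
  obtain ⟨g', rfl⟩ : η ∣ g := hη.dvd_of_dvd_mul_right
    ⟨-(Q0 * α ^ 2 + Q1 * (α * β) + Q2 * β ^ 2), by rw [h3]; ring⟩
  have hg0 : η * g' ≠ 0 := by
    intro h0
    apply hab0
    rw [h1, h2, h0]; simp
  have h4 : g' * ζ = -(Q0 * α ^ 2 + Q1 * (α * β) + Q2 * β ^ 2) := by
    apply mul_left_cancel₀ (left_ne_zero_of_mul hg0)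
    linear_combination h3
  have hmem : g' * ζ ∈ Ideal.span {α, β} :=
    mem_pair (-(Q0 * α + Q1 * β)) (-(Q2 * β)) (by rw [h4]; ring)
  have hgu : IsUnit g' → ζ ∈ Ideal.span {α, β} := by
    intro hu
    exact (Ideal.unit_mul_mem_iff_mem _ hu).1 hmem
  by_cases hα : α = 0
  · subst hα
    have hu : IsUnit β := isRelPrime_zero_left.1 hrel
    rw [Ideal.eq_top_of_isUnit_mem _ mβ hu]; trivial
  by_cases hβ : β = 0
  · subst hβ
    have hu : IsUnit α := isRelPrime_zero_right.1 hrel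
    rw [Ideal.eq_top_of_isUnit_mem _ mα hu]; trivial
  have ha' : ((η * g') * β).IsHomogeneous 2 := h1 ▸ ha
  have hb' : ((η * g') * α).IsHomogeneous 2 := by
    have := hb.neg
    rwa [h2, neg_neg] at this
  obtain ⟨m, e, hme, hm, he⟩ := hom_factor ha' (mul_ne_zero hg0 hβ)
  obtain ⟨m', e', hme', hm', he'⟩ := hom_factor hb' (mul_ne_zero hg0 hα)
  have hmm : m = m' := hm.inj_right hm' hg0
  obtain ⟨n0, n, hn, hn0, hgn⟩ := hom_factor hm hg0
  have hee : e = e' := by omega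
  subst hmm hee
  have hcase : e = 0 ∨ e = 2 ∨ e = 1 := by omega
  rcases hcase with rfl | rfl | rfl
  · rw [Ideal.eq_top_of_isUnit_mem _ mβ (unit_hom0 he hβ)]; trivial
  · apply hgu
    have : n = 0 := by omega
    subst this
    exact unit_hom0 hgn (right_ne_zero_of_mul hg0)
  · have hn' : n = 0 ∨ n = 1 := by omega
    rcases hn' with rfl | rfl
    · exact hgu (unit_hom0 hgn (right_ne_zero_of_mul hg0))
    · have hi : Indep α β := by
        by_contra hni
        rcases not_indep hni with ⟨c, hc⟩ | ⟨c, hc⟩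
        · exact (hom1_prime he hβ).not_unit (hrel (hc ▸ Dvd.intro_left _ rfl) dvd_rfl)
        · exact (hom1_prime he' hα).not_unit (hrel dvd_rfl (hc ▸ Dvd.intro_left _ rfl))
      have hP := hi.prime he' he
      rcases hP.mem_or_mem hmem with hgm | h
      · obtain ⟨l, m, hlm⟩ := hi.mem he' he hgn hgm
        have e5 : (C l * ζ + Q0 * α + Q1 * β) * α + (C m * ζ + Q2 * β) * β = 0 := by
          rw [hlm] at h4; linear_combination h4
        obtain ⟨z, hz1, hz2⟩ := relPrime_rel hrel e5
        by_cases hl : l = 0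
        · by_cases hm0 : m = 0
          · exfalso
            apply right_ne_zero_of_mul hg0
            rw [hlm, hl, hm0]; simp
          · exact (Ideal.unit_mul_mem_iff_mem _ (unit_C hm0)).1
              (mem_pair (-z) (-Q2) (by linear_combination hz2))
        · exact (Ideal.unit_mul_mem_iff_mem _ (unit_C hl)).1
              (mem_pair (-Q0) (z - Q1) (by linear_combination hz1))
      · exact h
end linforms
end S8
end

section
namespace S8
section setup
variable {A : Type} [CommRing A] [IsDomain A]
variable {Q : Type} [Field Q] [Algebra A Q] [IsFractionRing A Q]
variable {V : Type} [CommRing V] [Algebra Q V] [Algebra A V] [IsScalarTower A Q V]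

/-- the subalgebra generated by two elements, as a module -/
def BB (A : Type) [CommRing A] {V : Type} [CommRing V] [Algebra A V] (x y : V) : Submodule A V :=
  Subalgebra.toSubmodule (Algebra.adjoin A {x, y})

/-- existence of a good free overmodule -/
def Good {A : Type} [CommRing A] {V : Type} [CommRing V] [Algebra A V] (B : Submodule A V) : Prop :=
  ∃ (n : ℕ) (c : Fin n → V), LinearIndependent A c ∧ B ≤ Submodule.span A (Set.range c) ∧
    ∀ i, InSat B (c i)

theorem BB_shift (x y : V) (σ τ : A) :
    BB A (x - algebraMap A V σ) (y - algebraMap A V τ) = BB A x y := by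
  unfold BB
  congr 1
  apply le_antisymm
  · rw [Algebra.adjoin_le_iff]
    rintro v (rfl | rfl)
    · exact sub_mem (Algebra.subset_adjoin (by simp)) (Subalgebra.algebraMap_mem _ _)
    · exact sub_mem (Algebra.subset_adjoin (by simp)) (Subalgebra.algebraMap_mem _ _)
  · rw [Algebra.adjoin_le_iff]
    rintro v (rfl | rfl)
    · have : v - algebraMap A V σ ∈ Algebra.adjoin A {v - algebraMap A V σ, y - algebraMap A V τ} :=
        Algebra.subset_adjoin (by simp)
      have := add_mem this (Subalgebra.algebraMap_mem _ σ)
      simpa using this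
    · have : v - algebraMap A V τ ∈ Algebra.adjoin A {x - algebraMap A V σ, v - algebraMap A V τ} :=
        Algebra.subset_adjoin (by simp)
      have := add_mem this (Subalgebra.algebraMap_mem _ τ)
      simpa using this

theorem BB_symm (x y : V) : BB A x y = BB A y x := by
  unfold BB; rw [Set.pair_comm]

theorem BB_one (x y : V) : (1 : V) ∈ BB A x y := one_mem (Algebra.adjoin A {x, y})
theorem BB_left (x y : V) : x ∈ BB A x y :=
  show x ∈ Algebra.adjoin A {x, y} from Algebra.subset_adjoin (by simp)
theorem BB_right (x y : V) : y ∈ BB A x y :=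
  show y ∈ Algebra.adjoin A {x, y} from Algebra.subset_adjoin (by simp)

theorem BB_le (x y : V) (G : Set V) (h1 : (1 : V) ∈ Submodule.span A G)
    (hx : ∀ v ∈ G, x * v ∈ Submodule.span A G) (hy : ∀ v ∈ G, y * v ∈ Submodule.span A G) :
    BB A x y ≤ Submodule.span A G := by
  have key : ∀ z : V, (∀ v ∈ G, z * v ∈ Submodule.span A G) →
      ∀ v ∈ Submodule.span A G, z * v ∈ Submodule.span A G := by
    intro z hz v hv
    induction hv using Submodule.span_induction with
    | mem v hv => exact hz v hv
    | zero => rw [mul_zero]; exact zero_mem _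
    | add u v _ _ hu hv => rw [mul_add]; exact add_mem hu hv
    | smul a v _ hv => rw [mul_smul_comm]; exact Submodule.smul_mem _ _ hv
  have key2 : ∀ b ∈ Algebra.adjoin A {x, y}, ∀ v ∈ Submodule.span A G, b * v ∈ Submodule.span A G := by
    intro b hb
    induction hb using Algebra.adjoin_induction with
    | mem b hb =>
      rcases hb with rfl | rfl
      · exact key _ hx
      · exact key _ hy
    | algebraMap r => intro v hv; rw [← Algebra.smul_def]; exact Submodule.smul_mem _ _ hv
    | add a b _ _ ha hb => intro v hv; rw [add_mul]; exact add_mem (ha v hv) (hb v hv)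
    | mul a b _ _ ha hb => intro v hv; rw [mul_assoc]; exact ha _ (hb v hv)
  intro b hb
  have := key2 b hb 1 h1
  rwa [mul_one] at this

theorem ncancel {Q : Type} [Field Q] [Algebra A Q] [IsFractionRing A Q]
    [Algebra Q V] [IsScalarTower A Q V] {w : V} {a : A} (h : algebraMap A V a * w = 0) : a = 0 ∨ w = 0 := by
  by_cases ha : a = 0
  · exact Or.inl ha
  · right
    have ha' : algebraMap A Q a ≠ 0 := by
      rw [Ne, FaithfulSMul.algebraMap_eq_zero_iff]; exact ha
    rw [IsScalarTower.algebraMap_apply A Q V, ← Algebra.smul_def] at h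
    exact (smul_eq_zero_iff_right ha').1 h

theorem wcancel {Q : Type} [Field Q] [Algebra A Q] [IsFractionRing A Q]
    [Algebra Q V] [IsScalarTower A Q V] {w : V} (hw : w ≠ 0) {a b : A}
    (h : algebraMap A V a * w = algebraMap A V b * w) : a = b := by
  rw [← sub_eq_zero, ← sub_mul, ← map_sub] at h
  exact sub_eq_zero.1 ((ncancel (Q := Q) h).resolve_right hw)

theorem qdiv (a : A) (ha : a ≠ 0) (v : V) : ∃ n : V, algebraMap A V a * n = v ∧
    ∃ q : Q, n = q • v := by
  have ha' : algebraMap A Q a ≠ 0 := by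
    rw [Ne, FaithfulSMul.algebraMap_eq_zero_iff]; exact ha
  refine ⟨(algebraMap A Q a)⁻¹ • v, ?_, _, rfl⟩
  rw [IsScalarTower.algebraMap_apply A Q V, ← Algebra.smul_def, smul_smul, mul_inv_cancel₀ ha',
    one_smul]

theorem good_of_span [Module.Finite Q V] {B : Submodule A V} {n : ℕ}
    (hr : Module.finrank Q V = n)
    (hT : ∀ v : V, ∃ h : A, h ≠ 0 ∧ algebraMap A V h * v ∈ B) (c : Fin n → V)
    (hB : B ≤ Submodule.span A (Set.range c)) (hs : ∀ i, InSat B (c i)) : Good B := by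
  refine ⟨n, c, ?_, hB, hs⟩
  have : LinearIndependent Q c := by
    apply linearIndependent_of_top_le_span_of_card_eq_finrank
    · intro v _
      obtain ⟨h, hh, hv⟩ := hT v
      have h1 : algebraMap A V h * v ∈ Submodule.span Q (Set.range c) :=
        Submodule.span_le_restrictScalars A Q _ (hB hv)
      obtain ⟨u, hu, q, hq⟩ := qdiv (Q := Q) h hh (algebraMap A V h * v)
      have : u = v := by
        rw [← sub_eq_zero]
        refine (ncancel (Q := Q) (?_ : algebraMap A V h * (u - v) = 0)).resolve_left hh
        rw [mul_sub, hu, sub_self]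
      rw [← this, hq]
      exact Submodule.smul_mem _ _ h1
    · simp [hr]
  exact this.restrict_scalars (fun a b h => by
    simp only [Algebra.smul_def, mul_one] at h
    exact FaithfulSMul.algebraMap_injective A Q h)

theorem good3 [Module.Finite Q V] {B : Submodule A V}
    (hr : Module.finrank Q V = 3)
    (hT : ∀ v : V, ∃ h : A, h ≠ 0 ∧ algebraMap A V h * v ∈ B) (a b c : V)
    (hB : B ≤ Submodule.span A {a, b, c}) (ha : InSat B a) (hb : InSat B b) (hc : InSat B c) :
    Good B := by
  apply good_of_span hr hT ![a, b, c]
  · convert hB using 2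
    simp only [Matrix.range_cons, Matrix.range_empty, Set.union_empty, Set.union_singleton]
    ext v; simp; tauto
  · intro i; fin_cases i <;> simp [ha, hb, hc]

theorem mem3 (a b c : V) {v : V} (l m n : A)
    (h : v = algebraMap A V l * a + algebraMap A V m * b + algebraMap A V n * c) :
    v ∈ Submodule.span A {a, b, c} := by
  rw [h]
  simp only [← Algebra.smul_def]
  refine add_mem (add_mem ?_ ?_) ?_ <;> refine Submodule.smul_mem _ _ (Submodule.subset_span ?_) <;>
    simp

/-- saturated generator of a line -/
theorem R1 [IsNoetherianRing A] [UniqueFactorizationMonoid A] {B : Submodule A V} (hfg : B.FG)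
    (hT : ∀ v : V, ∃ h : A, h ≠ 0 ∧ algebraMap A V h * v ∈ B) (z : V) (hz : z ≠ 0) :
    ∃ w : V, w ≠ 0 ∧ (∃ q : Q, w = q • z) ∧
      (∀ c : Q, c • z ∈ B → ∃ a : A, c • z = algebraMap A V a * w) ∧ InSat B w := by
  let f : Q →ₗ[A] V := (LinearMap.toSpanSingleton Q V z).restrictScalars A
  have hf : ∀ c, f c = c • z := fun c => rfl
  have hinj : Function.Injective f := by
    intro a b hab
    rw [hf, hf, ← sub_eq_zero, ← sub_smul] at hab
    exact sub_eq_zero.1 ((smul_eq_zero.1 hab).resolve_right hz)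
  let M : Submodule A Q := B.comap f
  have hM : ∀ c, c ∈ M ↔ c • z ∈ B := fun c => Iff.rfl
  have hMfg : M.FG := by
    have : M.map f ≤ B := Submodule.map_comap_le _ _
    have hn : IsNoetherian A B := isNoetherian_of_fg_of_noetherian B hfg
    have h1 : (M.map f).FG := by
      have hn' : IsNoetherian A (M.map f) := isNoetherian_of_le this
      exact (Submodule.fg_top _).1 (IsNoetherian.noetherian ⊤)
    exact Submodule.fg_of_fg_map_injective f hinj h1
  obtain ⟨h, hh, hintg⟩ := FractionalIdeal.isFractional_of_fg (S := nonZeroDivisors A) hMfg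
  have hh0 : h ≠ 0 := nonZeroDivisors.ne_zero hh
  have hQh : algebraMap A Q h ≠ 0 := by
    rw [Ne, FaithfulSMul.algebraMap_eq_zero_iff]; exact hh0
  -- a / h
  let D : A → Q := fun a => algebraMap A Q a / algebraMap A Q h
  have hDmul : ∀ a b, D (a * b) = algebraMap A Q b * D a := by
    intro a b; simp only [D, map_mul]; ring
  obtain ⟨g0, hg0, hg0B⟩ := hT z
  have hg0M : algebraMap A Q g0 ∈ M := by
    rw [hM, Algebra.smul_def, ← IsScalarTower.algebraMap_apply]; exact hg0B
  let N : Set A := {a | D a ∈ M}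
  have hN : ∀ c ∈ M, ∃ a ∈ N, c = D a := by
    intro c hc
    obtain ⟨a, ha⟩ := hintg c hc
    have : c = D a := by
      simp only [D]; rw [ha, Algebra.smul_def]; field_simp
    exact ⟨a, by show D a ∈ M; rwa [← this], this⟩
  obtain ⟨n0, hn0N, hn0⟩ := hN _ hg0M
  have hn00 : n0 ≠ 0 := by
    rintro rfl
    simp only [D, map_zero, zero_div, FaithfulSMul.algebraMap_eq_zero_iff] at hn0
    exact hg0 hn0
  -- gcd
  obtain ⟨m, ⟨j, hjm, hj⟩, hmin⟩ := (WellFounded.has_min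
    (IsWellFounded.wf (r := DvdNotUnit (α := A))) {m | ∃ j, n0 = j * m ∧ ∀ n ∈ N, j ∣ n}
    ⟨n0, 1, by simp, fun n _ => one_dvd n⟩)
  have hj0 : j ≠ 0 := by rintro rfl; simp at hjm; exact hn00 hjm
  have hm0 : m ≠ 0 := by rintro rfl; simp at hjm; exact hn00 hjm
  have hDj : D j ≠ 0 := by
    simp only [D]
    refine div_ne_zero ?_ hQh
    rw [Ne, FaithfulSMul.algebraMap_eq_zero_iff]; exact hj0
  refine ⟨D j • z, smul_ne_zero hDj hz, ⟨_, rfl⟩, ?_, ?_⟩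
  · intro c hc
    obtain ⟨a, haN, rfl⟩ := hN c hc
    obtain ⟨e, rfl⟩ := hj a haN
    refine ⟨e, ?_⟩
    rw [hDmul, mul_smul, IsScalarTower.algebraMap_apply A Q V, ← Algebra.smul_def]
  · intro π hπ
    by_contra hcon
    push Not at hcon
    have hdiv : ∀ n ∈ N, j * π ∣ n := by
      intro n hn
      obtain ⟨e, rfl⟩ := hj n hn
      apply mul_dvd_mul_left
      by_contra he
      apply hcon e he
      have : D (j * e) • z ∈ B := hn
      rw [hDmul, mul_smul] at this
      rwa [algebraMap_smul] at this
    obtain ⟨m', rfl⟩ : π ∣ m := by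
      have := hdiv n0 hn0N
      rw [hjm] at this
      exact (mul_dvd_mul_iff_left hj0).1 this
    refine hmin m' ⟨j * π, by rw [hjm]; ring, hdiv⟩ ⟨right_ne_zero_of_mul hm0, π, hπ.not_unit, by ring⟩

theorem exists_div {Q : Type} [Field Q] [Algebra A Q] [IsFractionRing A Q]
    [Algebra Q V] [IsScalarTower A Q V] {α β : A} (h : IsRelPrime α β) (u v : V)
    (huv : algebraMap A V β * u = algebraMap A V α * v) :
    ∃ n, algebraMap A V α * n = u ∧ algebraMap A V β * n = v := by
  have key : ∀ {α β : A} (u v : V), α ≠ 0 →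
    algebraMap A V β * u = algebraMap A V α * v → ∃ n, algebraMap A V α * n = u ∧ algebraMap A V β * n = v := by
    intro α β u v hα huv
    obtain ⟨n, hn, -⟩ := qdiv (Q := Q) α hα u
    refine ⟨n, hn, ?_⟩
    rw [← sub_eq_zero]
    refine (ncancel (Q := Q) (?_ : algebraMap A V α * _ = 0)).resolve_left hα
    linear_combination algebraMap A V β * hn + huv
  by_cases hα : α = 0
  · have hβ : β ≠ 0 := by
      rintro rfl
      exact not_isRelPrime_zero_zero (hα ▸ h)
    obtain ⟨n, h1, h2⟩ := key v u hβ huv.symm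
    exact ⟨n, h2, h1⟩
  · exact key u v hα huv

theorem exists_div_w {Q : Type} [Field Q] [Algebra A Q] [IsFractionRing A Q]
    [Algebra Q V] [IsScalarTower A Q V] [UniqueFactorizationMonoid A] {α β a b : A} (h : IsRelPrime α β) (v w : V)
    (hw : w ≠ 0)
    (h1 : algebraMap A V α * v = algebraMap A V a * w)
    (h2 : algebraMap A V β * v = algebraMap A V b * w) : ∃ ρ : A, v = algebraMap A V ρ * w := by
  have e : a * β + (-b) * α = 0 := by
    apply wcancel (Q := Q) hw
    simp only [map_add, map_mul, map_neg, map_zero]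
    linear_combination algebraMap A V α * h2 - algebraMap A V β * h1
  obtain ⟨g, hg1, hg2⟩ := relPrime_rel h.symm e
  refine ⟨g, ?_⟩
  rw [← sub_eq_zero]
  by_cases hα : α = 0
  · have hβ : β ≠ 0 := by
      rintro rfl
      exact not_isRelPrime_zero_zero (hα ▸ h)
    refine (ncancel (Q := Q) (?_ : algebraMap A V β * _ = 0)).resolve_left hβ
    have hb : b = g * β := by linear_combination - hg2
    rw [hb, map_mul] at h2
    linear_combination h2
  · refine (ncancel (Q := Q) (?_ : algebraMap A V α * _ = 0)).resolve_left hα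
    rw [hg1, map_mul] at h1
    linear_combination h1

/-- data of a flag -/
structure Flag (x y w : V) (α β ζ p q p' α2 β2 γ : A) : Prop where
  hw : w ≠ 0
  rel : IsRelPrime α β
  e0 : algebraMap A V β * x - algebraMap A V α * y = algebraMap A V ζ * w
  exx : x * x = algebraMap A V (γ * α) * x + algebraMap A V p * w
  exy : x * y = algebraMap A V (γ * α) * y + algebraMap A V q * w
  eyy : y * y = algebraMap A V (γ * β) * y + algebraMap A V p' * w
  exw : x * w = algebraMap A V α2 * w
  eyw : y * w = algebraMap A V β2 * w
  sat : InSat (BB A x y) w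
  hJ : ∀ c g h e : A, algebraMap A V c + algebraMap A V g * x + algebraMap A V h * y =
    algebraMap A V e * w → c = 0 ∧ g * α + h * β = 0

variable {x y w : V} {α β ζ p q p' α2 β2 γ : A}

theorem Flag.rels {Q : Type} [Field Q] [Algebra A Q] [IsFractionRing A Q]
    [Algebra Q V] [IsScalarTower A Q V] (F : Flag x y w α β ζ p q p' α2 β2 γ) :
    p * β2 = q * α2 ∧ (q - γ * ζ) * β2 = p' * α2 ∧
    ζ * α2 = γ * α * ζ - q * α + p * β ∧ ζ * β2 = q * β - p' * α := by
  have e0 := F.e0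
  have exx := F.exx
  have exy := F.exy
  have eyy := F.eyy
  have exw := F.exw
  have eyw := F.eyw
  simp only [map_mul] at exx exy eyy
  refine ⟨?_, ?_, ?_, ?_⟩ <;> apply wcancel (Q := Q) F.hw <;>
    simp only [map_mul, map_sub, map_add]
  · linear_combination (-y) * exx + x * exy - algebraMap A V p * eyw + algebraMap A V q * exw
  · linear_combination (-y) * exy + x * eyy - algebraMap A V q * eyw + algebraMap A V p' * exw
      + algebraMap A V γ * y * e0 + algebraMap A V γ * algebraMap A V ζ * eyw
  · linear_combination - x * e0 - algebraMap A V ζ * exw + algebraMap A V β * exx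
      - algebraMap A V α * exy + algebraMap A V γ * algebraMap A V α * e0
  · linear_combination - y * e0 - algebraMap A V ζ * eyw + algebraMap A V β * exy
      - algebraMap A V α * eyy

theorem Flag.dvd {Q : Type} [Field Q] [Algebra A Q] [IsFractionRing A Q]
    [Algebra Q V] [IsScalarTower A Q V] [UniqueFactorizationMonoid A] (F : Flag x y w α β ζ p q p' α2 β2 γ)
    (π : A) (h1 : π ∣ ζ) (h2 : π ∣ p) (h3 : π ∣ q) (h4 : π ∣ p') (a : A)
    (haw : a • w ∈ BB A x y) : π ∣ a := by
  obtain ⟨ζ, rfl⟩ := h1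
  obtain ⟨p, rfl⟩ := h2
  obtain ⟨q, rfl⟩ := h3
  obtain ⟨p', rfl⟩ := h4
  have e0 := F.e0
  have exx := F.exx
  have exy := F.exy
  have eyy := F.eyy
  have exw := F.exw
  have eyw := F.eyw
  simp only [map_mul] at exx exy eyy e0
  have hmem : ∀ (v : V) (c g h e : A), v = algebraMap A V c + algebraMap A V g * x +
      algebraMap A V h * y + algebraMap A V e * (algebraMap A V π * w) →
      v ∈ Submodule.span A ({1, x, y, algebraMap A V π * w} : Set V) := by
    intro v c g h e hv
    have : v = c • 1 + g • x + h • y + e • (algebraMap A V π * w) := by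
      simp only [Algebra.smul_def]; rw [hv]; ring
    rw [this]
    refine add_mem (add_mem (add_mem ?_ ?_) ?_) ?_ <;>
      refine Submodule.smul_mem _ _ (Submodule.subset_span ?_) <;> simp
  have hle : BB A x y ≤ Submodule.span A ({1, x, y, algebraMap A V π * w} : Set V) := by
    apply BB_le
    · exact Submodule.subset_span (by simp)
    · rintro v (rfl | rfl | rfl | rfl)
      · exact hmem _ 0 1 0 0 (by simp)
      · exact hmem _ 0 (γ * α) 0 p (by simp only [map_mul, map_zero]; linear_combination exx)
      · exact hmem _ 0 0 (γ * α) q (by simp only [map_mul, map_zero]; linear_combination exy)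
      · exact hmem _ 0 0 0 α2 (by
          simp only [map_zero]; linear_combination algebraMap A V π * exw)
    · rintro v (rfl | rfl | rfl | rfl)
      · exact hmem _ 0 0 1 0 (by simp)
      · exact hmem _ 0 0 (γ * α) q (by simp only [map_mul, map_zero]; linear_combination exy)
      · exact hmem _ 0 0 (γ * β) p' (by simp only [map_mul, map_zero]; linear_combination eyy)
      · exact hmem _ 0 0 0 β2 (by
          simp only [map_zero]; linear_combination algebraMap A V π * eyw)
  have h := hle haw
  rw [Submodule.mem_span_insert] at h
  obtain ⟨c, u, hu, h⟩ := h
  rw [Submodule.mem_span_insert] at hu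
  obtain ⟨g, u', hu', rfl⟩ := hu
  rw [Submodule.mem_span_pair] at hu'
  obtain ⟨h', e, rfl⟩ := hu'
  simp only [Algebra.smul_def, mul_one] at h
  have hj := F.hJ c g h' (a - e * π) (by simp only [map_mul, map_sub]; linear_combination - h)
  obtain ⟨rfl, hj⟩ := hj
  obtain ⟨m, rfl, rfl⟩ := relPrime_rel F.rel hj
  refine ⟨m * ζ + e, ?_⟩
  apply wcancel (Q := Q) F.hw
  simp only [map_add, map_mul, map_neg, map_zero] at h ⊢
  linear_combination h + algebraMap A V m * e0

theorem Flag.coprime {Q : Type} [Field Q] [Algebra A Q] [IsFractionRing A Q]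
    [Algebra Q V] [IsScalarTower A Q V] [UniqueFactorizationMonoid A] (F : Flag x y w α β ζ p q p' α2 β2 γ)
    (π : A) (hπ : Prime π) (h1 : π ∣ ζ) (h2 : π ∣ p) (h3 : π ∣ q) (h4 : π ∣ p') : False := by
  obtain ⟨a, ha, haw⟩ := F.sat π hπ
  exact ha (F.dvd (Q := Q) π h1 h2 h3 h4 a haw)

theorem Flag.nonzero {Q : Type} [Field Q] [Algebra A Q] [IsFractionRing A Q]
    [Algebra Q V] [IsScalarTower A Q V] [UniqueFactorizationMonoid A] (F : Flag x y w α β ζ p q p' α2 β2 γ)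
    (hT : ∀ v : V, ∃ h : A, h ≠ 0 ∧ algebraMap A V h * v ∈ BB A x y) :
    ζ ≠ 0 ∨ p ≠ 0 ∨ q ≠ 0 ∨ p' ≠ 0 := by
  by_contra hc
  push Not at hc
  obtain ⟨h1, h2, h3, h4⟩ := hc
  obtain ⟨a, ha, haw⟩ := hT w
  rw [← Algebra.smul_def] at haw
  exact ha (zero_dvd_iff.1 (F.dvd (Q := Q) 0 (by simp [h1]) (by simp [h2]) (by simp [h3])
    (by simp [h4]) a haw))

theorem Flag.good [UniqueFactorizationMonoid A] [Module.Finite Q V] (hr : Module.finrank Q V = 3)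
    (hT : ∀ v : V, ∃ h : A, h ≠ 0 ∧ algebraMap A V h * v ∈ BB A x y)
    (F : Flag x y w α β ζ p q p' α2 β2 γ) (hζ : IsUnit ζ ∨ ζ ∈ Ideal.span {α, β}) :
    Good (BB A x y) := by
  have e0 := F.e0
  have exx := F.exx
  have exy := F.exy
  have eyy := F.eyy
  have exw := F.exw
  have eyw := F.eyw
  simp only [map_mul] at exx exy eyy e0
  rcases hζ with hu | hm
  · obtain ⟨i, hi⟩ := hu.exists_left_inv
    have hw : w = algebraMap A V (i * β) * x - algebraMap A V (i * α) * y := by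
      have := congrArg (algebraMap A V) hi
      simp only [map_mul, map_one] at this ⊢
      linear_combination (-w) * this - algebraMap A V i * e0
    apply good3 hr hT 1 x y
    · apply BB_le
      · exact Submodule.subset_span (by simp)
      · rintro v (rfl | rfl | rfl)
        · exact mem3 _ _ _ 0 1 0 (by simp)
        · exact mem3 _ _ _ 0 (γ * α + p * (i * β)) (- p * (i * α)) (by
            simp only [map_add, map_mul, map_neg, map_zero] at hw ⊢
            linear_combination exx + algebraMap A V p * hw)
        · exact mem3 _ _ _ 0 (q * (i * β)) (γ * α - q * (i * α)) (by
            simp only [map_add, map_mul, map_sub, map_zero] at hw ⊢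
            linear_combination exy + algebraMap A V q * hw)
      · rintro v (rfl | rfl | rfl)
        · exact mem3 _ _ _ 0 0 1 (by simp)
        · exact mem3 _ _ _ 0 (q * (i * β)) (γ * α - q * (i * α)) (by
            simp only [map_add, map_mul, map_sub, map_zero] at hw ⊢
            linear_combination exy + algebraMap A V q * hw)
        · exact mem3 _ _ _ 0 (p' * (i * β)) (γ * β - p' * (i * α)) (by
            simp only [map_add, map_mul, map_sub, map_zero] at hw ⊢
            linear_combination eyy + algebraMap A V p' * hw)
    · exact inSat_of_mem (BB_one _ _)
    · exact inSat_of_mem (BB_left _ _)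
    · exact inSat_of_mem (BB_right _ _)
  · obtain ⟨μ, l, hml⟩ := Ideal.mem_span_pair.1 hm
    obtain ⟨n, hn1, hn2⟩ := exists_div (Q := Q) F.rel (x - algebraMap A V l * w)
      (y + algebraMap A V μ * w) (by
        rw [← hml] at e0
        simp only [map_add, map_mul] at e0
        linear_combination e0)
    have hxn : ∃ ρ : A, x * n - algebraMap A V (γ * α) * n = algebraMap A V ρ * w := by
      apply exists_div_w (Q := Q) F.rel _ _ F.hw (a := p - l * α2 + γ * α * l)
        (b := q + μ * α2 - γ * α * μ)
      · simp only [map_add, map_mul, map_sub]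
        linear_combination (x - algebraMap A V γ * algebraMap A V α) * hn1 + exx
          - algebraMap A V l * exw
      · simp only [map_add, map_mul, map_sub]
        linear_combination (x - algebraMap A V γ * algebraMap A V α) * hn2 + exy
          + algebraMap A V μ * exw
    have hyn : ∃ ρ : A, y * n - algebraMap A V γ * y = algebraMap A V ρ * w := by
      apply exists_div_w (Q := Q) F.rel _ _ F.hw (a := q - l * β2) (b := p' + μ * β2)
      · simp only [map_add, map_mul, map_sub]
        linear_combination y * hn1 + exy - algebraMap A V l * eyw
      · simp only [map_add, map_mul, map_sub]
        linear_combination y * hn2 + eyy + algebraMap A V μ * eyw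
    obtain ⟨ρ, hρ⟩ := hxn
    obtain ⟨ρ', hρ'⟩ := hyn
    simp only [map_mul] at hρ hρ'
    apply good3 hr hT 1 n w
    · apply BB_le
      · exact Submodule.subset_span (by simp)
      · rintro v (rfl | rfl | rfl)
        · exact mem3 _ _ _ 0 α l (by simp only [map_zero]; linear_combination - hn1)
        · exact mem3 _ _ _ 0 (γ * α) ρ (by
            simp only [map_mul, map_zero]; linear_combination hρ)
        · exact mem3 _ _ _ 0 0 α2 (by simp only [map_zero]; linear_combination exw)
      · rintro v (rfl | rfl | rfl)
        · exact mem3 _ _ _ 0 β (-μ) (by simp only [map_zero, map_neg]; linear_combination - hn2)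
        · exact mem3 _ _ _ 0 (γ * β) (ρ' - γ * μ) (by
            simp only [map_mul, map_zero, map_sub]
            linear_combination hρ' - algebraMap A V γ * hn2)
        · exact mem3 _ _ _ 0 0 β2 (by simp only [map_zero]; linear_combination eyw)
    · exact inSat_of_mem (BB_one _ _)
    · apply InSat.of_coprime α β
      · intro π hπ h1 h2
        exact hπ.not_unit (F.rel h1 h2)
      · rw [Algebra.smul_def, hn1, sub_eq_add_neg, ← neg_mul, ← map_neg, ← Algebra.smul_def]
        exact (inSat_of_mem (BB_left _ _)).add (F.sat.smul _)
      · rw [Algebra.smul_def, hn2, ← Algebra.smul_def]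
        exact (inSat_of_mem (BB_right _ _)).add (F.sat.smul _)
    · exact F.sat
end setup

section charlin
open Polynomial
variable {k : Type} [Field k] {d : ℕ}

/-- homogeneous integrality over A -/
def HomIntA {V : Type} [CommRing V] [Algebra (MvPolynomial (Fin d) k) V] (x : V) : Prop :=
  ∃ H : (MvPolynomial (Fin d) k)[X], H.Monic ∧
    (∀ i ≤ H.natDegree, (H.coeff i).IsHomogeneous (H.natDegree - i)) ∧
    H.eval₂ (algebraMap (MvPolynomial (Fin d) k) V) x = 0

theorem root_hom {a : MvPolynomial (Fin d) k} {R : (MvPolynomial (Fin d) k)[X]} (hR : R.Monic)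
    (hh : ∀ i ≤ ((X - C a) * R).natDegree,
      (((X - C a) * R).coeff i).IsHomogeneous (((X - C a) * R).natDegree - i)) :
    a.IsHomogeneous 1 := by
  generalize hP : X - C a = P at hh
  have hPm : P.Monic := hP ▸ monic_X_sub_C a
  have hdeg : P.natDegree = 1 := by rw [← hP, natDegree_X_sub_C]
  have hc : P.coeff 0 = -a := by rw [← hP]; simp
  have g1 : ∀ i ≤ (P * R).natDegree, X ^ ((P * R).natDegree - i) ∣
      (compHom k d).toRingHom ((P * R).coeff i) := by
    intro i hi
    have e : (compHom k d).toRingHom ((P * R).coeff i) = compHom k d ((P * R).coeff i) := rfl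
    rw [e, compHom_hom (hh i hi), ← C_mul_X_pow_eq_monomial]
    exact Dvd.intro_left _ rfl
  have g2 : ∀ i ≤ (P * R).natDegree, 
      ((compHom k d).toRingHom ((P * R).coeff i)).natDegree ≤ (P * R).natDegree - i := by
    intro i hi
    have e : (compHom k d).toRingHom ((P * R).coeff i) = compHom k d ((P * R).coeff i) := rfl
    rw [e, compHom_hom (hh i hi)]
    exact natDegree_monomial_le _
  have l1 := order_lower (compHom k d).toRingHom hPm hR g1 0 (by simp)
  have l2 := order_upper (compHom k d).toRingHom hPm hR g2 0 (by simp)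
  rw [hdeg, hc] at l1 l2
  have h3 : (-a).IsHomogeneous 1 := isHom_of_comp l1 l2
  simpa using h3.neg

theorem charlin {Q : Type} [Field Q] [Algebra (MvPolynomial (Fin d) k) Q]
    [IsFractionRing (MvPolynomial (Fin d) k) Q] (x : Q) (h : HomIntA (d := d) (k := k) x) :
    ∃ a : MvPolynomial (Fin d) k, a.IsHomogeneous 1 ∧ x = algebraMap _ Q a := by
  obtain ⟨H, hm, hh, h0⟩ := h
  obtain ⟨a, rfl⟩ := (IsIntegrallyClosed.isIntegral_iff (R := MvPolynomial (Fin d) k)).1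
    (⟨H, hm, h0⟩ : IsIntegral (MvPolynomial (Fin d) k) x)
  refine ⟨a, ?_, rfl⟩
  rw [eval₂_at_apply, FaithfulSMul.algebraMap_eq_zero_iff] at h0
  obtain ⟨R, rfl⟩ := dvd_iff_isRoot.2 h0
  have hR : R.Monic := (monic_X_sub_C a).of_mul_monic_left hm
  exact root_hom hR hh

end charlin
end S8
end

section
namespace S8
section gen
variable {A : Type} [CommRing A] [IsDomain A]
variable {Q : Type} [Field Q] [Algebra A Q] [IsFractionRing A Q]
variable {V : Type} [CommRing V] [Algebra Q V] [Algebra A V] [IsScalarTower A Q V]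

theorem char_alg (c : V →ₐ[Q] Q) (a : A) : c (algebraMap A V a) = algebraMap A Q a := by
  rw [IsScalarTower.algebraMap_apply A Q V, AlgHom.commutes]; rfl

theorem aq_inj {a b : A} (h : algebraMap A Q a = algebraMap A Q b) : a = b :=
  FaithfulSMul.algebraMap_injective A Q h

theorem aq_zero {a : A} (h : algebraMap A Q a = 0) : a = 0 :=
  (FaithfulSMul.algebraMap_eq_zero_iff A Q).1 h

theorem act_char (z : V) (hz : z ≠ 0) (h : ∀ u : V, ∃ q : Q, u * z = q • z) :
    ∃ c : V →ₐ[Q] Q, ∀ u, u * z = c u • z := by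
  choose c hc using h
  have huniq : ∀ a b : Q, a • z = b • z → a = b := by
    intro a b hab
    rw [← sub_eq_zero, ← sub_smul] at hab
    exact sub_eq_zero.1 ((smul_eq_zero.1 hab).resolve_right hz)
  refine ⟨{ toFun := c, map_one' := ?_, map_mul' := ?_, map_zero' := ?_, map_add' := ?_,
            commutes' := ?_ }, hc⟩
  · apply huniq; rw [← hc]; simp
  · intro a b; apply huniq; rw [← hc, mul_smul, ← hc, ← mul_smul_comm, ← hc]; ring
  · apply huniq; rw [← hc]; simp
  · intro a b; apply huniq; rw [← hc, add_smul, ← hc, ← hc]; ring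
  · intro a; apply huniq; rw [← hc, ← Algebra.smul_def]; rfl

theorem char_ext {s t : V} (hT : ∀ v : V, ∃ h : A, h ≠ 0 ∧ algebraMap A V h * v ∈ BB A s t)
    (c c' : V →ₐ[Q] Q) (h1 : c s = c' s) (h2 : c t = c' t) : c = c' := by
  have key : ∀ b ∈ Algebra.adjoin A {s, t}, c b = c' b := by
    intro b hb
    induction hb using Algebra.adjoin_induction with
    | mem b hb => rcases hb with rfl | rfl <;> assumption
    | algebraMap r => rw [char_alg, char_alg]
    | add a b _ _ ha hb => rw [map_add, map_add, ha, hb]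
    | mul a b _ _ ha hb => rw [map_mul, map_mul, ha, hb]
  apply AlgHom.ext
  intro v
  obtain ⟨h, hh, hv⟩ := hT v
  have := key _ hv
  rw [map_mul, map_mul, char_alg, char_alg] at this
  exact mul_left_cancel₀ (fun h0 => hh (aq_zero h0)) this

theorem finrank_le_of_span [Module.Finite Q V] {B : Submodule A V} {n : ℕ}
    (hT : ∀ v : V, ∃ h : A, h ≠ 0 ∧ algebraMap A V h * v ∈ B) (c : Fin n → V)
    (hB : B ≤ Submodule.span A (Set.range c)) : Module.finrank Q V ≤ n := by
  have : Submodule.span Q (Set.range c) = ⊤ := by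
    rw [eq_top_iff]
    intro v _
    obtain ⟨h, hh, hv⟩ := hT v
    have h1 : algebraMap A V h * v ∈ Submodule.span Q (Set.range c) :=
      Submodule.span_le_restrictScalars A Q _ (hB hv)
    obtain ⟨u, hu, q, hq⟩ := qdiv (Q := Q) h hh (algebraMap A V h * v)
    have : u = v := by
      rw [← sub_eq_zero]
      refine (ncancel (Q := Q) (?_ : algebraMap A V h * (u - v) = 0)).resolve_left hh
      rw [mul_sub, hu, sub_self]
    rw [← this, hq]
    exact Submodule.smul_mem _ _ h1
  have h2 := finrank_range_le_card (R := Q) c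
  rw [Set.finrank, this, finrank_top] at h2
  simpa using h2

theorem mem2 (a b : V) {v : V} (l m : A)
    (h : v = algebraMap A V l * a + algebraMap A V m * b) :
    v ∈ Submodule.span A {a, b} := by
  rw [h]
  simp only [← Algebra.smul_def]
  refine add_mem ?_ ?_ <;> refine Submodule.smul_mem _ _ (Submodule.subset_span ?_) <;>
    simp

theorem span2_range (a b : V) : Submodule.span A (Set.range ![a, b]) = Submodule.span A {a, b} := by
  congr 1
  simp only [Matrix.range_cons, Matrix.range_empty, Set.union_empty, Set.union_singleton]
  ext v; simp; tauto

theorem good2 [Module.Finite Q V] {B : Submodule A V}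
    (hr : Module.finrank Q V = 2)
    (hT : ∀ v : V, ∃ h : A, h ≠ 0 ∧ algebraMap A V h * v ∈ B) (a b : V)
    (hB : B ≤ Submodule.span A {a, b}) (ha : InSat B a) (hb : InSat B b) :
    Good B := by
  apply good_of_span hr hT ![a, b]
  · rwa [span2_range]
  · intro i; fin_cases i <;> simp [ha, hb]

theorem R1' [IsNoetherianRing A] [UniqueFactorizationMonoid A] {B : Submodule A V} (hfg : B.FG)
    (hT : ∀ v : V, ∃ h : A, h ≠ 0 ∧ algebraMap A V h * v ∈ B) (z : V) (hz : z ≠ 0) :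
    ∃ w : V, w ≠ 0 ∧ (∃ q : Q, w = q • z) ∧
      (∀ u ∈ B, (∃ c : Q, u = c • z) → ∃ a : A, u = algebraMap A V a * w) ∧ InSat B w := by
  obtain ⟨w, h1, h2, h3, h4⟩ := R1 (Q := Q) hfg hT z hz
  exact ⟨w, h1, h2, fun u hu ⟨c, hc⟩ => by subst hc; exact h3 c hu, h4⟩

theorem BB_alg (x y : V) (a : A) : algebraMap A V a ∈ BB A x y :=
  Subalgebra.algebraMap_mem (Algebra.adjoin A {x, y}) a

theorem BB_mul {x y u v : V} (hu : u ∈ BB A x y) (hv : v ∈ BB A x y) : u * v ∈ BB A x y :=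
  Subalgebra.mul_mem (Algebra.adjoin A {x, y}) hu hv

/-- a line in terms of finrank -/
theorem line [Module.Finite Q V] (I : Submodule Q V) (h : Module.finrank Q I = 1) :
    ∃ z : V, z ≠ 0 ∧ z ∈ I ∧ ∀ u ∈ I, ∃ q : Q, u = q • z := by
  obtain ⟨z, hz, hall⟩ := finrank_eq_one_iff'.1 h
  refine ⟨z.1, by simpa using hz, z.2, fun u hu => ?_⟩
  obtain ⟨c, hc⟩ := hall ⟨u, hu⟩
  exact ⟨c, (congrArg Subtype.val hc).symm⟩

theorem ker_finrank [Module.Finite Q V] (c : V →ₐ[Q] Q) :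
    Module.finrank Q (LinearMap.ker c.toLinearMap) + 1 = Module.finrank Q V := by
  have h := LinearMap.finrank_range_add_finrank_ker c.toLinearMap
  have : LinearMap.range c.toLinearMap = ⊤ := by
    rw [LinearMap.range_eq_top]
    intro q
    exact ⟨algebraMap Q V q, by simp⟩
  rw [this, finrank_top, Module.finrank_self] at h
  omega

theorem ker2_finrank [Module.Finite Q V] (c c' : V →ₐ[Q] Q) (hne : c ≠ c') :
    Module.finrank Q (LinearMap.ker c.toLinearMap ⊓ LinearMap.ker c'.toLinearMap : Submodule Q V) + 2
      = Module.finrank Q V := by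
  have h := LinearMap.finrank_range_add_finrank_ker (c.toLinearMap.prod c'.toLinearMap)
  obtain ⟨v, hv⟩ : ∃ v, c v ≠ c' v := by
    by_contra hc
    push Not at hc
    exact hne (AlgHom.ext hc)
  have hv' := sub_ne_zero.2 hv
  have : LinearMap.range (c.toLinearMap.prod c'.toLinearMap) = ⊤ := by
    rw [LinearMap.range_eq_top]
    rintro ⟨a, b⟩
    refine ⟨((a - b) / (c v - c' v)) • v + algebraMap Q V (a - (a - b) / (c v - c' v) * c v), ?_⟩
    simp only [LinearMap.prod_apply, Function.prod_apply, AlgHom.toLinearMap_apply, map_add, map_smul,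
      AlgHom.commutes, Algebra.algebraMap_self, RingHom.id_apply, Prod.smul_mk, Prod.mk_add_mk,
      smul_eq_mul, Prod.mk.injEq]
    constructor
    · ring
    · field_simp; ring
  rw [this, finrank_top, Module.finrank_prod, Module.finrank_self, LinearMap.ker_prod] at h
  omega

theorem case2 [IsNoetherianRing A] [UniqueFactorizationMonoid A] [Module.Finite Q V]
    (hr : Module.finrank Q V = 2) {x y : V} (hfg : (BB A x y).FG)
    (hT : ∀ v : V, ∃ h : A, h ≠ 0 ∧ algebraMap A V h * v ∈ BB A x y)
    (c0 : V →ₐ[Q] Q) (hx : c0 x = 0) (hy : c0 y = 0)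
    (hintg : ∀ c : V →ₐ[Q] Q, ∃ a b : A, c x = algebraMap A Q a ∧ c y = algebraMap A Q b) :
    Good (BB A x y) := by
  obtain ⟨z, hz0, hzm, hz⟩ := line (LinearMap.ker c0.toLinearMap)
    (by have := ker_finrank c0; omega)
  have hz' : ∀ u, c0 u = 0 → ∃ q : Q, u = q • z := fun u hu => hz u hu
  have hzm' : c0 z = 0 := hzm
  obtain ⟨w, hw0, ⟨q, hq⟩, hw, hs⟩ := R1' (Q := Q) hfg hT z hz0
  have hcw : c0 w = 0 := by rw [hq, map_smul, hzm', smul_zero]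
  obtain ⟨c2, hc2⟩ := act_char (Q := Q) w hw0 (fun u => by
    obtain ⟨q', hq'⟩ := hz' (u * w) (by rw [map_mul, hcw, mul_zero])
    have hq0 : q ≠ 0 := by rintro rfl; rw [zero_smul] at hq; exact hw0 hq
    refine ⟨q' * q⁻¹, ?_⟩
    rw [hq', hq, smul_smul, mul_assoc, inv_mul_cancel₀ hq0, mul_one])
  obtain ⟨a, b, ha, hb⟩ := hintg c2
  obtain ⟨l, hl⟩ := hw x (BB_left _ _) (hz' x hx)
  obtain ⟨m, hm⟩ := hw y (BB_right _ _) (hz' y hy)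
  have hxw : x * w = algebraMap A V a * w := by
    rw [hc2, ha, algebraMap_smul, Algebra.smul_def]
  have hyw : y * w = algebraMap A V b * w := by
    rw [hc2, hb, algebraMap_smul, Algebra.smul_def]
  apply good2 hr hT 1 w
  · apply BB_le
    · exact Submodule.subset_span (by simp)
    · rintro v (rfl | rfl)
      · exact mem2 _ _ 0 l (by rw [mul_one, map_zero, zero_mul, zero_add, ← hl])
      · exact mem2 _ _ 0 a (by rw [hxw, map_zero, zero_mul, zero_add])
    · rintro v (rfl | rfl)
      · exact mem2 _ _ 0 m (by rw [mul_one, map_zero, zero_mul, zero_add, ← hm])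
      · exact mem2 _ _ 0 b (by rw [hyw, map_zero, zero_mul, zero_add])
  · exact inSat_of_mem (BB_one _ _)
  · exact hs

/-- line data for two characters -/
theorem lineT [IsNoetherianRing A] [UniqueFactorizationMonoid A] [Module.Finite Q V]
    (hr : Module.finrank Q V = 3) {x y : V} (hfg : (BB A x y).FG)
    (hT : ∀ v : V, ∃ h : A, h ≠ 0 ∧ algebraMap A V h * v ∈ BB A x y)
    (c0 c1 : V →ₐ[Q] Q) (hne : c0 ≠ c1) :
    ∃ (w : V) (c2 : V →ₐ[Q] Q), w ≠ 0 ∧ c0 w = 0 ∧ c1 w = 0 ∧ (∀ u, u * w = c2 u • w) ∧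
      InSat (BB A x y) w ∧
      ∀ u ∈ BB A x y, c0 u = 0 → c1 u = 0 → ∃ a : A, u = algebraMap A V a * w := by
  obtain ⟨z, hz0, hzm, hz⟩ := line (LinearMap.ker c0.toLinearMap ⊓ LinearMap.ker c1.toLinearMap)
    (by have := ker2_finrank c0 c1 hne; omega)
  have hz' : ∀ u, c0 u = 0 → c1 u = 0 → ∃ q : Q, u = q • z := fun u hu hu' => hz u ⟨hu, hu'⟩
  have hzm0 : c0 z = 0 := hzm.1
  have hzm1 : c1 z = 0 := hzm.2
  obtain ⟨w, hw0, ⟨q, hq⟩, hw, hs⟩ := R1' (Q := Q) hfg hT z hz0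
  have hcw : c0 w = 0 := by rw [hq, map_smul, hzm0, smul_zero]
  have hcw1 : c1 w = 0 := by rw [hq, map_smul, hzm1, smul_zero]
  obtain ⟨c2, hc2⟩ := act_char (Q := Q) w hw0 (fun u => by
    obtain ⟨q', hq'⟩ := hz' (u * w) (by rw [map_mul, hcw, mul_zero]) (by rw [map_mul, hcw1, mul_zero])
    have hq0 : q ≠ 0 := by rintro rfl; rw [zero_smul] at hq; exact hw0 hq
    refine ⟨q' * q⁻¹, ?_⟩
    rw [hq', hq, smul_smul, mul_assoc, inv_mul_cancel₀ hq0, mul_one])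
  exact ⟨w, c2, hw0, hcw, hcw1, hc2, hs, fun u hu h0 h1 => hw u hu (hz' u h0 h1)⟩
end gen

section caseT
open MvPolynomial
variable {k : Type} [Field k] {d : ℕ}
variable {Q : Type} [Field Q] [Algebra (MvPolynomial (Fin d) k) Q]
  [IsFractionRing (MvPolynomial (Fin d) k) Q]
variable {V : Type} [CommRing V] [Algebra Q V] [Algebra (MvPolynomial (Fin d) k) V]
  [IsScalarTower (MvPolynomial (Fin d) k) Q V]

theorem caseT_dep [Module.Finite Q V]
    (hr : Module.finrank Q V = 3) {x y : V}
    (hT : ∀ v : V, ∃ h : MvPolynomial (Fin d) k, h ≠ 0 ∧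
      algebraMap _ V h * v ∈ BB (MvPolynomial (Fin d) k) x y)
    (c0 c1 : V →ₐ[Q] Q) (hx : c0 x = 0) (hy : c0 y = 0)
    (α β α2 β2 : MvPolynomial (Fin d) k) (h1x : c1 x = algebraMap _ Q α)
    (h1y : c1 y = algebraMap _ Q β) (w : V)
    (exw : x * w = algebraMap _ V α2 * w) (eyw : y * w = algebraMap _ V β2 * w)
    (hs : InSat (BB (MvPolynomial (Fin d) k) x y) w)
    (hw : ∀ u ∈ BB (MvPolynomial (Fin d) k) x y, c0 u = 0 → c1 u = 0 →
      ∃ a : MvPolynomial (Fin d) k, u = algebraMap _ V a * w)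
    (c : k) (hc : α = C c * β) : Good (BB (MvPolynomial (Fin d) k) x y) := by
  obtain ⟨l, hl⟩ := hw (x - algebraMap (MvPolynomial (Fin d) k) V (C c) * y)
    (sub_mem (BB_left _ _) (BB_mul (BB_alg _ _ _) (BB_right _ _)))
    (by rw [map_sub, map_mul, hx, hy]; simp)
    (by rw [map_sub, map_mul, h1x, h1y, char_alg, hc, map_mul, sub_self])
  obtain ⟨m, hm⟩ := hw (y * y - algebraMap _ V β * y)
    (sub_mem (BB_mul (BB_right _ _) (BB_right _ _)) (BB_mul (BB_alg _ _ _) (BB_right _ _)))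
    (by rw [map_sub, map_mul, map_mul, hy]; simp)
    (by rw [map_sub, map_mul, map_mul, h1y, char_alg, sub_self])
  apply good3 hr hT 1 y w
  · apply BB_le
    · exact Submodule.subset_span (by simp)
    · rintro v (rfl | rfl | rfl)
      · exact mem3 _ _ _ 0 (C c) l (by rw [map_zero]; linear_combination hl)
      · exact mem3 _ _ _ 0 (C c * β) (C c * m + l * β2) (by
          simp only [map_zero, map_mul, map_add]
          linear_combination v * hl + algebraMap (MvPolynomial (Fin d) k) V (C c) * hm + algebraMap _ V l * eyw)
      · exact mem3 _ _ _ 0 0 α2 (by simp only [map_zero]; linear_combination exw)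
    · rintro v (rfl | rfl | rfl)
      · exact mem3 _ _ _ 0 1 0 (by simp)
      · exact mem3 _ _ _ 0 β m (by simp only [map_zero]; linear_combination hm)
      · exact mem3 _ _ _ 0 0 β2 (by simp only [map_zero]; linear_combination eyw)
  · exact inSat_of_mem (BB_one _ _)
  · exact inSat_of_mem (BB_right _ _)
  · exact hs

theorem caseT [Module.Finite Q V]
    (hr : Module.finrank Q V = 3) {x y : V} (hfg : (BB (MvPolynomial (Fin d) k) x y).FG)
    (hT : ∀ v : V, ∃ h : MvPolynomial (Fin d) k, h ≠ 0 ∧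
      algebraMap _ V h * v ∈ BB (MvPolynomial (Fin d) k) x y)
    (c0 c1 : V →ₐ[Q] Q) (hne : c0 ≠ c1) (hx : c0 x = 0) (hy : c0 y = 0)
    (hintg : ∀ c : V →ₐ[Q] Q, ∃ a b : MvPolynomial (Fin d) k, a.IsHomogeneous 1 ∧
      b.IsHomogeneous 1 ∧ c x = algebraMap _ Q a ∧ c y = algebraMap _ Q b) :
    Good (BB (MvPolynomial (Fin d) k) x y) := by
  obtain ⟨w, c2, hw0, hc0w, hc1w, hc2, hs, hw⟩ := lineT hr hfg hT c0 c1 hne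
  obtain ⟨α, β, hα, hβ, h1x, h1y⟩ := hintg c1
  obtain ⟨α2, β2, hα2, hβ2, h2x, h2y⟩ := hintg c2
  have exw : x * w = algebraMap _ V α2 * w := by
    rw [hc2, h2x, algebraMap_smul, Algebra.smul_def]
  have eyw : y * w = algebraMap _ V β2 * w := by
    rw [hc2, h2y, algebraMap_smul, Algebra.smul_def]
  by_cases hi : Indep α β
  swap
  · rcases not_indep hi with ⟨c, hc⟩ | ⟨c, hc⟩
    · exact caseT_dep hr hT c0 c1 hx hy α β α2 β2 h1x h1y w exw eyw hs hw c hc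
    · rw [BB_symm] at hs hw hT ⊢
      exact caseT_dep hr hT c0 c1 hy hx β α β2 α2 h1y h1x w eyw exw hs hw c hc
  have hrel := hi.relPrime hα hβ
  obtain ⟨ζ, hζ⟩ := hw (algebraMap _ V β * x - algebraMap _ V α * y)
    (sub_mem (BB_mul (BB_alg _ _ _) (BB_left _ _)) (BB_mul (BB_alg _ _ _) (BB_right _ _)))
    (by rw [map_sub, map_mul, map_mul, hx, hy]; simp)
    (by rw [map_sub, map_mul, map_mul, h1x, h1y, char_alg, char_alg]; ring)
  obtain ⟨p, hp⟩ := hw (x * x - algebraMap _ V α * x)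
    (sub_mem (BB_mul (BB_left _ _) (BB_left _ _)) (BB_mul (BB_alg _ _ _) (BB_left _ _)))
    (by rw [map_sub, map_mul, map_mul, hx]; simp)
    (by rw [map_sub, map_mul, map_mul, h1x, char_alg]; ring)
  obtain ⟨q, hq⟩ := hw (x * y - algebraMap _ V α * y)
    (sub_mem (BB_mul (BB_left _ _) (BB_right _ _)) (BB_mul (BB_alg _ _ _) (BB_right _ _)))
    (by rw [map_sub, map_mul, map_mul, hx, hy]; simp)
    (by rw [map_sub, map_mul, map_mul, h1x, h1y, char_alg]; ring)
  obtain ⟨p', hp'⟩ := hw (y * y - algebraMap _ V β * y)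
    (sub_mem (BB_mul (BB_right _ _) (BB_right _ _)) (BB_mul (BB_alg _ _ _) (BB_right _ _)))
    (by rw [map_sub, map_mul, map_mul, hy]; simp)
    (by rw [map_sub, map_mul, map_mul, h1y, char_alg]; ring)
  have F : Flag x y w α β ζ p q p' α2 β2 1 :=
    { hw := hw0
      rel := hrel
      e0 := hζ
      exx := by rw [one_mul]; linear_combination hp
      exy := by rw [one_mul]; linear_combination hq
      eyy := by rw [one_mul]; linear_combination hp'
      exw := exw
      eyw := eyw
      sat := hs
      hJ := by
        intro c g h e he
        have e0 := congrArg c0 he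
        have e1 := congrArg c1 he
        simp only [map_add, map_mul, char_alg, hx, hy, mul_zero, add_zero, hc0w] at e0
        have hc := aq_zero e0
        refine ⟨hc, ?_⟩
        simp only [map_add, map_mul, char_alg, h1x, h1y, mul_zero, hc1w, hc, map_zero, zero_add] at e1
        apply aq_zero (Q := Q)
        simpa using e1 }
  obtain ⟨r1, r2, r3, r4⟩ := F.rels (Q := Q)
  apply F.good (Q := Q) hr hT
  apply algT hα hβ hα2 hβ2 hi r1 (by linear_combination r2) (by linear_combination r3) r4
    (F.coprime (Q := Q)) (F.nonzero (Q := Q) hT)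
end caseT
end S8
end

section
namespace S8
section caseL
open MvPolynomial
variable {k : Type} [Field k] {d : ℕ}
variable {Q : Type} [Field Q] [Algebra (MvPolynomial (Fin d) k) Q]
  [IsFractionRing (MvPolynomial (Fin d) k) Q]
variable {V : Type} [CommRing V] [Algebra Q V] [Algebra (MvPolynomial (Fin d) k) V]
  [IsScalarTower (MvPolynomial (Fin d) k) Q V]

/-- the alternative coming from the cubics -/
def Alt (k : Type) [Field k] (d : ℕ) (Q : Type) [Field Q] {V : Type} [CommRing V] [Algebra Q V]
    [Algebra (MvPolynomial (Fin d) k) V] (x y : V) : Prop :=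
  (∃ a b Q0 Q1 Q2 e0 e1 e2 e3 : MvPolynomial (Fin d) k, a.IsHomogeneous 2 ∧ b.IsHomogeneous 2 ∧
    ¬ (a = 0 ∧ b = 0) ∧
    algebraMap _ V a * x + algebraMap _ V b * y + algebraMap _ V Q0 * (x * x)
    + algebraMap _ V Q1 * (x * y) + algebraMap _ V Q2 * (y * y)
    + algebraMap _ V e0 * (x * (x * x)) + algebraMap _ V e1 * (y * (x * x))
    + algebraMap _ V e2 * (x * (y * y)) + algebraMap _ V e3 * (y * (y * y)) = 0) ∨
  (∃ Φ Ψ : V →ₐ[Q] DualNumber Q, Φ x = DualNumber.eps ∧ Φ y = 0 ∧ Ψ x = 0 ∧ Ψ y = DualNumber.eps)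

theorem nak {N I : Ideal V} (hN : IsNilpotent N) (h : N * I = I) : I = ⊥ := by
  obtain ⟨m, hm⟩ := hN
  have : ∀ j, N ^ j * I = I := by
    intro j
    induction j with
    | zero => simp
    | succ j ih => rw [pow_succ, mul_assoc, h, ih]
  rw [← this m, hm]; simp

theorem dual_zero (Φ : V →ₐ[Q] DualNumber Q) {u v : V} (hu : IsNilpotent u) (hv : IsNilpotent v) :
    Φ (u * v) = 0 := by
  have key : ∀ u : V, IsNilpotent u → (Φ u).fst = 0 := by
    intro u hu
    have h1 := (hu.map Φ).map (TrivSqZeroExt.fstHom Q Q Q)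
    exact h1.eq_zero
  have h1 := key u hu
  have h2 := key v hv
  rw [map_mul]
  apply TrivSqZeroExt.ext
  · rw [TrivSqZeroExt.fst_mul, h1, h2]; simp
  · rw [TrivSqZeroExt.snd_mul, h1, h2]; simp

theorem caseL_ideal [Module.Finite Q V] (hr : Module.finrank Q V = 3) (N : Ideal V)
    (hNn : IsNilpotent N) (hD : Module.finrank Q (N.restrictScalars Q) = 2) (h2 : N * N ≠ ⊥) :
    N * (N * N) = ⊥ ∧ Module.finrank Q ((N * N).restrictScalars Q) = 1 := by
  have hlt : ∀ I : Ideal V, I ≠ ⊥ → Module.finrank Q ((N * I).restrictScalars Q) <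
      Module.finrank Q (I.restrictScalars Q) := by
    intro I hI
    apply Submodule.finrank_lt_finrank_of_lt
    have hle : (N * I).restrictScalars Q ≤ I.restrictScalars Q := by
      intro u hu
      rw [Submodule.restrictScalars_mem] at hu ⊢
      exact (Ideal.mul_le_right : N * I ≤ I) hu
    refine lt_of_le_of_ne hle ?_
    intro h
    exact hI (nak hNn (Submodule.restrictScalars_injective Q V V h))
  have hbot : ∀ I : Ideal V, Module.finrank Q (I.restrictScalars Q) = 0 → I = ⊥ := by
    intro I h0
    rw [Submodule.finrank_eq_zero] at h0
    exact Submodule.restrictScalars_injective Q V V h0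
  have hN0 : N ≠ ⊥ := by
    rintro rfl
    exact h2 (by simp)
  have a1 := hlt N hN0
  have a2 := hlt (N * N) h2
  have a3 : Module.finrank Q ((N * N).restrictScalars Q) ≠ 0 := fun h => h2 (hbot _ h)
  have a4 : Module.finrank Q ((N * N).restrictScalars Q) = 1 := by omega
  exact ⟨hbot _ (by omega), a4⟩

/-- structure of a local algebra of dimension three -/
theorem caseL_split [Module.Finite Q V] (hr : Module.finrank Q V = 3) (c0 : V →ₐ[Q] Q)
    (hnil : ∀ u, c0 u = 0 → IsNilpotent u) :
    (∀ u v, c0 u = 0 → c0 v = 0 → u * v = 0) ∨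
    ∃ z : V, z ≠ 0 ∧ c0 z = 0 ∧ (∀ u v, c0 u = 0 → c0 v = 0 → ∃ q : Q, u * v = q • z) ∧
      (∀ u, c0 u = 0 → u * z = 0) ∧ ∀ Φ : V →ₐ[Q] DualNumber Q, Φ z = 0 := by
  have hnoeth : IsNoetherianRing V := IsNoetherianRing.of_finite Q V
  have hD := ker_finrank c0
  obtain ⟨N, hN⟩ : ∃ N : Ideal V, N = RingHom.ker c0 := ⟨_, rfl⟩
  have hm : ∀ u, u ∈ N ↔ c0 u = 0 := by intro u; rw [hN]; exact Iff.rfl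
  have hker : N.restrictScalars Q = LinearMap.ker c0.toLinearMap := by rw [hN]; rfl
  have hNn : IsNilpotent N := by
    rw [Ideal.FG.isNilpotent_iff_le_nilradical (IsNoetherian.noetherian N)]
    intro u hu
    exact hnil u ((hm u).1 hu)
  rw [← hker] at hD
  clear hN hker
  by_cases h2 : N * N = ⊥
  · left
    intro u v hu hv
    have := Ideal.mul_mem_mul ((hm u).2 hu) ((hm v).2 hv)
    rw [h2] at this
    exact this
  right
  obtain ⟨h3, hD2⟩ := caseL_ideal hr N hNn (by omega) h2
  obtain ⟨z, hz0, hzm, hz⟩ := line _ hD2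
  have hzm' : z ∈ N * N := hzm
  refine ⟨z, hz0, (hm z).1 (Ideal.mul_le_left hzm'), ?_, ?_, ?_⟩
  · intro u v hu hv
    exact hz _ (Ideal.mul_mem_mul ((hm u).2 hu) ((hm v).2 hv))
  · intro u hu
    have := Ideal.mul_mem_mul ((hm u).2 hu) hzm'
    rw [h3] at this
    exact this
  · intro Φ
    have : N * N ≤ RingHom.ker Φ := by
      rw [Ideal.mul_le]
      intro u hu v hv
      exact dual_zero Φ (hnil u ((hm u).1 hu)) (hnil v ((hm v).1 hv))
    exact this hzm'

theorem caseL_rel [Module.Finite Q V] (hr : Module.finrank Q V = 3) (c0 : V →ₐ[Q] Q) {x y z : V}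
    (hx : c0 x = 0) (hy : c0 y = 0) (hz : c0 z = 0) (hz0 : z ≠ 0) :
    ∃ α β : MvPolynomial (Fin d) k, IsRelPrime α β ∧
      ∃ c : Q, algebraMap _ V β * x - algebraMap _ V α * y = c • z := by
  have hD := ker_finrank c0
  have hdep : ¬ LinearIndependent Q (![⟨x, hx⟩, ⟨y, hy⟩, ⟨z, hz⟩] :
      Fin 3 → LinearMap.ker c0.toLinearMap) := by
    intro h
    have := h.fintype_card_le_finrank
    simp at this
    omega
  rw [Fintype.not_linearIndependent_iff] at hdep
  obtain ⟨g, hg, i, hi⟩ := hdep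
  have hg' : g 0 • x + g 1 • y + g 2 • z = 0 := by
    have := congrArg Subtype.val hg
    simpa [Fin.sum_univ_three] using this
  by_cases h1 : g 1 = 0
  · by_cases h0 : g 0 = 0
    · exfalso
      rw [h0, h1, zero_smul, zero_smul, zero_add, zero_add] at hg'
      have h2 := (smul_eq_zero.1 hg').resolve_right hz0
      fin_cases i
      · exact hi h0
      · exact hi h1
      · exact hi h2
    · refine ⟨0, 1, isRelPrime_one_right, -((g 0)⁻¹ * g 2), ?_⟩
      rw [h1, zero_smul, add_zero] at hg'
      rw [map_one, one_mul, map_zero, zero_mul, sub_zero, neg_smul, mul_smul,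
        eq_neg_of_add_eq_zero_right hg', smul_neg, neg_neg, smul_smul, inv_mul_cancel₀ h0, one_smul]
  · obtain ⟨n, D, hrel, hnD⟩ := IsFractionRing.exists_reduced_fraction (A := MvPolynomial (Fin d) k)
      (g 0 / g 1)
    have hD0 : (D : MvPolynomial (Fin d) k) ≠ 0 := nonZeroDivisors.ne_zero D.2
    have hD0' : algebraMap _ Q (D : MvPolynomial (Fin d) k) ≠ 0 := fun h => hD0 (aq_zero h)
    refine ⟨-D, n, hrel.symm.neg_left, - (algebraMap _ Q (D : MvPolynomial (Fin d) k) / g 1 * g 2), ?_⟩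
    rw [IsFractionRing.mk'_eq_div] at hnD
    have e1 : algebraMap (MvPolynomial (Fin d) k) Q n =
        algebraMap _ Q (D : MvPolynomial (Fin d) k) / g 1 * g 0 := by
      field_simp at hnD ⊢
      linear_combination hnD
    have e2 : algebraMap (MvPolynomial (Fin d) k) Q D =
        algebraMap _ Q (D : MvPolynomial (Fin d) k) / g 1 * g 1 := by
      field_simp
    rw [← Algebra.smul_def, ← Algebra.smul_def, neg_smul, sub_neg_eq_add,
      ← algebraMap_smul Q n x, ← algebraMap_smul Q (D : MvPolynomial (Fin d) k) y, e1]
    nth_rewrite 2 [e2]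
    rw [mul_smul, mul_smul, ← smul_add, eq_neg_of_add_eq_zero_left hg', neg_smul, mul_smul, smul_neg]

set_option maxHeartbeats 1000000 in
theorem caseL_main [Module.Finite Q V]
    (hr : Module.finrank Q V = 3) {x y : V} (hfg : (BB (MvPolynomial (Fin d) k) x y).FG)
    (hT : ∀ v : V, ∃ h : MvPolynomial (Fin d) k, h ≠ 0 ∧
      algebraMap _ V h * v ∈ BB (MvPolynomial (Fin d) k) x y)
    (c0 : V →ₐ[Q] Q) (hx : c0 x = 0) (hy : c0 y = 0) (hA : Alt k d Q x y)
    (z : V) (hz0 : z ≠ 0) (hc0z : c0 z = 0)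
    (hz' : ∀ u v, c0 u = 0 → c0 v = 0 → ∃ q : Q, u * v = q • z)
    (hzz : ∀ u, c0 u = 0 → u * z = 0) (hΦz : ∀ Φ : V →ₐ[Q] DualNumber Q, Φ z = 0) :
    Good (BB (MvPolynomial (Fin d) k) x y) := by
  obtain ⟨w, hw0, ⟨q0, hq0⟩, hw, hs⟩ := R1' (Q := Q) hfg hT z hz0
  have hq00 : q0 ≠ 0 := by rintro rfl; rw [zero_smul] at hq0; exact hw0 hq0
  have hzero : ∀ u, c0 u = 0 → u * w = 0 := by
    intro u hu
    rw [hq0, mul_smul_comm, hzz u hu, smul_zero]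
  have hzero3 : ∀ u v t, c0 u = 0 → c0 v = 0 → c0 t = 0 → u * (v * t) = 0 := by
    intro u v t hu hv ht
    obtain ⟨q, hq⟩ := hz' v t hv ht
    rw [hq, mul_smul_comm, hzz u hu, smul_zero]
  have hbl := BB_left (A := MvPolynomial (Fin d) k) x y
  have hbr := BB_right (A := MvPolynomial (Fin d) k) x y
  obtain ⟨p, hp⟩ := hw (x * x) (BB_mul hbl hbl) (hz' _ _ hx hx)
  obtain ⟨q, hq⟩ := hw (x * y) (BB_mul hbl hbr) (hz' _ _ hx hy)
  obtain ⟨p', hp'⟩ := hw (y * y) (BB_mul hbr hbr) (hz' _ _ hy hy)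
  have exw : x * w = algebraMap (MvPolynomial (Fin d) k) V 0 * w := by
    rw [hzero x hx, map_zero, zero_mul]
  have eyw : y * w = algebraMap (MvPolynomial (Fin d) k) V 0 * w := by
    rw [hzero y hy, map_zero, zero_mul]
  have hc0w : c0 w = 0 := by
    rw [hq0, map_smul, hc0z, smul_zero]
  -- x and y are not both in the line
  have hnot : ∀ l m : MvPolynomial (Fin d) k, x = algebraMap _ V l * w → y = algebraMap _ V m * w →
      False := by
    intro l m hl hm
    have hle : BB (MvPolynomial (Fin d) k) x y ≤ Submodule.span _ (Set.range ![1, w]) := by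
      rw [span2_range]
      apply BB_le
      · exact Submodule.subset_span (by simp)
      · rintro v (rfl | rfl)
        · exact mem2 _ _ 0 l (by rw [mul_one, map_zero, zero_mul, zero_add, ← hl])
        · rw [hzero x hx]; exact zero_mem _
      · rintro v (rfl | rfl)
        · exact mem2 _ _ 0 m (by rw [mul_one, map_zero, zero_mul, zero_add, ← hm])
        · rw [hzero y hy]; exact zero_mem _
    have := finrank_le_of_span (Q := Q) hT _ hle
    omega
  -- relation
  obtain ⟨α, β, hrel, hline⟩ := caseL_rel (k := k) (d := d) hr c0 hx hy hc0z hz0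
  obtain ⟨ζ, hζ⟩ := hw _ (sub_mem (BB_mul (BB_alg _ _ _) hbl) (BB_mul (BB_alg _ _ _) hbr)) hline
  have toline : ∀ (D : MvPolynomial (Fin d) k), D ≠ 0 → ∀ u ∈ BB (MvPolynomial (Fin d) k) x y,
      ∀ e : MvPolynomial (Fin d) k, algebraMap _ V D * u = algebraMap _ V e * w →
      ∃ l : MvPolynomial (Fin d) k, u = algebraMap _ V l * w := by
    intro D hD u hu e he
    apply hw u hu
    have hD' : algebraMap (MvPolynomial (Fin d) k) Q D ≠ 0 := fun h => hD (aq_zero h)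
    refine ⟨(algebraMap _ Q D)⁻¹ * (algebraMap _ Q e * q0), ?_⟩
    rw [mul_smul, mul_smul, ← hq0, algebraMap_smul, Algebra.smul_def e w, ← he, ← Algebra.smul_def,
      ← algebraMap_smul Q D u, smul_smul, inv_mul_cancel₀ hD', one_smul]
  have F : Flag x y w α β ζ p q p' 0 0 0 :=
    { hw := hw0
      rel := hrel
      e0 := hζ
      exx := by rw [hp]; simp
      exy := by rw [hq]; simp
      eyy := by rw [hp']; simp
      exw := exw
      eyw := eyw
      sat := hs
      hJ := by
        intro c g h e he
        have e0 := congrArg c0 he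
        simp only [map_add, map_mul, char_alg, hx, hy, mul_zero, add_zero, hc0w] at e0
        have hc := aq_zero e0
        refine ⟨hc, ?_⟩
        rw [hc, map_zero, zero_add] at he
        by_contra hD
        obtain ⟨l, hl⟩ := toline _ hD x hbl (h * ζ + α * e) (by
          simp only [map_add, map_mul]
          linear_combination algebraMap _ V h * hζ + algebraMap _ V α * he)
        obtain ⟨m, hm⟩ := toline _ hD y hbr (β * e - g * ζ) (by
          simp only [map_add, map_mul, map_sub]
          linear_combination - algebraMap _ V g * hζ + algebraMap _ V β * he)
        exact hnot l m hl hm }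
  apply F.good (Q := Q) hr hT
  right
  obtain ⟨-, -, r3, r4⟩ := F.rels (Q := Q)
  simp only [mul_zero, zero_mul, zero_sub] at r3 r4
  obtain ⟨p1, hp1, hq1⟩ := relPrime_rel hrel.symm (a := p) (b := -q) (by linear_combination - r3)
  have hq1' : q = p1 * β := by linear_combination - hq1
  obtain ⟨η, hη, hpη⟩ := relPrime_rel hrel.symm (a := p1 * β) (b := -p') (by
    rw [← hq1']; linear_combination - r4)
  have hpη' : p' = η * β := by linear_combination - hpη
  obtain ⟨η', e1, e2⟩ := relPrime_rel hrel.symm (a := p1) (b := -η) (by linear_combination hη)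
  have e2' : η = η' * β := by linear_combination - e2
  have hpp : p = η' * α ^ 2 := by rw [hp1, e1]; ring
  have hqq : q = η' * (α * β) := by rw [hq1', e1]; ring
  have hpp' : p' = η' * β ^ 2 := by rw [hpη', e2']; ring
  have hηζ : IsRelPrime η' ζ := by
    apply isRelPrime_of_no_nonunits_factors
    · rintro ⟨h1, h2⟩
      have := F.nonzero (Q := Q) hT
      rw [hpp, hqq, hpp', h1, h2] at this
      simp at this
    · intro a ha ha0 h1 h2
      obtain ⟨π, hπ, hd⟩ := WfDvdMonoid.exists_irreducible_factor ha ha0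
      have hd1 := hd.trans h1
      refine F.coprime (Q := Q) π hπ.prime (hd.trans h2) ?_ ?_ ?_
      · rw [hpp]; exact hd1.mul_right _
      · rw [hqq]; exact hd1.mul_right _
      · rw [hpp']; exact hd1.mul_right _
  rcases hA with ⟨a, b, Q0, Q1, Q2, f0, f1, f2, f3, ha, hb, hab0, heq⟩ | ⟨Φ, Ψ, hΦx, hΦy, hΨx, hΨy⟩
  · rw [hzero3 _ _ _ hx hx hx, hzero3 _ _ _ hy hx hx,
      hzero3 _ _ _ hx hy hy, hzero3 _ _ _ hy hy hy,
      hp, hq, hp'] at heq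
    simp only [mul_zero, add_zero] at heq
    have hab := (F.hJ 0 a b (-(Q0 * p + Q1 * q + Q2 * p')) (by
      simp only [map_zero, map_neg, map_add, map_mul]
      linear_combination heq)).2
    apply algL (Q0 := Q0) (Q1 := Q1) (Q2 := Q2) hrel ha hb hab0 hab hηζ
    rintro g rfl rfl
    apply wcancel (Q := Q) hw0
    rw [hpp, hqq, hpp'] at heq
    simp only [map_neg, map_add, map_mul, map_pow] at heq ⊢
    linear_combination heq - algebraMap _ V g * hζ
  · exfalso
    have hker : ∀ Φ : V →ₐ[Q] DualNumber Q, Φ w = 0 := by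
      intro Φ
      rw [hq0, map_smul, hΦz, smul_zero]
    have halg : ∀ (Φ : V →ₐ[Q] DualNumber Q) (a : MvPolynomial (Fin d) k),
        Φ (algebraMap _ V a) = algebraMap Q _ (algebraMap _ Q a) := by
      intro Φ a
      rw [IsScalarTower.algebraMap_apply _ Q V, AlgHom.commutes]
    have hε : ∀ a : Q, algebraMap Q (DualNumber Q) a * DualNumber.eps = 0 → a = 0 := by
      intro a ha
      have := congrArg TrivSqZeroExt.snd ha
      simpa [TrivSqZeroExt.snd_mul, TrivSqZeroExt.algebraMap_eq_inl] using this
    have h1 := congrArg Φ hζ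
    have h2 := congrArg Ψ hζ
    rw [map_sub, map_mul, map_mul, map_mul, hker, halg, hΦx, hΦy, mul_zero, mul_zero, sub_zero] at h1
    rw [map_sub, map_mul, map_mul, map_mul, hker, halg, halg, hΨx, hΨy, mul_zero, mul_zero, zero_sub,
      neg_eq_zero] at h2
    have hβ := aq_zero (hε _ h1)
    have hα := aq_zero (hε _ h2)
    rw [hα, hβ] at hrel
    exact not_isRelPrime_zero_zero hrel

theorem caseL [Module.Finite Q V]
    (hr : Module.finrank Q V = 3) {x y : V} (hfg : (BB (MvPolynomial (Fin d) k) x y).FG)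
    (hT : ∀ v : V, ∃ h : MvPolynomial (Fin d) k, h ≠ 0 ∧
      algebraMap _ V h * v ∈ BB (MvPolynomial (Fin d) k) x y)
    (c0 : V →ₐ[Q] Q) (hx : c0 x = 0) (hy : c0 y = 0)
    (hnil : ∀ u, c0 u = 0 → IsNilpotent u) (hA : Alt k d Q x y) :
    Good (BB (MvPolynomial (Fin d) k) x y) := by
  rcases caseL_split hr c0 hnil with hz | ⟨z, hz0, hc0z, hz', hzz, hΦz⟩
  · apply good3 hr hT 1 x y
    · apply BB_le
      · exact Submodule.subset_span (by simp)
      · rintro v (rfl | rfl | rfl)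
        · exact mem3 _ _ _ 0 1 0 (by simp)
        · rw [hz _ _ hx hx]; exact zero_mem _
        · rw [hz _ _ hx hy]; exact zero_mem _
      · rintro v (rfl | rfl | rfl)
        · exact mem3 _ _ _ 0 0 1 (by simp)
        · rw [hz _ _ hy hx]; exact zero_mem _
        · rw [hz _ _ hy hy]; exact zero_mem _
    · exact inSat_of_mem (BB_one _ _)
    · exact inSat_of_mem (BB_left _ _)
    · exact inSat_of_mem (BB_right _ _)
  · exact caseL_main hr hfg hT c0 hx hy hA z hz0 hc0z hz' hzz hΦz
end caseL
end S8
end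

section
namespace S8
section caseM
open Polynomial
variable {k : Type} [Field k] {d : ℕ}
variable {Q : Type} [Field Q] [Algebra (MvPolynomial (Fin d) k) Q]
  [IsFractionRing (MvPolynomial (Fin d) k) Q]
variable {V : Type} [CommRing V] [Algebra Q V] [Algebra (MvPolynomial (Fin d) k) V]
  [IsScalarTower (MvPolynomial (Fin d) k) Q V]

theorem HomIntA.map {W : Type} [CommRing W] [Algebra (MvPolynomial (Fin d) k) W] {x : V}
    (h : HomIntA (k := k) (d := d) x) (φ : V →+* W)
    (hφ : ∀ a : MvPolynomial (Fin d) k, φ (algebraMap _ V a) = algebraMap _ W a) :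
    HomIntA (k := k) (d := d) (φ x) := by
  obtain ⟨H, hm, hh, h0⟩ := h
  refine ⟨H, hm, hh, ?_⟩
  have := congrArg φ h0
  rw [hom_eval₂, map_zero] at this
  rw [← this]
  congr 1
  exact (RingHom.ext hφ).symm

/-- all linear combinations are homogeneously integral -/
def LinH (k : Type) [Field k] (d : ℕ) {V : Type} [CommRing V] [Algebra (MvPolynomial (Fin d) k) V]
    (s t : V) : Prop :=
  ∀ (a b : k) (l : MvPolynomial (Fin d) k), l.IsHomogeneous 1 →
    HomIntA (k := k) (d := d) (algebraMap (MvPolynomial (Fin d) k) V (MvPolynomial.C a) * s +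
      algebraMap (MvPolynomial (Fin d) k) V (MvPolynomial.C b) * t +
      algebraMap (MvPolynomial (Fin d) k) V l)

theorem LinH.map {W : Type} [CommRing W] [Algebra (MvPolynomial (Fin d) k) W] {s t : V}
    (h : LinH k d s t) (φ : V →+* W)
    (hφ : ∀ a : MvPolynomial (Fin d) k, φ (algebraMap _ V a) = algebraMap _ W a) :
    LinH k d (φ s) (φ t) := by
  intro a b l hl
  have := (h a b l hl).map φ hφ
  rwa [map_add, map_add, map_mul, map_mul, hφ, hφ, hφ] at this

theorem LinH.symm {s t : V} (h : LinH k d s t) : LinH k d t s := by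
  intro a b l hl
  have := h b a l hl
  rwa [add_comm (algebraMap _ V _ * s)] at this

theorem LinH.shift {s t : V} (h : LinH k d s t) {σ τ : MvPolynomial (Fin d) k}
    (hσ : σ.IsHomogeneous 1) (hτ : τ.IsHomogeneous 1) :
    LinH k d (s - algebraMap _ V σ) (t - algebraMap _ V τ) := by
  intro a b l hl
  have h1 : (MvPolynomial.C a * σ).IsHomogeneous 1 := by
    simpa using (MvPolynomial.isHomogeneous_C (Fin d) a).mul hσ
  have h2 : (MvPolynomial.C b * τ).IsHomogeneous 1 := by
    simpa using (MvPolynomial.isHomogeneous_C (Fin d) b).mul hτ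
  have := h a b (l - MvPolynomial.C a * σ - MvPolynomial.C b * τ) ((hl.sub h1).sub h2)
  convert this using 1
  simp only [map_sub, map_mul]
  ring

theorem LinH.left {s t : V} (h : LinH k d s t) : HomIntA (k := k) (d := d) s := by
  have := h 1 0 0 (MvPolynomial.isHomogeneous_zero _ _ _)
  simpa using this

theorem LinH.right {s t : V} (h : LinH k d s t) : HomIntA (k := k) (d := d) t := h.symm.left

theorem HomIntA.isIntegral {x : V} (h : HomIntA (k := k) (d := d) x) :
    IsIntegral (MvPolynomial (Fin d) k) x := by
  obtain ⟨H, hm, _, h0⟩ := h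
  exact ⟨H, hm, h0⟩

theorem li_of_fin {L : Type} [Field L] [Algebra (MvPolynomial (Fin d) k) L] [Algebra Q L]
    [IsScalarTower (MvPolynomial (Fin d) k) Q L] [Module.Finite Q L] {n : ℕ}
    (hr : Module.finrank Q L < n) (x : Fin n → L) :
    ∃ a : Fin n → MvPolynomial (Fin d) k, a ≠ 0 ∧ ∑ i, algebraMap _ L (a i) * x i = 0 := by
  have h : ¬ LinearIndependent (MvPolynomial (Fin d) k) x := by
    rw [LinearIndependent.iff_fractionRing (R := MvPolynomial (Fin d) k) (K := Q)]
    intro h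
    have := h.fintype_card_le_finrank
    simp at this
    omega
  rw [Fintype.not_linearIndependent_iff] at h
  obtain ⟨g, hg, i, hi⟩ := h
  refine ⟨g, fun h0 => hi (by rw [h0]; rfl), ?_⟩
  simpa [Algebra.smul_def] using hg

theorem domA [IsAlgClosed k] {L : Type} [Field L] [Algebra (MvPolynomial (Fin d) k) L] [Algebra Q L]
    [IsScalarTower (MvPolynomial (Fin d) k) Q L] [Module.Finite Q L]
    (hr : Module.finrank Q L ≤ 3) (s t : L) (H : LinH k d s t) :
    (∃ (a b : k) (l : MvPolynomial (Fin d) k), ¬ (a = 0 ∧ b = 0) ∧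
      algebraMap (MvPolynomial (Fin d) k) L (MvPolynomial.C a) * s +
      algebraMap (MvPolynomial (Fin d) k) L (MvPolynomial.C b) * t = algebraMap _ L l) ∨
    ((∀ a b c : MvPolynomial (Fin d) k, algebraMap _ L a + algebraMap _ L b * s +
      algebraMap _ L c * t = 0 → a = 0 ∧ b = 0 ∧ c = 0) ∧
    (∃ a b c : MvPolynomial (Fin d) k, s * s = algebraMap _ L a + algebraMap _ L b * s +
      algebraMap _ L c * t) ∧
    (∃ a b c : MvPolynomial (Fin d) k, s * t = algebraMap _ L a + algebraMap _ L b * s +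
      algebraMap _ L c * t) ∧
    (∃ a b c : MvPolynomial (Fin d) k, t * t = algebraMap _ L a + algebraMap _ L b * s +
      algebraMap _ L c * t)) := by
  rw [or_iff_not_imp_left]
  intro hn
  let _ : Algebra k L := ((algebraMap (MvPolynomial (Fin d) k) L).comp MvPolynomial.C).toAlgebra
  let ι : MvPolynomial (Fin d) k →ₐ[k] L :=
    { algebraMap (MvPolynomial (Fin d) k) L with commutes' := fun r => rfl }
  have hι : ∀ a, ι a = algebraMap _ L a := fun a => rfl
  have hs : ∀ (a : k) (x : L), a • x = algebraMap (MvPolynomial (Fin d) k) L (MvPolynomial.C a) * x :=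
    fun a x => rfl
  have hinj : Function.Injective (algebraMap (MvPolynomial (Fin d) k) L) := by
    rw [IsScalarTower.algebraMap_eq _ Q L]
    exact (algebraMap Q L).injective.comp (FaithfulSMul.algebraMap_injective _ Q)
  have D : DomConc ι s t := by
    apply dom
    refine ⟨hinj, ?_, ?_, ?_⟩
    · intro x
      exact li_of_fin (Q := Q) (by omega) x
    · intro a b l hl
      rw [hs, hs]
      exact H a b l hl
    · intro a b l h
      by_contra h0
      exact hn ⟨a, b, l, h0, by rw [hs, hs] at h; exact h⟩
  exact ⟨D.li, D.ss, D.st, D.tt⟩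

/-- one generator -/
theorem good_single {L : Type} [Field L] [Algebra (MvPolynomial (Fin d) k) L] [Algebra Q L]
    [IsScalarTower (MvPolynomial (Fin d) k) Q L] {x y : L}
    (hy : IsIntegral (MvPolynomial (Fin d) k) y)
    (hx : x ∈ Algebra.adjoin (MvPolynomial (Fin d) k) {y}) :
    Good (BB (MvPolynomial (Fin d) k) x y) := by
  have hfs : FaithfulSMul (MvPolynomial (Fin d) k) L := by
    rw [faithfulSMul_iff_algebraMap_injective, IsScalarTower.algebraMap_eq _ Q L]
    exact (algebraMap Q L).injective.comp (FaithfulSMul.algebraMap_injective _ Q)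
  have hB : BB (MvPolynomial (Fin d) k) x y =
      Subalgebra.toSubmodule (Algebra.adjoin (MvPolynomial (Fin d) k) {y}) := by
    unfold BB
    congr 1
    apply le_antisymm
    · rw [Algebra.adjoin_le_iff]
      rintro v (rfl | rfl)
      · exact hx
      · exact Algebra.subset_adjoin rfl
    · exact Algebra.adjoin_mono (by simp)
  refine ⟨(minpoly (MvPolynomial (Fin d) k) y).natDegree, fun i => y ^ (i : ℕ), ?_, ?_, ?_⟩
  · rw [Fintype.linearIndependent_iff]
    intro g hg i
    let p : (MvPolynomial (Fin d) k)[X] := ∑ i : Fin _, C (g i) * X ^ (i : ℕ)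
    have hp0 : p = 0 := by
      have hd : minpoly (MvPolynomial (Fin d) k) y ∣ p := by
        apply minpoly.isIntegrallyClosed_dvd hy
        simp only [p, map_sum, map_mul, aeval_C, aeval_X, map_pow]
        simpa [Algebra.smul_def] using hg
      by_contra hne
      have h1 : p.degree < (minpoly (MvPolynomial (Fin d) k) y).degree := by
        rw [degree_eq_natDegree (minpoly.monic hy).ne_zero]
        exact degree_sum_fin_lt g
      exact absurd (degree_le_of_dvd hd hne) (not_le.2 h1)
    have := congrArg (fun p => p.coeff (i : ℕ)) hp0
    simp only [p, finsetSum_coeff, coeff_C_mul, coeff_X_pow, coeff_zero] at this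
    rw [Finset.sum_eq_single i] at this
    · simpa using this
    · intro j _ hj
      rw [if_neg, mul_zero]
      intro h; exact hj (Fin.ext h.symm)
    · simp
  · rw [hB, ← Submodule.span_range_natDegree_eq_adjoin (minpoly.monic hy) (minpoly.aeval _ _)]
    apply Submodule.span_mono
    intro v hv
    simp only [Finset.coe_image, Set.mem_image, Finset.mem_coe, Finset.mem_range] at hv
    obtain ⟨i, hi, rfl⟩ := hv
    exact ⟨⟨i, hi⟩, rfl⟩
  · intro i
    apply inSat_of_mem
    rw [hB, Subalgebra.mem_toSubmodule]
    have h1 : y ∈ Algebra.adjoin (MvPolynomial (Fin d) k) {y} := Algebra.subset_adjoin rfl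
    exact Subalgebra.pow_mem _ h1 _

theorem lin_solve {L : Type} [CommRing L] [Algebra (MvPolynomial (Fin d) k) L] {x y e : L} {a b : k}
    {l : MvPolynomial (Fin d) k} (ha : a ≠ 0)
    (h : algebraMap (MvPolynomial (Fin d) k) L (MvPolynomial.C a) * x +
      algebraMap (MvPolynomial (Fin d) k) L (MvPolynomial.C b) * y = algebraMap _ L l * e) :
    ∃ l' b' : MvPolynomial (Fin d) k, x = algebraMap _ L l' * e + algebraMap _ L b' * y := by
  refine ⟨MvPolynomial.C a⁻¹ * l, - (MvPolynomial.C a⁻¹ * MvPolynomial.C b), ?_⟩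
  have h1 : algebraMap (MvPolynomial (Fin d) k) L (MvPolynomial.C a⁻¹) *
      algebraMap (MvPolynomial (Fin d) k) L (MvPolynomial.C a) = 1 := by
    rw [← map_mul, ← MvPolynomial.C_mul, inv_mul_cancel₀ ha, MvPolynomial.C_1, map_one]
  simp only [map_mul, map_neg]
  linear_combination algebraMap (MvPolynomial (Fin d) k) L (MvPolynomial.C a⁻¹) * h - x * h1

theorem caseField [IsAlgClosed k] {L : Type} [Field L] [Algebra (MvPolynomial (Fin d) k) L]
    [Algebra Q L]
    [IsScalarTower (MvPolynomial (Fin d) k) Q L] [Module.Finite Q L]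
    (hr : Module.finrank Q L ≤ 3) (s t : L) (H : LinH k d s t) :
    Good (BB (MvPolynomial (Fin d) k) s t) := by
  rcases domA (Q := Q) hr s t H with ⟨a, b, l, hab, h⟩ | ⟨hli, ⟨a1, b1, c1, h1⟩, ⟨a2, b2, c2, h2⟩,
      ⟨a3, b3, c3, h3⟩⟩
  · by_cases ha : a = 0
    · have hb : b ≠ 0 := fun hb => hab ⟨ha, hb⟩
      rw [add_comm, ← mul_one (algebraMap _ L l)] at h
      obtain ⟨l', b', h'⟩ := lin_solve hb h
      rw [BB_symm]
      apply good_single (Q := Q) H.left.isIntegral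
      rw [h', mul_one]
      exact add_mem (Subalgebra.algebraMap_mem _ _)
        (mul_mem (Subalgebra.algebraMap_mem _ _) (Algebra.subset_adjoin rfl))
    · rw [← mul_one (algebraMap _ L l)] at h
      obtain ⟨l', b', h'⟩ := lin_solve ha h
      apply good_single (Q := Q) H.right.isIntegral
      rw [h', mul_one]
      exact add_mem (Subalgebra.algebraMap_mem _ _)
        (mul_mem (Subalgebra.algebraMap_mem _ _) (Algebra.subset_adjoin rfl))
  · refine ⟨3, ![1, s, t], ?_, ?_, ?_⟩
    · rw [Fintype.linearIndependent_iff]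
      intro g hg
      simp [Fin.sum_univ_three, Algebra.smul_def] at hg
      obtain ⟨g0, g1, g2⟩ := hli _ _ _ hg
      intro i
      fin_cases i
      · exact g0
      · exact g1
      · exact g2
    · have : Set.range ![1, s, t] = {1, s, t} := by
        simp only [Matrix.range_cons, Matrix.range_empty, Set.union_empty, Set.union_singleton]
        ext v; simp; tauto
      rw [this]
      apply BB_le
      · exact Submodule.subset_span (by simp)
      · rintro v (rfl | rfl | rfl)
        · exact mem3 _ _ _ 0 1 0 (by simp)
        · exact mem3 _ _ _ _ _ _ (by rw [mul_one]; exact h1)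
        · exact mem3 _ _ _ _ _ _ (by rw [mul_one]; exact h2)
      · rintro v (rfl | rfl | rfl)
        · exact mem3 _ _ _ 0 0 1 (by simp)
        · exact mem3 _ _ _ _ _ _ (by rw [mul_one, mul_comm]; exact h2)
        · exact mem3 _ _ _ _ _ _ (by rw [mul_one]; exact h3)
    · intro i
      apply inSat_of_mem
      fin_cases i
      · exact BB_one _ _
      · exact BB_left _ _
      · exact BB_right _ _

theorem quad_eq {L : Type} [Field L] [Algebra (MvPolynomial (Fin d) k) L] [Algebra Q L]
    [IsScalarTower (MvPolynomial (Fin d) k) Q L] [Module.Finite Q L]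
    (hr : Module.finrank Q L = 2) {y : L} (hy : IsIntegral (MvPolynomial (Fin d) k) y) :
    ∃ τ ν : MvPolynomial (Fin d) k, y * y = algebraMap _ L τ * y + algebraMap _ L ν := by
  have hfs : FaithfulSMul (MvPolynomial (Fin d) k) L := by
    rw [faithfulSMul_iff_algebraMap_injective, IsScalarTower.algebraMap_eq _ Q L]
    exact (algebraMap Q L).injective.comp (FaithfulSMul.algebraMap_injective _ Q)
  have hm := minpoly.monic hy
  have hd : (minpoly (MvPolynomial (Fin d) k) y).natDegree ≤ 2 := by
    have := minpoly.isIntegrallyClosed_eq_field_fractions' Q hy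
    rw [← hm.natDegree_map (algebraMap (MvPolynomial (Fin d) k) Q), ← this, ← hr]
    exact minpoly.natDegree_le y
  generalize hp : minpoly (MvPolynomial (Fin d) k) y = p at *
  have hpy : aeval y p = 0 := by rw [← hp]; exact minpoly.aeval _ _
  have hm2 : (X ^ (2 - p.natDegree) * p).Monic := (monic_X_pow _).mul hm
  have hd2 : (X ^ (2 - p.natDegree) * p).natDegree = 2 := by
    rw [(monic_X_pow _).natDegree_mul hm, natDegree_X_pow]; omega
  have h0 : aeval y (X ^ (2 - p.natDegree) * p) = 0 := by rw [map_mul, hpy, mul_zero]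
  generalize X ^ (2 - p.natDegree) * p = q at *
  rw [aeval_eq_sum_range, hd2, Finset.sum_range_succ, Finset.sum_range_succ, Finset.sum_range_one] at h0
  have : q.coeff 2 = 1 := by rw [← hd2]; exact hm2
  rw [this] at h0
  refine ⟨- q.coeff 1, - q.coeff 0, ?_⟩
  simp only [Algebra.smul_def, map_neg, map_one] at h0 ⊢
  linear_combination h0

theorem caseM_main [Module.Finite Q V]
    {L : Type} [Field L] [Algebra (MvPolynomial (Fin d) k) L] [Algebra Q L]
    [IsScalarTower (MvPolynomial (Fin d) k) Q L] [Module.Finite Q L]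
    (hr : Module.finrank Q V = 3) {x y : V} (hfg : (BB (MvPolynomial (Fin d) k) x y).FG)
    (hT : ∀ v : V, ∃ h : MvPolynomial (Fin d) k, h ≠ 0 ∧
      algebraMap _ V h * v ∈ BB (MvPolynomial (Fin d) k) x y)
    (hL : Module.finrank Q L = 2) (ρ : V →ₐ[Q] L) (c0 : V →ₐ[Q] Q)
    (hy : c0 y = 0) (hinj : ∀ u, c0 u = 0 → ρ u = 0 → u = 0)
    (e : V) (he0 : c0 e = 0) (he1 : ρ e = 1) (hyi : HomIntA (k := k) (d := d) y)
    (l b : MvPolynomial (Fin d) k) (hxe : x = algebraMap _ V l * e + algebraMap _ V b * y) :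
    Good (BB (MvPolynomial (Fin d) k) x y) := by
  have hρ : ∀ a : MvPolynomial (Fin d) k, ρ (algebraMap _ V a) = algebraMap _ L a := by
    intro a
    rw [IsScalarTower.algebraMap_apply _ Q V, AlgHom.commutes, ← IsScalarTower.algebraMap_apply]
  have heq : ∀ u v, c0 u = 0 → c0 v = 0 → ρ u = ρ v → u = v := by
    intro u v h1 h2 h3
    rw [← sub_eq_zero]
    exact hinj _ (by rw [map_sub, h1, h2, sub_zero]) (by rw [map_sub, h3, sub_self])
  have hyi' : HomIntA (k := k) (d := d) (ρ y) := hyi.map (ρ : V →+* L) hρ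
  obtain ⟨τ, ν, hq⟩ := quad_eq (Q := Q) hL hyi'.isIntegral
  have hyy : y * y = algebraMap _ V τ * y + algebraMap _ V ν * e := by
    apply heq
    · simp [hy]
    · simp [hy, he0]
    · simp only [map_mul, map_add, hρ, he1, mul_one]; exact hq
  have hye : y * e = y := by
    apply heq
    · simp [hy]
    · exact hy
    · simp [he1]
  have hee : e * e = e := by
    apply heq
    · simp [he0]
    · exact he0
    · simp [he1]
  have hle : BB (MvPolynomial (Fin d) k) x y ≤ Submodule.span _ {1, y, e} := by
    apply BB_le
    · exact Submodule.subset_span (by simp)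
    · rintro v (rfl | rfl | rfl)
      · exact mem3 _ _ _ 0 b l (by rw [hxe]; simp; ring)
      · exact mem3 _ _ _ 0 (l + b * τ) (b * ν) (by
          rw [hxe]; simp only [map_add, map_mul, map_zero]
          linear_combination algebraMap _ V l * hye + algebraMap _ V b * hyy)
      · exact mem3 _ _ _ 0 b l (by
          rw [hxe]; simp only [map_zero]
          linear_combination algebraMap _ V l * hee + algebraMap _ V b * hye)
    · rintro v (rfl | rfl | rfl)
      · exact mem3 _ _ _ 0 1 0 (by simp)
      · exact mem3 _ _ _ 0 τ ν (by rw [hyy]; simp)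
      · exact mem3 _ _ _ 0 1 0 (by rw [hye]; simp)
  have he : e ≠ 0 := by rintro rfl; simp at he1
  obtain ⟨w, hw0, -, hw, hs⟩ := R1' (Q := Q) hfg hT e he
  apply good3 hr hT 1 y w
  · intro u hu
    have h1 := hle hu
    rw [Submodule.mem_span_triple] at h1
    obtain ⟨c, g, h, huv⟩ := h1
    have h2 : algebraMap _ V h * e ∈ BB (MvPolynomial (Fin d) k) x y := by
      have : algebraMap _ V h * e = u - algebraMap _ V c - algebraMap _ V g * y := by
        rw [← huv]; simp only [Algebra.smul_def]; ring
      rw [this]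
      exact sub_mem (sub_mem hu (BB_alg _ _ _)) (BB_mul (BB_alg _ _ _) (BB_right _ _))
    obtain ⟨a, ha⟩ := hw _ h2 ⟨algebraMap _ Q h, by rw [algebraMap_smul, Algebra.smul_def]⟩
    exact mem3 _ _ _ c g a (by rw [← ha, ← huv]; simp only [Algebra.smul_def])
  · exact inSat_of_mem (BB_one _ _)
  · exact inSat_of_mem (BB_right _ _)
  · exact hs

theorem caseM [IsAlgClosed k] [Module.Finite Q V]
    {L : Type} [Field L] [Algebra (MvPolynomial (Fin d) k) L] [Algebra Q L]
    [IsScalarTower (MvPolynomial (Fin d) k) Q L] [Module.Finite Q L]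
    (hr : Module.finrank Q V = 3) {x y : V} (hfg : (BB (MvPolynomial (Fin d) k) x y).FG)
    (hT : ∀ v : V, ∃ h : MvPolynomial (Fin d) k, h ≠ 0 ∧
      algebraMap _ V h * v ∈ BB (MvPolynomial (Fin d) k) x y)
    (hL : Module.finrank Q L = 2) (ρ : V →ₐ[Q] L) (c0 : V →ₐ[Q] Q) (hx : c0 x = 0)
    (hy : c0 y = 0) (hinj : ∀ u, c0 u = 0 → ρ u = 0 → u = 0)
    (e : V) (he0 : c0 e = 0) (he1 : ρ e = 1) (H : LinH k d x y) :
    Good (BB (MvPolynomial (Fin d) k) x y) := by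
  have hρ : ∀ a : MvPolynomial (Fin d) k, ρ (algebraMap _ V a) = algebraMap _ L a := by
    intro a
    rw [IsScalarTower.algebraMap_apply _ Q V, AlgHom.commutes, ← IsScalarTower.algebraMap_apply]
  have H' : LinH k d (ρ x) (ρ y) := H.map (ρ : V →+* L) hρ
  rcases domA (Q := Q) (by omega) _ _ H' with ⟨a, b, l, hab, h⟩ | ⟨hli, -, -, -⟩
  · have h' : algebraMap (MvPolynomial (Fin d) k) V (MvPolynomial.C a) * x +
        algebraMap (MvPolynomial (Fin d) k) V (MvPolynomial.C b) * y = algebraMap _ V l * e := by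
      rw [← sub_eq_zero]
      apply hinj
      · simp [hx, hy, he0]
      · simp only [map_sub, map_add, map_mul, hρ, he1]; rw [h]; ring
    by_cases ha : a = 0
    · have hb : b ≠ 0 := fun hb => hab ⟨ha, hb⟩
      rw [add_comm] at h'
      obtain ⟨l', b', e'⟩ := lin_solve hb h'
      rw [BB_symm] at hfg ⊢
      simp only [BB_symm x y] at hT
      exact caseM_main hr hfg hT hL ρ c0 hx hinj e he0 he1 H.left l' b' e'
    · obtain ⟨l', b', e'⟩ := lin_solve ha h'
      exact caseM_main hr hfg hT hL ρ c0 hy hinj e he0 he1 H.right l' b' e'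
  · exfalso
    obtain ⟨a, ha, hs⟩ := li_of_fin (k := k) (d := d) (Q := Q) (n := 3) (by omega) ![1, ρ x, ρ y]
    simp [Fin.sum_univ_three] at hs
    obtain ⟨g0, g1, g2⟩ := hli _ _ _ hs
    apply ha
    funext i
    fin_cases i
    · exact g0
    · exact g1
    · exact g2
end caseM
end S8
end

section
namespace S8
section classify
open Polynomial
variable {k : Type} [Field k] {d : ℕ}
variable {Q : Type} [Field Q] [Algebra (MvPolynomial (Fin d) k) Q]
  [IsFractionRing (MvPolynomial (Fin d) k) Q]
variable {V : Type} [CommRing V] [Algebra Q V] [Algebra (MvPolynomial (Fin d) k) V]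
  [IsScalarTower (MvPolynomial (Fin d) k) Q V]

theorem char_lin {s t : V} (H : LinH k d s t) (c : V →ₐ[Q] Q) :
    ∃ a b : MvPolynomial (Fin d) k, a.IsHomogeneous 1 ∧
      b.IsHomogeneous 1 ∧ c s = algebraMap _ Q a ∧ c t = algebraMap _ Q b := by
  obtain ⟨a, ha, h1⟩ := charlin (k := k) (d := d) (c s) (H.left.map (c : V →+* Q) (char_alg c))
  obtain ⟨b, hb, h2⟩ := charlin (k := k) (d := d) (c t) (H.right.map (c : V →+* Q) (char_alg c))
  exact ⟨a, b, ha, hb, h1, h2⟩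

theorem char_of_dim_one {W : Type} [CommRing W] [Algebra Q W] (h : Module.finrank Q W = 1) :
    ∃ c : W →ₐ[Q] Q, ∀ u, c u = 0 → u = 0 := by
  have hn : Nontrivial W := Module.nontrivial_of_finrank_pos (R := Q) (by omega)
  obtain ⟨c, hc⟩ := act_char (Q := Q) (1 : W) one_ne_zero (fun u => by
    obtain ⟨q, hq⟩ := (finrank_eq_one_iff_of_nonzero' (1 : W) one_ne_zero).1 h (u * 1)
    exact ⟨q, hq.symm⟩)
  refine ⟨c, fun u hu => ?_⟩
  have := hc u
  rwa [hu, zero_smul, mul_one] at this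

theorem caseR [IsAlgClosed k] [Module.Finite Q V]
    {L : Type} [Field L] [Algebra (MvPolynomial (Fin d) k) L] [Algebra Q L]
    [IsScalarTower (MvPolynomial (Fin d) k) Q L] [Module.Finite Q L]
    (hr : Module.finrank Q V = 3) {x y : V} (hfg : (BB (MvPolynomial (Fin d) k) x y).FG)
    (hT : ∀ v : V, ∃ h : MvPolynomial (Fin d) k, h ≠ 0 ∧
      algebraMap _ V h * v ∈ BB (MvPolynomial (Fin d) k) x y)
    (c0 : V →ₐ[Q] Q) (hx : c0 x = 0) (hy : c0 y = 0) (H : LinH k d x y)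
    (ρ : V →ₐ[Q] L) (hρ : Function.Surjective ρ) (n : V) (hn0 : c0 n = 0) (hn1 : ρ n ≠ 0) :
    Good (BB (MvPolynomial (Fin d) k) x y) := by
  obtain ⟨m, hm⟩ := hρ (ρ n)⁻¹
  have he0 : c0 (m * n) = 0 := by rw [map_mul, hn0, mul_zero]
  have he1 : ρ (m * n) = 1 := by rw [map_mul, hm, inv_mul_cancel₀ hn1]
  have hrn := LinearMap.finrank_range_add_finrank_ker ρ.toLinearMap
  have hsurj : LinearMap.range ρ.toLinearMap = ⊤ := LinearMap.range_eq_top.2 hρ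
  rw [hsurj, finrank_top, hr] at hrn
  have hLpos : 0 < Module.finrank Q L := Module.finrank_pos
  -- the element complementary to e
  have h1e : ρ (1 - m * n) = 0 := by rw [map_sub, he1, map_one, sub_self]
  have h1c : c0 (1 - m * n) = 1 := by rw [map_sub, he0, map_one, sub_zero]
  have hk0 : Module.finrank Q (LinearMap.ker ρ.toLinearMap) ≠ 0 := by
    intro h0
    rw [Submodule.finrank_eq_zero] at h0
    have : (1 - m * n) ∈ LinearMap.ker ρ.toLinearMap := h1e
    rw [h0, Submodule.mem_bot] at this
    rw [this, map_zero] at h1c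
    exact zero_ne_one h1c
  by_cases h1 : Module.finrank Q L = 1
  · obtain ⟨c, hc⟩ := char_of_dim_one h1
    apply caseT hr hfg hT c0 (c.comp ρ) _ hx hy (char_lin H)
    intro h
    have : c (ρ n) = 0 := by
      have := congrArg (fun f : V →ₐ[Q] Q => f n) h
      simp only [AlgHom.comp_apply] at this
      rw [← this, hn0]
    exact hn1 (hc _ this)
  · have h2 : Module.finrank Q L = 2 := by omega
    apply caseM hr hfg hT h2 ρ c0 hx hy _ (m * n) he0 he1 H
    intro u hu0 hu1
    obtain ⟨z, hz0, hzm, hz⟩ := line (LinearMap.ker ρ.toLinearMap) (by omega)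
    obtain ⟨q1, hq1⟩ := hz _ h1e
    obtain ⟨q2, hq2⟩ := hz _ hu1
    have hcz : c0 z ≠ 0 := by
      intro h
      rw [hq1, map_smul, h, smul_zero] at h1c
      exact zero_ne_one h1c
    rw [hq2, map_smul, smul_eq_mul] at hu0
    rw [hq2, (mul_eq_zero.1 hu0).resolve_right hcz, zero_smul]

theorem withchar3 [IsAlgClosed k] [Module.Finite Q V]
    (hr : Module.finrank Q V = 3) {x y : V} (hfg : (BB (MvPolynomial (Fin d) k) x y).FG)
    (hT : ∀ v : V, ∃ h : MvPolynomial (Fin d) k, h ≠ 0 ∧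
      algebraMap _ V h * v ∈ BB (MvPolynomial (Fin d) k) x y)
    (c0 : V →ₐ[Q] Q) (hx : c0 x = 0) (hy : c0 y = 0) (H : LinH k d x y) (hA : Alt k d Q x y) :
    Good (BB (MvPolynomial (Fin d) k) x y) := by
  by_cases hnil : ∀ u, c0 u = 0 → IsNilpotent u
  · exact caseL hr hfg hT c0 hx hy hnil hA
  push Not at hnil
  obtain ⟨n, hn0, hn⟩ := hnil
  rw [nilpotent_iff_mem_prime] at hn
  push Not at hn
  obtain ⟨P, hP, hnP⟩ := hn
  have : IsArtinianRing V := IsArtinianRing.of_finite Q V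
  have hmax : P.IsMaximal := IsArtinianRing.isMaximal_of_isPrime P
  letI := Ideal.Quotient.field P
  exact caseR (L := V ⧸ P) hr hfg hT c0 hx hy H (Ideal.Quotient.mkₐ Q P)
    (Ideal.Quotient.mkₐ_surjective Q P) n hn0
    (fun h => hnP (Ideal.Quotient.eq_zero_iff_mem.1 h))

theorem withchar [IsAlgClosed k] [Module.Finite Q V]
    (hr : Module.finrank Q V ≤ 3) {s t : V} (hfg : (BB (MvPolynomial (Fin d) k) s t).FG)
    (hT : ∀ v : V, ∃ h : MvPolynomial (Fin d) k, h ≠ 0 ∧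
      algebraMap _ V h * v ∈ BB (MvPolynomial (Fin d) k) s t)
    (H : LinH k d s t)
    (HL : ∀ σ τ : MvPolynomial (Fin d) k, σ.IsHomogeneous 1 → τ.IsHomogeneous 1 →
      ∀ c0 : V →ₐ[Q] Q, c0 s = algebraMap _ Q σ → c0 t = algebraMap _ Q τ →
      Alt k d Q (s - algebraMap _ V σ) (t - algebraMap _ V τ)) (c0 : V →ₐ[Q] Q) :
    Good (BB (MvPolynomial (Fin d) k) s t) := by
  obtain ⟨σ, τ, hσ, hτ, hs, ht⟩ := char_lin H c0
  have hA := HL σ τ hσ hτ c0 hs ht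
  have H' := H.shift hσ hτ
  rw [← BB_shift s t σ τ] at hfg ⊢
  simp only [← BB_shift s t σ τ] at hT
  have hx : c0 (s - algebraMap _ V σ) = 0 := by rw [map_sub, char_alg, hs, sub_self]
  have hy : c0 (t - algebraMap _ V τ) = 0 := by rw [map_sub, char_alg, ht, sub_self]
  generalize s - algebraMap _ V σ = x at *
  generalize t - algebraMap _ V τ = y at *
  have hk := ker_finrank c0
  by_cases h3 : Module.finrank Q V = 3
  · exact withchar3 h3 hfg hT c0 hx hy H' hA
  by_cases h2 : Module.finrank Q V = 2
  · refine case2 h2 hfg hT c0 hx hy (fun c => ?_)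
    obtain ⟨a, b, -, -, h1, h2⟩ := char_lin H' c
    exact ⟨a, b, h1, h2⟩
  have h0 : Module.finrank Q (LinearMap.ker c0.toLinearMap) = 0 := by omega
  rw [Submodule.finrank_eq_zero] at h0
  have hz : ∀ u, c0 u = 0 → u = 0 := by
    intro u hu
    have : u ∈ LinearMap.ker c0.toLinearMap := hu
    rwa [h0, Submodule.mem_bot] at this
  apply good_of_span (Q := Q) (n := 1) (by omega) hT ![1]
  · rw [Matrix.range_cons, Matrix.range_empty, Set.union_empty]
    apply BB_le
    · exact Submodule.subset_span rfl
    · intro v _; rw [hz x hx, zero_mul]; exact zero_mem _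
    · intro v _; rw [hz y hy, zero_mul]; exact zero_mem _
  · intro i
    fin_cases i
    exact inSat_of_mem (BB_one _ _)

theorem mainP5 [IsAlgClosed k] [Module.Finite Q V]
    (hr : Module.finrank Q V ≤ 3) {s t : V} (hfg : (BB (MvPolynomial (Fin d) k) s t).FG)
    (hT : ∀ v : V, ∃ h : MvPolynomial (Fin d) k, h ≠ 0 ∧
      algebraMap _ V h * v ∈ BB (MvPolynomial (Fin d) k) s t)
    (H : LinH k d s t)
    (HL : ∀ σ τ : MvPolynomial (Fin d) k, σ.IsHomogeneous 1 → τ.IsHomogeneous 1 →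
      ∀ c0 : V →ₐ[Q] Q, c0 s = algebraMap _ Q σ → c0 t = algebraMap _ Q τ →
      Alt k d Q (s - algebraMap _ V σ) (t - algebraMap _ V τ)) :
    Good (BB (MvPolynomial (Fin d) k) s t) := by
  rcases subsingleton_or_nontrivial V with hV | hV
  · exact ⟨0, Fin.elim0, linearIndependent_empty_type, fun u _ => by
      rw [Subsingleton.elim u 0]; exact zero_mem _, fun i => i.elim0⟩
  by_cases hf : IsField V
  · letI := hf.toField
    exact caseField (Q := Q) hr s t H
  · rw [Ring.not_isField_iff_exists_ideal_bot_lt_and_lt_top] at hf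
    obtain ⟨I, hI0, hI1⟩ := hf
    obtain ⟨c0⟩ : Nonempty (V →ₐ[Q] Q) := by
      have hadd := Submodule.finrank_quotient_add_finrank (I.restrictScalars Q)
      have hq : Module.finrank Q (V ⧸ I) = Module.finrank Q (V ⧸ I.restrictScalars Q) := rfl
      rw [← hq] at hadd
      have h1 : Module.finrank Q (I.restrictScalars Q) ≠ 0 := by
        intro h0
        rw [Submodule.finrank_eq_zero] at h0
        exact hI0.ne' (Submodule.restrictScalars_injective Q V V h0)
      have h2 : Module.finrank Q (V ⧸ I) ≠ 0 := by
        have : Nontrivial (V ⧸ I) := Ideal.Quotient.nontrivial_iff.2 hI1.ne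
        have := Module.finrank_pos (R := Q) (M := V ⧸ I)
        omega
      by_cases h3 : Module.finrank Q (V ⧸ I) = 1
      · obtain ⟨c, -⟩ := char_of_dim_one h3
        exact ⟨c.comp (Ideal.Quotient.mkₐ Q I)⟩
      · obtain ⟨z, hz0, hzm, hz⟩ := line (I.restrictScalars Q) (by omega)
        obtain ⟨c, -⟩ := act_char (Q := Q) z hz0 (fun u => hz _ (I.mul_mem_left u hzm))
        exact ⟨c⟩
    exact withchar hr hfg hT H HL c0
end classify
end S8
end

section
namespace S8
section link
variable {A : Type} [CommRing A] [IsDomain A]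
variable {Q : Type} [Field Q] [Algebra A Q] [IsFractionRing A Q]
variable {V : Type} [CommRing V] [Algebra Q V] [Algebra A V] [IsScalarTower A Q V]
variable {W : Type} [CommRing W] [Algebra A W]

theorem BB_range (φ : W →ₐ[A] V) (s t : W) (hst : Algebra.adjoin A {s, t} = ⊤) :
    BB A (φ s) (φ t) = LinearMap.range φ.toLinearMap := by
  have h1 : Algebra.adjoin A {φ s, φ t} = φ.range := by
    rw [← Algebra.map_top, ← hst, AlgHom.map_adjoin, Set.image_pair]
  unfold BB
  rw [h1]
  rfl

theorem dual_link {Q : Type} [Field Q] [Algebra A Q] [IsFractionRing A Q]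
    [Algebra Q V] [IsScalarTower A Q V] [IsNoetherianRing A] [UniqueFactorizationMonoid A]
    (φ : W →ₐ[A] V) (s t : W) (hst : Algebra.adjoin A {s, t} = ⊤)
    (hker : ∀ w, φ w = 0 → ∃ a : A, a ≠ 0 ∧ a • w = 0)
    (hT : ∀ v : V, ∃ h : A, h ≠ 0 ∧ algebraMap A V h * v ∈ BB A (φ s) (φ t))
    (hG : Good (BB A (φ s) (φ t))) : Module.Projective A (W →ₗ[A] A) := by
  obtain ⟨n, c, hli, hB, hsat⟩ := hG
  have htf : Module.IsTorsionFree A V := by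
    rw [Module.isTorsionFree_iff_smul_eq_zero]
    intro a v h
    rw [Algebra.smul_def] at h
    exact ncancel (Q := Q) h
  have hP : Module.Projective A (BB A (φ s) (φ t) →ₗ[A] A) :=
    dual_projective _ c hli hB hsat (fun i => by
      obtain ⟨h, hh, hm⟩ := hT (c i)
      exact ⟨h, hh, by rw [Algebra.smul_def]; exact hm⟩)
  rw [BB_range φ s t hst] at hP
  let π : W →ₗ[A] LinearMap.range φ.toLinearMap := φ.toLinearMap.rangeRestrict
  have hπ : Function.Surjective π := φ.toLinearMap.surjective_rangeRestrict
  let e : (LinearMap.range φ.toLinearMap →ₗ[A] A) →ₗ[A] (W →ₗ[A] A) := LinearMap.lcomp A A π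
  have he : Function.Bijective e := by
    constructor
    · intro f g h
      apply LinearMap.ext
      intro b
      obtain ⟨w, rfl⟩ := hπ b
      exact congrArg (fun f : W →ₗ[A] A => f w) h
    · intro ψ
      have hk : LinearMap.ker π ≤ LinearMap.ker ψ := by
        intro w hw
        have hw' : φ w = 0 := congrArg Subtype.val (LinearMap.mem_ker.1 hw)
        obtain ⟨a, ha, haw⟩ := hker w hw'
        rw [LinearMap.mem_ker]
        have := congrArg ψ haw
        rw [map_smul, map_zero, smul_eq_mul] at this
        exact (mul_eq_zero.1 this).resolve_left ha
      refine ⟨((LinearMap.ker π).liftQ ψ hk).comp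
        (π.quotKerEquivOfSurjective hπ).symm.toLinearMap, ?_⟩
      apply LinearMap.ext
      intro w
      show ((LinearMap.ker π).liftQ ψ hk) ((π.quotKerEquivOfSurjective hπ).symm (π w)) = ψ w
      have : (π.quotKerEquivOfSurjective hπ).symm (π w) = (LinearMap.ker π).mkQ w := by
        rw [LinearEquiv.symm_apply_eq]; rfl
      rw [this]; rfl
  exact Module.Projective.of_equiv (LinearEquiv.ofBijective e he)
end link

section tens
open TensorProduct
variable {A : Type} [CommRing A] [IsDomain A]
variable {W : Type} [CommRing W] [Algebra A W]

theorem tens_ker (w : W) (h : (1 : FractionRing A) ⊗ₜ[A] w = 0) : ∃ a : A, a ≠ 0 ∧ a • w = 0 := by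
  have := (IsLocalizedModule.eq_zero_iff (nonZeroDivisors A)
    (TensorProduct.mk A (FractionRing A) W 1)).1 h
  obtain ⟨c, hc⟩ := this
  exact ⟨c, nonZeroDivisors.ne_zero c.2, hc⟩

theorem tens_surj (v : FractionRing A ⊗[A] W) :
    ∃ a : A, a ≠ 0 ∧ ∃ w : W, a • v = (1 : FractionRing A) ⊗ₜ[A] w := by
  obtain ⟨⟨w, c⟩, hc⟩ := IsLocalizedModule.surj (nonZeroDivisors A)
    (TensorProduct.mk A (FractionRing A) W 1) v
  exact ⟨c, nonZeroDivisors.ne_zero c.2, w, hc⟩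

theorem tens_lift {U : Type} [CommRing U] [Algebra (FractionRing A) U] [Algebra A U]
    [IsScalarTower A (FractionRing A) U] (ψ : W →ₐ[A] U) :
    ∃ Φ : FractionRing A ⊗[A] W →ₐ[FractionRing A] U, ∀ w,
      Φ (Algebra.TensorProduct.includeRight w) = ψ w :=
  ⟨Algebra.TensorProduct.lift (Algebra.ofId (FractionRing A) U) ψ (fun _ _ => Commute.all _ _),
    fun w => by simp⟩
end tens

section expand
open Polynomial
variable {k : Type} [Field k] {d : ℕ}

/-- bivariate polynomials over `A` which come from cubic forms -/
def Cubic (F : (MvPolynomial (Fin d) k)[X][X]) : Prop :=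
  (∀ i j, i + j ≤ 3 → ((F.coeff j).coeff i).IsHomogeneous (3 - (i + j))) ∧
  (∀ i j, 3 < i + j → (F.coeff j).coeff i = 0)

theorem Cubic.eval {F : (MvPolynomial (Fin d) k)[X][X]} (hF : Cubic F) {W : Type} [CommRing W]
    [Algebra (MvPolynomial (Fin d) k) W] (s t : W) :
    aevalAeval s t F = 
      algebraMap _ W ((F.coeff 0).coeff 0) + algebraMap _ W ((F.coeff 0).coeff 1) * s
      + algebraMap _ W ((F.coeff 1).coeff 0) * t
      + algebraMap _ W ((F.coeff 0).coeff 2) * (s * s)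
      + algebraMap _ W ((F.coeff 1).coeff 1) * (s * t)
      + algebraMap _ W ((F.coeff 2).coeff 0) * (t * t)
      + algebraMap _ W ((F.coeff 0).coeff 3) * (s * (s * s))
      + algebraMap _ W ((F.coeff 1).coeff 2) * (t * (s * s))
      + algebraMap _ W ((F.coeff 2).coeff 1) * (s * (t * t))
      + algebraMap _ W ((F.coeff 3).coeff 0) * (t * (t * t)) := by
  have h1 : ∀ j, (F.coeff j).natDegree ≤ 3 - j := by
    intro j
    rw [natDegree_le_iff_coeff_eq_zero]
    intro i hi
    exact hF.2 i j (by omega)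
  have h2 : F.natDegree ≤ 3 := by
    rw [natDegree_le_iff_coeff_eq_zero]
    intro j hj
    ext i : 1
    rw [coeff_zero]
    exact hF.2 i j (by omega)
  have e1 : F = C (F.coeff 0) + C (F.coeff 1) * X + C (F.coeff 2) * X ^ 2 + C (F.coeff 3) * X ^ 3 := by
    conv_lhs => rw [F.as_sum_range_C_mul_X_pow' (n := 4) (by omega)]
    simp [Finset.sum_range_succ]
  have e2 : ∀ p : (MvPolynomial (Fin d) k)[X], p.natDegree ≤ 3 →
      p = C (p.coeff 0) + C (p.coeff 1) * X + C (p.coeff 2) * X ^ 2 + C (p.coeff 3) * X ^ 3 := by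
    intro p hp
    conv_lhs => rw [p.as_sum_range_C_mul_X_pow' (n := 4) (by omega)]
    simp [Finset.sum_range_succ]
  have hX : aevalAeval s t (X : (MvPolynomial (Fin d) k)[X][X]) = t := by simp
  have hCX : aevalAeval s t (C X : (MvPolynomial (Fin d) k)[X][X]) = s := by simp
  have hCC : ∀ a : MvPolynomial (Fin d) k, aevalAeval s t (C (C a) : (MvPolynomial (Fin d) k)[X][X]) =
      algebraMap _ W a := by intro a; simp
  have e3 : ∀ p : (MvPolynomial (Fin d) k)[X], p.natDegree ≤ 3 →
      aevalAeval s t (C p) = algebraMap _ W (p.coeff 0) + algebraMap _ W (p.coeff 1) * s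
      + algebraMap _ W (p.coeff 2) * s ^ 2 + algebraMap _ W (p.coeff 3) * s ^ 3 := by
    intro p hp
    conv_lhs => rw [e2 p hp]
    simp only [C_add, C_mul, C_pow, map_add, map_mul, map_pow, hCX, hCC]
  conv_lhs => rw [e1]
  simp only [map_add, map_mul, map_pow, hX]
  rw [e3 _ ((h1 0).trans (by omega)), e3 _ ((h1 1).trans (by omega)), e3 _ ((h1 2).trans (by omega)),
    e3 _ ((h1 3).trans (by omega))]
  rw [hF.2 3 1 (by omega), hF.2 2 2 (by omega), hF.2 3 2 (by omega), hF.2 1 3 (by omega),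
    hF.2 2 3 (by omega), hF.2 3 3 (by omega)]
  simp only [map_zero]
  ring

/-- Taylor expansion of a cubic at a linear point -/
theorem Cubic.taylor {F : (MvPolynomial (Fin d) k)[X][X]} (hF : Cubic F)
    {σ τ : MvPolynomial (Fin d) k} (hσ : σ.IsHomogeneous 1) (hτ : τ.IsHomogeneous 1) :
    ∃ c a b Q0 Q1 Q2 e0 e1 e2 e3 : MvPolynomial (Fin d) k, a.IsHomogeneous 2 ∧ b.IsHomogeneous 2 ∧
    ∀ {W : Type} [CommRing W] [Algebra (MvPolynomial (Fin d) k) W] (x y : W),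
    aevalAeval (x + algebraMap _ W σ) (y + algebraMap _ W τ) F =
    algebraMap _ W c + (algebraMap _ W a * x + algebraMap _ W b * y + algebraMap _ W Q0 * (x * x)
    + algebraMap _ W Q1 * (x * y) + algebraMap _ W Q2 * (y * y)
    + algebraMap _ W e0 * (x * (x * x)) + algebraMap _ W e1 * (y * (x * x))
    + algebraMap _ W e2 * (x * (y * y)) + algebraMap _ W e3 * (y * (y * y))) := by
  have H : ∀ i j, i + j ≤ 3 → ∀ n, n = 3 - (i + j) → ((F.coeff j).coeff i).IsHomogeneous n := by
    rintro i j h n rfl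
    exact hF.1 i j h
  have nat : ∀ (n : ℕ), (MvPolynomial.C (n : k) : MvPolynomial (Fin d) k).IsHomogeneous 0 :=
    fun n => MvPolynomial.isHomogeneous_C _ _
  have hE := fun (W : Type) (i1 : CommRing W) (i2 : Algebra (MvPolynomial (Fin d) k) W) (s t : W) =>
    hF.eval s t
  have f01 := H 1 0 (by omega) 2 rfl
  have f10 := H 0 1 (by omega) 2 rfl
  have f02 := H 2 0 (by omega) 1 rfl
  have f11 := H 1 1 (by omega) 1 rfl
  have f20 := H 0 2 (by omega) 1 rfl
  have f03 := H 3 0 (by omega) 0 rfl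
  have f12 := H 2 1 (by omega) 0 rfl
  have f21 := H 1 2 (by omega) 0 rfl
  have f30 := H 0 3 (by omega) 0 rfl
  generalize (F.coeff 0).coeff 0 = g00 at *
  generalize (F.coeff 0).coeff 1 = g01 at *
  generalize (F.coeff 1).coeff 0 = g10 at *
  generalize (F.coeff 0).coeff 2 = g02 at *
  generalize (F.coeff 1).coeff 1 = g11 at *
  generalize (F.coeff 2).coeff 0 = g20 at *
  generalize (F.coeff 0).coeff 3 = g03 at *
  generalize (F.coeff 1).coeff 2 = g12 at *
  generalize (F.coeff 2).coeff 1 = g21 at *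
  generalize (F.coeff 3).coeff 0 = g30 at *
  refine ⟨g00 + g01 * σ + g10 * τ + g02 * (σ * σ) + g11 * (σ * τ) + g20 * (τ * τ) +
      g03 * (σ * (σ * σ)) + g12 * (τ * (σ * σ)) + g21 * (σ * (τ * τ)) + g30 * (τ * (τ * τ)),
    g01 + (g02 * σ + g02 * σ) + g11 * τ +
      (g03 * (σ * σ) + g03 * (σ * σ) + g03 * (σ * σ)) + (g12 * (σ * τ) + g12 * (σ * τ)) + g21 * (τ * τ),
    g10 + (g20 * τ + g20 * τ) + g11 * σ +
      (g30 * (τ * τ) + g30 * (τ * τ) + g30 * (τ * τ)) + (g21 * (σ * τ) + g21 * (σ * τ)) + g12 * (σ * σ),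
    g02 + 3 * g03 * σ + g12 * τ, g11 + 2 * g12 * σ + 2 * g21 * τ, g20 + g21 * σ + 3 * g30 * τ,
    g03, g12, g21, g30, ?_, ?_, ?_⟩
  · exact ((((f01.add ((f02.mul hσ).add (f02.mul hσ))).add (f11.mul hτ)).add
      (((f03.mul (hσ.mul hσ)).add (f03.mul (hσ.mul hσ))).add (f03.mul (hσ.mul hσ)))).add
      ((f12.mul (hσ.mul hτ)).add (f12.mul (hσ.mul hτ)))).add (f21.mul (hτ.mul hτ))
  · exact ((((f10.add ((f20.mul hτ).add (f20.mul hτ))).add (f11.mul hσ)).add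
      (((f30.mul (hτ.mul hτ)).add (f30.mul (hτ.mul hτ))).add (f30.mul (hτ.mul hτ)))).add
      ((f21.mul (hσ.mul hτ)).add (f21.mul (hσ.mul hτ)))).add (f12.mul (hσ.mul hσ))
  · intro W _ _ x y
    rw [hE W _ _]
    simp only [map_add, map_mul, map_ofNat]
    ring
end expand
end S8
end

section
namespace S8
section core
open Polynomial TensorProduct
variable {k : Type} [Field k] {d : ℕ}

theorem surj_adjoin {A : Type} [CommRing A] {W : Type} [CommRing W] [Algebra A W] (s t : W)
    (hsurj : Function.Surjective (aevalAeval s t : A[X][X] →ₐ[A] W)) :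
    Algebra.adjoin A {s, t} = ⊤ := by
  rw [eq_top_iff]
  rintro w -
  obtain ⟨p, rfl⟩ := hsurj w
  have hs : s ∈ Algebra.adjoin A {s, t} := Algebra.subset_adjoin (by simp)
  have ht : t ∈ Algebra.adjoin A {s, t} := Algebra.subset_adjoin (by simp)
  have hq : ∀ q : A[X], aevalAeval s t (C q) ∈ Algebra.adjoin A {s, t} := by
    intro q
    induction q using Polynomial.induction_on' with
    | add p q hp hq => rw [C_add, map_add]; exact add_mem hp hq
    | monomial n a =>
      rw [← C_mul_X_pow_eq_monomial, C_mul, C_pow, map_mul, map_pow, aevalAeval_X, aevalAeval_C, aeval_C]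
      exact mul_mem (Subalgebra.algebraMap_mem _ a) (Subalgebra.pow_mem _ hs n)
  induction p using Polynomial.induction_on' with
  | add p q hp hq => rw [map_add]; exact add_mem hp hq
  | monomial n a =>
    rw [← C_mul_X_pow_eq_monomial, map_mul, map_pow, aevalAeval_Y]
    exact mul_mem (hq a) (Subalgebra.pow_mem _ ht n)

theorem integral_abs {A : Type} [CommRing A] {W : Type} [CommRing W] [Algebra A W] (s t : W)
    (hst : Algebra.adjoin A {s, t} = ⊤) {f : A[X][X]} (hf : f.Monic) (hf0 : aevalAeval s t f = 0)
    {δ : A[X]} (hδ : δ.Monic) (hδ0 : aeval s δ = 0) : Algebra.IsIntegral A W := by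
  have hs : IsIntegral A s := ⟨δ, hδ, hδ0⟩
  have ht : IsIntegral A t := by
    have hB : Algebra.IsIntegral A (Algebra.adjoin A {s}) := Algebra.IsIntegral.adjoin (by simpa using hs)
    have hmem : s ∈ Algebra.adjoin A {s} := Algebra.subset_adjoin (by simp)
    generalize Algebra.adjoin A {s} = B at hB hmem
    apply isIntegral_trans (A := B)
    refine ⟨f.map (aeval (⟨s, hmem⟩ : B) : A[X] →ₐ[A] B).toRingHom, hf.map _, ?_⟩
    rw [eval₂_map]
    have : (algebraMap B W).comp (aeval (⟨s, hmem⟩ : B) : A[X] →ₐ[A] B).toRingHom =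
        (aevalAeval s t : A[X][X] →ₐ[A] W).toRingHom.comp C := by
      apply RingHom.ext
      intro q
      show B.val (aeval (⟨s, hmem⟩ : B) q) = aevalAeval s t (C q)
      rw [← aeval_algHom_apply]
      simp
    rw [this]
    have h2 : t = (aevalAeval s t : A[X][X] →ₐ[A] W).toRingHom X := by simp
    conv_lhs => arg 2; rw [h2]
    rw [← hom_eval₂, eval₂_C_X]
    exact hf0
  have h1 : Algebra.IsIntegral A (Algebra.adjoin A {s, t}) := Algebra.IsIntegral.adjoin (by
    intro x hx
    rcases hx with rfl | rfl
    · exact hs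
    · exact ht)
  rw [hst] at h1
  exact ⟨fun x => by
    have := h1.isIntegral (⟨x, Algebra.mem_top⟩ : (⊤ : Subalgebra A W))
    exact this.map (⊤ : Subalgebra A W).val⟩

theorem tens_alt {F G H : (MvPolynomial (Fin d) k)[X][X]} (cF : Cubic F) (cG : Cubic G) (cH : Cubic H)
    {σ τ : MvPolynomial (Fin d) k} (hσ : σ.IsHomogeneous 1) (hτ : τ.IsHomogeneous 1)
    {V : Type} [CommRing V] [Algebra (FractionRing (MvPolynomial (Fin d) k)) V]
    [Algebra (MvPolynomial (Fin d) k) V]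
    [IsScalarTower (MvPolynomial (Fin d) k) (FractionRing (MvPolynomial (Fin d) k)) V]
    (s t : V) (hF : aevalAeval s t F = 0) (hG : aevalAeval s t G = 0) (hH : aevalAeval s t H = 0)
    (lift : ∀ s' t' : DualNumber (FractionRing (MvPolynomial (Fin d) k)),
      aevalAeval s' t' F = 0 → aevalAeval s' t' G = 0 → aevalAeval s' t' H = 0 →
      ∃ Φ : V →ₐ[FractionRing (MvPolynomial (Fin d) k)]
        DualNumber (FractionRing (MvPolynomial (Fin d) k)), Φ s = s' ∧ Φ t = t')
    (c0 : V →ₐ[FractionRing (MvPolynomial (Fin d) k)] (FractionRing (MvPolynomial (Fin d) k)))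
    (h0s : c0 s = algebraMap _ _ σ) (h0t : c0 t = algebraMap _ _ τ) :
    Alt k d (FractionRing (MvPolynomial (Fin d) k))
      (s - algebraMap _ V σ) (t - algebraMap _ V τ) := by
  have key : ∀ P : (MvPolynomial (Fin d) k)[X][X], Cubic P → aevalAeval s t P = 0 →
      (∃ a b Q0 Q1 Q2 e0 e1 e2 e3 : MvPolynomial (Fin d) k, a.IsHomogeneous 2 ∧ b.IsHomogeneous 2 ∧
      ∀ {W : Type} [CommRing W] [Algebra (MvPolynomial (Fin d) k) W] (x y : W),
      aevalAeval (x + algebraMap _ W σ) (y + algebraMap _ W τ) P =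
      (algebraMap _ W a * x + algebraMap _ W b * y + algebraMap _ W Q0 * (x * x)
      + algebraMap _ W Q1 * (x * y) + algebraMap _ W Q2 * (y * y)
      + algebraMap _ W e0 * (x * (x * x)) + algebraMap _ W e1 * (y * (x * x))
      + algebraMap _ W e2 * (x * (y * y)) + algebraMap _ W e3 * (y * (y * y)))) := by
    intro P cP hP
    obtain ⟨c, a, b, Q0, Q1, Q2, e0, e1, e2, e3, ha, hb, hall⟩ := cP.taylor hσ hτ
    have h1 := hall (s - algebraMap _ V σ) (t - algebraMap _ V τ)
    rw [sub_add_cancel, sub_add_cancel, hP] at h1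
    have h2 := congrArg c0 h1
    simp only [map_add, map_mul, map_sub, char_alg, h0s, h0t, map_zero, sub_self, mul_zero, add_zero] at h2
    have hc : c = 0 := aq_zero (Q := FractionRing (MvPolynomial (Fin d) k)) h2.symm
    refine ⟨a, b, Q0, Q1, Q2, e0, e1, e2, e3, ha, hb, ?_⟩
    intro W _ _ x y
    rw [hall, hc, map_zero, zero_add]
  have first : ∀ a b Q0 Q1 Q2 e0 e1 e2 e3 : MvPolynomial (Fin d) k, ∀ P : (MvPolynomial (Fin d) k)[X][X],
      a.IsHomogeneous 2 → b.IsHomogeneous 2 → aevalAeval s t P = 0 → (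
      ∀ {W : Type} [CommRing W] [Algebra (MvPolynomial (Fin d) k) W] (x y : W),
      aevalAeval (x + algebraMap _ W σ) (y + algebraMap _ W τ) P =
      (algebraMap _ W a * x + algebraMap _ W b * y + algebraMap _ W Q0 * (x * x)
      + algebraMap _ W Q1 * (x * y) + algebraMap _ W Q2 * (y * y)
      + algebraMap _ W e0 * (x * (x * x)) + algebraMap _ W e1 * (y * (x * x))
      + algebraMap _ W e2 * (x * (y * y)) + algebraMap _ W e3 * (y * (y * y)))) → 
      ¬ (a = 0 ∧ b = 0) → Alt k d (FractionRing (MvPolynomial (Fin d) k))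
      (s - algebraMap _ V σ) (t - algebraMap _ V τ) := by
    intro a b Q0 Q1 Q2 e0 e1 e2 e3 P ha hb hP hall hab
    left
    refine ⟨a, b, Q0, Q1, Q2, e0, e1, e2, e3, ha, hb, hab, ?_⟩
    have h1 := hall (s - algebraMap _ V σ) (t - algebraMap _ V τ)
    rw [sub_add_cancel, sub_add_cancel, hP] at h1
    exact h1.symm
  obtain ⟨a, b, Q0, Q1, Q2, e0, e1, e2, e3, ha, hb, hall⟩ := key F cF hF
  by_cases hab : a = 0 ∧ b = 0
  swap
  · exact first a b Q0 Q1 Q2 e0 e1 e2 e3 F ha hb hF hall hab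
  obtain ⟨a', b', Q0', Q1', Q2', e0', e1', e2', e3', ha', hb', hall'⟩ := key G cG hG
  by_cases hab' : a' = 0 ∧ b' = 0
  swap
  · exact first a' b' Q0' Q1' Q2' e0' e1' e2' e3' G ha' hb' hG hall' hab'
  obtain ⟨a2, b2, Q02, Q12, Q22, e02, e12, e22, e32, ha2, hb2, hall2⟩ := key H cH hH
  by_cases hab2 : a2 = 0 ∧ b2 = 0
  swap
  · exact first a2 b2 Q02 Q12 Q22 e02 e12 e22 e32 H ha2 hb2 hH hall2 hab2
  right
  have z : ∀ x y : DualNumber (FractionRing (MvPolynomial (Fin d) k)),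
      x * x = 0 → x * y = 0 → y * y = 0 → 
      ∃ Φ : V →ₐ[FractionRing (MvPolynomial (Fin d) k)]
        DualNumber (FractionRing (MvPolynomial (Fin d) k)), Φ (s - algebraMap _ V σ) = x ∧
          Φ (t - algebraMap _ V τ) = y := by
    intro x y hxx hxy hyy
    obtain ⟨Φ, h1, h2⟩ := lift (x + algebraMap _ _ σ) (y + algebraMap _ _ τ)
      (by rw [hall, hxx, hxy, hyy, hab.1, hab.2]; simp only [mul_zero, map_zero, zero_mul, add_zero])
      (by rw [hall', hxx, hxy, hyy, hab'.1, hab'.2]; simp only [mul_zero, map_zero, zero_mul, add_zero])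
      (by rw [hall2, hxx, hxy, hyy, hab2.1, hab2.2]; simp only [mul_zero, map_zero, zero_mul, add_zero])
    have hc : ∀ a : MvPolynomial (Fin d) k, Φ (algebraMap _ V a) = algebraMap _ _ a := by
      intro a
      rw [IsScalarTower.algebraMap_apply _ (FractionRing (MvPolynomial (Fin d) k)) V, AlgHom.commutes,
        ← IsScalarTower.algebraMap_apply]
    refine ⟨Φ, ?_, ?_⟩
    · rw [map_sub, h1, hc, add_sub_cancel_right]
    · rw [map_sub, h2, hc, add_sub_cancel_right]
  obtain ⟨Φ, h1, h2⟩ := z DualNumber.eps 0 (by simp) (by simp) (by simp)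
  obtain ⟨Ψ, h3, h4⟩ := z 0 DualNumber.eps (by simp) (by simp) (by simp)
  exact ⟨Φ, Ψ, h1, h2, h3, h4⟩

theorem alg_lift {A S W U : Type} [CommRing A] [CommRing S] [CommRing W] [CommRing U] [Algebra A S]
    [Algebra A W] [Algebra A U] (π : S →ₐ[A] W) (hπ : Function.Surjective π) (ψ : S →ₐ[A] U)
    (h : ∀ p, π p = 0 → ψ p = 0) : ∃ Φ : W →ₐ[A] U, ∀ p, Φ (π p) = ψ p := by
  choose r hr using hπ
  have hd : ∀ p q, π p = π q → ψ p = ψ q := by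
    intro p q hpq
    rw [← sub_eq_zero, ← map_sub]
    apply h
    rw [map_sub, hpq, sub_self]
  refine ⟨{ toFun := fun w => ψ (r w), map_one' := ?_, map_mul' := ?_, map_zero' := ?_,
            map_add' := ?_, commutes' := ?_ }, ?_⟩
  · rw [← map_one ψ]; apply hd; rw [hr, map_one]
  · intro x y; rw [← map_mul]; apply hd; rw [map_mul, hr, hr, hr]
  · rw [← map_zero ψ]; apply hd; rw [hr, map_zero]
  · intro x y; rw [← map_add]; apply hd; rw [map_add, hr, hr, hr]
  · intro a
    show ψ (r (algebraMap A W a)) = algebraMap A U a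
    rw [← ψ.commutes]; apply hd; rw [hr, π.commutes]
  · intro p; exact hd _ _ (hr _)

theorem aevalAeval_map {A : Type} [CommRing A] {W V : Type} [CommRing W] [Algebra A W] [CommRing V]
    [Algebra A V] (φ : W →ₐ[A] V) (s t : W) (P : A[X][X]) :
    aevalAeval (φ s) (φ t) P = φ (aevalAeval s t P) := by
  have h : (aevalAeval (φ s) (φ t) : A[X][X] →ₐ[A] _).toRingHom =
    (φ.comp (aevalAeval s t)).toRingHom := by
    apply Polynomial.ringHom_ext'
    · apply Polynomial.ringHom_ext'
      · apply RingHom.ext; intro a; simp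
      · simp
    · simp
  exact congrArg (fun f : A[X][X] →+* _ => f P) h

theorem core_abs1 [IsAlgClosed k] {F G H : (MvPolynomial (Fin d) k)[X][X]}
    (cF : Cubic F) (cG : Cubic G) (cH : Cubic H)
    {W : Type} [CommRing W] [Algebra (MvPolynomial (Fin d) k) W] [Module.Finite (MvPolynomial (Fin d) k) W]
    (s t : W) (hst : Algebra.adjoin (MvPolynomial (Fin d) k) {s, t} = ⊤)
    (hF : aevalAeval s t F = 0) (hG : aevalAeval s t G = 0) (hH : aevalAeval s t H = 0)
    {V : Type} [CommRing V] [Algebra (FractionRing (MvPolynomial (Fin d) k)) V]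
    [Algebra (MvPolynomial (Fin d) k) V]
    [IsScalarTower (MvPolynomial (Fin d) k) (FractionRing (MvPolynomial (Fin d) k)) V]
    [Module.Finite (FractionRing (MvPolynomial (Fin d) k)) V]
    (φ : W →ₐ[MvPolynomial (Fin d) k] V)
    (hker : ∀ w, φ w = 0 → ∃ a : MvPolynomial (Fin d) k, a ≠ 0 ∧ a • w = 0)
    (hsurj : ∀ v : V, ∃ a : MvPolynomial (Fin d) k, a ≠ 0 ∧ ∃ w, a • v = φ w)
    (lift : ∀ s' t' : DualNumber (FractionRing (MvPolynomial (Fin d) k)),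
      aevalAeval s' t' F = 0 → aevalAeval s' t' G = 0 → aevalAeval s' t' H = 0 →
      ∃ Φ : V →ₐ[FractionRing (MvPolynomial (Fin d) k)]
        DualNumber (FractionRing (MvPolynomial (Fin d) k)), Φ (φ s) = s' ∧ Φ (φ t) = t')
    (hL : LinH k d s t)
    (hr : Module.finrank (FractionRing (MvPolynomial (Fin d) k)) V ≤ 3) :
    Module.Projective (MvPolynomial (Fin d) k) (W →ₗ[MvPolynomial (Fin d) k] MvPolynomial (Fin d) k) := by
  have hT : ∀ v : V, ∃ h : MvPolynomial (Fin d) k, h ≠ 0 ∧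
      algebraMap _ V h * v ∈ BB (MvPolynomial (Fin d) k) (φ s) (φ t) := by
    intro v
    obtain ⟨a, ha, w, hw⟩ := hsurj v
    refine ⟨a, ha, ?_⟩
    rw [← Algebra.smul_def, hw, BB_range φ s t hst]
    exact ⟨w, rfl⟩
  have hfg : (BB (MvPolynomial (Fin d) k) (φ s) (φ t)).FG := by
    rw [BB_range φ s t hst, LinearMap.range_eq_map]
    exact (Module.Finite.fg_top).map _
  have hL' : LinH k d (φ s) (φ t) := LinH.map hL φ.toRingHom (fun a => φ.commutes a)
  have hG' := mainP5 (k := k) (d := d) (Q := FractionRing (MvPolynomial (Fin d) k)) hr hfg hT hL'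
    (fun σ τ hσ hτ c0 h1 h2 =>
      tens_alt cF cG cH hσ hτ (φ s) (φ t) (by rw [aevalAeval_map, hF, map_zero])
        (by rw [aevalAeval_map, hG, map_zero])
        (by rw [aevalAeval_map, hH, map_zero]) lift c0 h1 h2)
  exact dual_link (Q := FractionRing (MvPolynomial (Fin d) k)) φ s t hst hker hT hG'

theorem core_abs [IsAlgClosed k] {F G H : (MvPolynomial (Fin d) k)[X][X]}
    (cF : Cubic F) (cG : Cubic G) (cH : Cubic H)
    {W : Type} [CommRing W] [Algebra (MvPolynomial (Fin d) k) W] [Module.Finite (MvPolynomial (Fin d) k) W]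
    (s t : W) (hst : Algebra.adjoin (MvPolynomial (Fin d) k) {s, t} = ⊤)
    (hF : aevalAeval s t F = 0) (hG : aevalAeval s t G = 0) (hH : aevalAeval s t H = 0)
    (lift : ∀ s' t' : DualNumber (FractionRing (MvPolynomial (Fin d) k)),
      aevalAeval s' t' F = 0 → aevalAeval s' t' G = 0 → aevalAeval s' t' H = 0 →
      ∃ Φ : W →ₐ[MvPolynomial (Fin d) k]
        DualNumber (FractionRing (MvPolynomial (Fin d) k)), Φ s = s' ∧ Φ t = t')
    (hL : LinH k d s t)
    (hr : Module.finrank (FractionRing (MvPolynomial (Fin d) k))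
      (FractionRing (MvPolynomial (Fin d) k) ⊗[MvPolynomial (Fin d) k] W) ≤ 3) :
    Module.Projective (MvPolynomial (Fin d) k) (W →ₗ[MvPolynomial (Fin d) k] MvPolynomial (Fin d) k) := by
  refine core_abs1 cF cG cH s t hst hF hG hH
    (Algebra.TensorProduct.includeRight :
      W →ₐ[_] FractionRing (MvPolynomial (Fin d) k) ⊗[MvPolynomial (Fin d) k] W)
    (fun w hw => tens_ker w hw) (fun v => tens_surj v) ?_ hL hr
  intro s' t' e1 e2 e3
  obtain ⟨ψ, h1, h2⟩ := lift s' t' e1 e2 e3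
  obtain ⟨Φ, hΦ⟩ := tens_lift ψ
  exact ⟨Φ, by rw [← h1]; exact hΦ s, by rw [← h2]; exact hΦ t⟩

theorem core_proj [IsAlgClosed k] {F G H h' u : (MvPolynomial (Fin d) k)[X][X]} {δ : (MvPolynomial (Fin d) k)[X]}
    (D : DualData F G h' u δ) (cF : Cubic F) (cG : Cubic G) (cH : Cubic H)
    {W : Type} [CommRing W] [Algebra (MvPolynomial (Fin d) k) W]
    (s t : W) (hsurj : Function.Surjective (aevalAeval s t : (MvPolynomial (Fin d) k)[X][X] →ₐ[_] W))
    (hF : aevalAeval s t F = 0) (hG : aevalAeval s t G = 0) (hH : aevalAeval s t H = 0)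
    (hker : ∀ P : (MvPolynomial (Fin d) k)[X][X], aevalAeval s t P = 0 → ∃ a b c, P = a * F + b * G + c * H)
    (hL : LinH k d s t)
    (hr : Module.finrank (FractionRing (MvPolynomial (Fin d) k))
      (FractionRing (MvPolynomial (Fin d) k) ⊗[MvPolynomial (Fin d) k] W) ≤ 3) :
    Module.Projective (MvPolynomial (Fin d) k) (W →ₗ[MvPolynomial (Fin d) k] MvPolynomial (Fin d) k) := by
  have hst := surj_adjoin s t hsurj
  have hδ : aeval s δ = 0 := by
    have h1 : aevalAeval s t (C δ) = 0 := by
      rw [D.rel, map_add, map_mul, map_mul, hF, hG, mul_zero, mul_zero, add_zero]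
    rwa [aevalAeval_C] at h1
  have hintg := integral_abs s t hst D.hf hF D.hδ hδ
  have hfin : Module.Finite (MvPolynomial (Fin d) k) W := by
    constructor
    have := fg_adjoin_of_finite (R := MvPolynomial (Fin d) k) (s := {s, t}) (Set.toFinite _) (by
        intro x hx
        exact hintg.isIntegral x)
    rw [hst] at this
    exact this
  refine core_abs cF cG cH s t hst hF hG hH ?_ hL hr
  intro s' t' h1 h2 h3
  have hk : ∀ P : (MvPolynomial (Fin d) k)[X][X], aevalAeval s t P = 0 → aevalAeval s' t' P = 0 := by
    intro P hP
    obtain ⟨a, b, c, rfl⟩ := hker P hP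
    rw [map_add, map_add, map_mul, map_mul, map_mul, h1, h2, h3, mul_zero, mul_zero, mul_zero, add_zero, add_zero]
  obtain ⟨Φ, hΦ⟩ := alg_lift (aevalAeval s t) hsurj (aevalAeval s' t') hk
  refine ⟨Φ, ?_, ?_⟩
  · have := hΦ (C X)
    rwa [aevalAeval_X, aevalAeval_X] at this
  · have := hΦ X
    rwa [aevalAeval_Y, aevalAeval_Y] at this
end core
end S8
end

section
namespace S8
section gen
open Polynomial CategoryTheory

theorem final_generic {R A : Type} [CommRing R] [CommRing A] [IsDomain A] (e : R ≃+* A[X][X])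
    (f g h : R) {h' u : A[X][X]} {δ : A[X]} (D : DualData (e f) (e g) h' u δ)
    {W : Type} [CommRing W] [Algebra A W] (π : R →+* W) (hπ : Function.Surjective π)
    (hker : ∀ p, π p = 0 ↔ p ∈ Ideal.span {f, g, h})
    (hA : ∀ a, algebraMap A W a = π (e.symm (C (C a))))
    (hproj : Module.Projective A (W →ₗ[A] A)) :
    pdLE R (R ⧸ Ideal.span {f, g, h}) 4 := by
  have hJ : Ideal.span {e f, e g, e h} = (Ideal.span {f, g, h}).map (e : R →+* A[X][X]) := by
    rw [Ideal.map_span]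
    congr 1
    ext x
    simp [Set.image_insert_eq, Set.image_singleton]
  refine pdLE_of_ringEquiv e _ (Ideal.span {e f, e g, e h}) hJ 4 ?_
  apply D.pd
  have hk : ∀ p : A[X][X], π (e.symm p) = 0 ↔ p ∈ Ideal.span {e f, e g, e h} := by
    intro p
    rw [hker, hJ]
    constructor
    · intro hp
      have := Ideal.mem_map_of_mem (e : R →+* A[X][X]) hp
      simpa using this
    · intro hp
      obtain ⟨q, hq, rfl⟩ := (Ideal.mem_map_iff_of_surjective (e : R →+* A[X][X]) e.surjective).1 hp
      simpa using hq
  generalize Ideal.span {e f, e g, e h} = J at *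
  let ψ : A[X][X] →ₗ[A] W :=
    { toFun := fun p => π (e.symm p), map_add' := fun x y => by simp, map_smul' := fun a x => by
        simp only [RingHom.id_apply]
        rw [Algebra.smul_def, Algebra.smul_def, hA, map_mul, map_mul]; rfl }
  have hψ : Function.Surjective ψ := fun w => by
    obtain ⟨r, rfl⟩ := hπ w
    exact ⟨e r, by show π (e.symm (e r)) = π r; rw [e.symm_apply_apply]⟩
  have hq : ∀ p : A[X][X], Ideal.Quotient.mkₐ A J p = 0 ↔ ψ p = 0 := fun p =>
    Ideal.Quotient.eq_zero_iff_mem.trans (hk p).symm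
  let μ : A[X][X] →ₗ[A] (A[X][X] ⧸ J) := (Ideal.Quotient.mkₐ A J).toLinearMap
  have hμ : Function.Surjective μ := Ideal.Quotient.mk_surjective
  have hker2 : LinearMap.ker ψ = LinearMap.ker μ := by
    ext p; exact (hq p).symm
  let E : W ≃ₗ[A] (A[X][X] ⧸ J) := (ψ.quotKerEquivOfSurjective hψ).symm.trans
    ((Submodule.quotEquivOfEq _ _ hker2).trans (μ.quotKerEquivOfSurjective hμ))
  exact Module.Projective.of_equiv (LinearEquiv.congrLeft A A E)
end gen

section hom
variable {k : Type} [Field k] {N : ℕ}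
open MvPolynomial

/-- ideals closed under taking homogeneous components -/
def HomId (J : Ideal (MvPolynomial (Fin N) k)) : Prop :=
  ∀ p ∈ J, ∀ n, homogeneousComponent n p ∈ J

theorem hc_mul {q : MvPolynomial (Fin N) k} {m : ℕ} (hq : q.IsHomogeneous m) (n : ℕ)
    (a : MvPolynomial (Fin N) k) :
    homogeneousComponent n (a * q) = if m ≤ n then homogeneousComponent (n - m) a * q else 0 := by
  induction a using MvPolynomial.induction_on' with
  | monomial d c =>
    have h1 : (monomial d c : MvPolynomial (Fin N) k).IsHomogeneous d.degree :=
      isHomogeneous_monomial c rfl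
    rw [homogeneousComponent_of_mem (h1.mul hq), homogeneousComponent_of_mem h1]
    split_ifs <;> first | rfl | omega | simp
  | add p p' hp hp' =>
    rw [add_mul, map_add, hp, hp', map_add]
    split_ifs
    · rw [add_mul]
    · simp

theorem homId_span (f g h : MvPolynomial (Fin N) k) {m : ℕ} (hf : f.IsHomogeneous m)
    (hg : g.IsHomogeneous m) (hh : h.IsHomogeneous m) : HomId (Ideal.span {f, g, h}) := by
  intro p hp n
  rw [Ideal.mem_span_insert] at hp
  obtain ⟨a, z, hz, rfl⟩ := hp
  rw [Ideal.mem_span_pair] at hz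
  obtain ⟨b, c, rfl⟩ := hz
  have hfm : f ∈ Ideal.span {f, g, h} := Ideal.subset_span (by simp)
  have hgm : g ∈ Ideal.span {f, g, h} := Ideal.subset_span (by simp)
  have hhm : h ∈ Ideal.span {f, g, h} := Ideal.subset_span (by simp)
  rw [map_add, map_add, hc_mul hf, hc_mul hg, hc_mul hh]
  split_ifs
  · exact add_mem (Ideal.mul_mem_left _ _ hfm)
      (add_mem (Ideal.mul_mem_left _ _ hgm) (Ideal.mul_mem_left _ _ hhm))
  · simp
end hom

section lin
variable {k : Type} [Field k] {d : ℕ}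
open Polynomial

/-- the inclusion of the last `d` variables -/
noncomputable def iot (k : Type) [Field k] (d : ℕ) : MvPolynomial (Fin d) k →ₐ[k] MvPolynomial (Fin (d + 2)) k :=
  MvPolynomial.rename (fun i => i.succ.succ)

theorem iot_hom {p : MvPolynomial (Fin d) k} {n : ℕ} (hp : p.IsHomogeneous n) :
    (iot k d p).IsHomogeneous n := hp.rename_isHomogeneous

theorem lin_core {J : Ideal (MvPolynomial (Fin (d + 2)) k)} (hJ : HomId J)
    {ℓ : MvPolynomial (Fin (d + 2)) k} (hℓ : ℓ.IsHomogeneous 1)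
    {p : (MvPolynomial (Fin d) k)[X]} (hp : p.Monic) (h0 : p.eval₂ (iot k d).toRingHom ℓ ∈ J) :
    ∃ H : (MvPolynomial (Fin d) k)[X], H.Monic ∧
      (∀ i ≤ H.natDegree, (H.coeff i).IsHomogeneous (H.natDegree - i)) ∧
      H.eval₂ (iot k d).toRingHom ℓ ∈ J := by
  let n := p.natDegree
  let H : (MvPolynomial (Fin d) k)[X] :=
    ∑ i ∈ Finset.range (n + 1), monomial i (MvPolynomial.homogeneousComponent (n - i) (p.coeff i))
  have hcoeff : ∀ i, i ≤ n → H.coeff i = MvPolynomial.homogeneousComponent (n - i) (p.coeff i) := by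
    intro i hi
    simp only [H, finsetSum_coeff, coeff_monomial]
    rw [Finset.sum_ite_eq' ]
    rw [if_pos (Finset.mem_range.2 (by omega))]
  have hcn : H.coeff n = 1 := by
    rw [hcoeff n le_rfl, Nat.sub_self]
    have : p.coeff n = 1 := hp
    rw [this]
    exact MvPolynomial.homogeneousComponent_eq_self (MvPolynomial.isHomogeneous_one _ _)
  have hle : H.natDegree ≤ n := by
    apply natDegree_sum_le_of_forall_le
    intro i hi
    exact (natDegree_monomial_le _).trans (by have := Finset.mem_range.1 hi; omega)
  have hdeg : H.natDegree = n := le_antisymm hle (le_natDegree_of_ne_zero (by rw [hcn]; exact one_ne_zero))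
  refine ⟨H, ?_, ?_, ?_⟩
  · show H.coeff H.natDegree = 1
    rw [hdeg, hcn]
  · intro i hi
    rw [hdeg] at hi ⊢
    rw [hcoeff i hi]
    exact MvPolynomial.homogeneousComponent_isHomogeneous _ _
  · have h1 := hJ _ h0 n
    convert h1 using 1
    rw [eval₂_eq_sum_range, eval₂_eq_sum_range, hdeg, map_sum]
    apply Finset.sum_congr rfl
    intro i hi
    have hi' : i ≤ n := by have := Finset.mem_range.1 hi; omega
    have h2 : (ℓ ^ i).IsHomogeneous i := by simpa using hℓ.pow i
    rw [hcoeff i hi', hc_mul h2, if_pos hi']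
    congr 1
    exact MvPolynomial.rename_homogeneousComponent _ _

/-- the coordinate isomorphism -/
noncomputable def sig (k : Type) [Field k] (d : ℕ) :
    MvPolynomial (Fin (d + 2)) k ≃+* (MvPolynomial (Fin d) k)[X][X] :=
  (MvPolynomial.finSuccEquiv k (d + 1)).toRingEquiv.trans
    (Polynomial.mapEquiv (MvPolynomial.finSuccEquiv k d).toRingEquiv)

theorem sig_coeff (f : MvPolynomial (Fin (d + 2)) k) (i j : ℕ) :
    ((sig k d f).coeff j).coeff i =
      (MvPolynomial.finSuccEquiv k d ((MvPolynomial.finSuccEquiv k (d + 1) f).coeff j)).coeff i := by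
  simp [sig]

theorem sig_apply (f : MvPolynomial (Fin (d + 2)) k) : sig k d f =
    map (MvPolynomial.finSuccEquiv k d).toRingEquiv.toRingHom (MvPolynomial.finSuccEquiv k (d + 1) f) := rfl

theorem sig_X0 : sig k d (MvPolynomial.X 0) = X := by
  rw [sig_apply, MvPolynomial.finSuccEquiv_X_zero, map_X]

theorem sig_Xs (i : Fin (d + 1)) : sig k d (MvPolynomial.X i.succ) =
    C (MvPolynomial.finSuccEquiv k d (MvPolynomial.X i)) := by
  rw [sig_apply, MvPolynomial.finSuccEquiv_X_succ, map_C]; rfl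

theorem sig_X1 : sig k d (MvPolynomial.X 1) = C X := by
  have : (1 : Fin (d + 2)) = Fin.succ 0 := rfl
  rw [this, sig_Xs, MvPolynomial.finSuccEquiv_X_zero]

theorem sig_iot (a : MvPolynomial (Fin d) k) : sig k d (iot k d a) = C (C a) := by
  have : (sig k d : _ →+* (MvPolynomial (Fin d) k)[X][X]).comp (iot k d).toRingHom =
      (C : (MvPolynomial (Fin d) k)[X] →+* _).comp C := by
    apply MvPolynomial.ringHom_ext
    · intro r; simp [sig, iot, MvPolynomial.finSuccEquiv_apply]
    · intro i
      show sig k d (MvPolynomial.rename _ (MvPolynomial.X i)) = C (C (MvPolynomial.X i))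
      rw [MvPolynomial.rename_X, sig_Xs, MvPolynomial.finSuccEquiv_X_succ]
  exact congrArg (fun f : MvPolynomial (Fin d) k →+* _ => f a) this

theorem sig_cubic {f : MvPolynomial (Fin (d + 2)) k} (hf : f.IsHomogeneous 3) : Cubic (sig k d f) := by
  constructor
  · intro i j hij
    rw [sig_coeff]
    have h1 := hf.finSuccEquiv_coeff_isHomogeneous j (3 - j) (by omega)
    exact h1.finSuccEquiv_coeff_isHomogeneous i (3 - (i + j)) (by omega)
  · intro i j hij
    rw [sig_coeff]
    by_cases hj : j ≤ 3
    · have h1 := hf.finSuccEquiv_coeff_isHomogeneous j (3 - j) (by omega)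
      exact coeff_eq_zero_of_natDegree_lt (lt_of_le_of_lt (fse_natDegree_le h1) (by omega))
    · rw [coeff_eq_zero_of_natDegree_lt (lt_of_le_of_lt (fse_natDegree_le hf) (by omega))]
      simp
end lin

section fr
open TensorProduct
theorem finrank_tens {A W : Type} [CommRing A] [IsDomain A] [CommRing W] [Algebra A W] (m : ℕ)
    (h : ∀ (r : ℕ) (w : Fin r → W), LinearIndependent A w → r ≤ m) :
    Module.finrank (FractionRing A) (FractionRing A ⊗[A] W) ≤ m := by
  by_contra hlt
  push Not at hlt
  obtain ⟨b, hb⟩ := exists_linearIndependent_of_le_finrank (R := FractionRing A)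
    (M := FractionRing A ⊗[A] W) hlt
  have hbA : LinearIndependent A b :=
    (LinearIndependent.iff_fractionRing (R := A) (K := FractionRing A)).2 hb
  choose a ha w hw using fun i => tens_surj (b i)
  have hw2 : LinearIndependent A w := by
    rw [Fintype.linearIndependent_iff] at hbA ⊢
    intro g hg i
    have h1 : ∑ i, (g i * a i) • b i = 0 := by
      have h2 : (1 : FractionRing A) ⊗ₜ[A] (∑ i, g i • w i) = 0 := by rw [hg, TensorProduct.tmul_zero]
      rw [TensorProduct.tmul_sum] at h2
      rw [← h2]
      apply Finset.sum_congr rfl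
      intro i _
      rw [mul_smul, hw, TensorProduct.tmul_smul]
    have := hbA (fun i => g i * a i) h1 i
    exact (mul_eq_zero.1 this).resolve_right (ha i)
  have := h _ w hw2
  omega
end fr
end S8
end

section
namespace S8
section coord
variable {k : Type} [Field k] {d : ℕ}
open Polynomial CategoryTheory

theorem sig_symm_CC (a : MvPolynomial (Fin d) k) : (sig k d).symm (C (C a)) = iot k d a := by
  rw [RingEquiv.symm_apply_eq, sig_iot]

theorem sig_aev {W : Type} [CommRing W] [Algebra (MvPolynomial (Fin d) k) W]
    (π : MvPolynomial (Fin (d + 2)) k →+* W) (hA : ∀ a, algebraMap _ W a = π (iot k d a))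
    (P : (MvPolynomial (Fin d) k)[X][X]) :
    aevalAeval (π (MvPolynomial.X 1)) (π (MvPolynomial.X 0)) P = π ((sig k d).symm P) := by
  have : (aevalAeval (π (MvPolynomial.X 1)) (π (MvPolynomial.X 0)) :
      (MvPolynomial (Fin d) k)[X][X] →ₐ[_] W).toRingHom = π.comp (sig k d).symm.toRingHom := by
    apply Polynomial.ringHom_ext'
    · apply Polynomial.ringHom_ext'
      · apply RingHom.ext; intro a
        show aevalAeval (π (MvPolynomial.X 1)) (π (MvPolynomial.X 0)) (C (C a)) = π ((sig k d).symm (C (C a)))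
        rw [sig_symm_CC, aevalAeval_C, aeval_C, hA]
      · show aevalAeval (π (MvPolynomial.X 1)) (π (MvPolynomial.X 0)) (C X) = π ((sig k d).symm (C X))
        rw [aevalAeval_X, ← sig_X1, RingEquiv.symm_apply_apply]
    · show aevalAeval (π (MvPolynomial.X 1)) (π (MvPolynomial.X 0)) X = π ((sig k d).symm X)
      rw [aevalAeval_Y, ← sig_X0, RingEquiv.symm_apply_apply]
  exact congrArg (fun f : (MvPolynomial (Fin d) k)[X][X] →+* _ => f P) this

theorem coord_linH {J : Ideal (MvPolynomial (Fin (d + 2)) k)} (hJ : HomId J)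
    {W : Type} [CommRing W] [Algebra (MvPolynomial (Fin d) k) W]
    (π : MvPolynomial (Fin (d + 2)) k →+* W) (hker : ∀ p, π p = 0 ↔ p ∈ J)
    (hA : ∀ a, algebraMap _ W a = π (iot k d a))
    (hintg : Algebra.IsIntegral (MvPolynomial (Fin d) k) W) :
    LinH k d (π (MvPolynomial.X 1)) (π (MvPolynomial.X 0)) := by
  intro a b l hl
  have hev : ∀ (p : (MvPolynomial (Fin d) k)[X]) (r : MvPolynomial (Fin (d + 2)) k),
      p.eval₂ (algebraMap (MvPolynomial (Fin d) k) W) (π r) = π (p.eval₂ (iot k d).toRingHom r) := by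
    intro p r
    rw [hom_eval₂]
    congr 1
    exact RingHom.ext hA
  have e : algebraMap (MvPolynomial (Fin d) k) W (MvPolynomial.C a) * π (MvPolynomial.X 1) +
      algebraMap (MvPolynomial (Fin d) k) W (MvPolynomial.C b) * π (MvPolynomial.X 0) +
      algebraMap (MvPolynomial (Fin d) k) W l = π (iot k d (MvPolynomial.C a) * MvPolynomial.X 1 +
        iot k d (MvPolynomial.C b) * MvPolynomial.X 0 + iot k d l) := by
    rw [hA, hA, hA, map_add, map_add, map_mul, map_mul]
  rw [e]
  have hℓ : (iot k d (MvPolynomial.C a) * MvPolynomial.X 1 +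
        iot k d (MvPolynomial.C b) * MvPolynomial.X 0 + iot k d l).IsHomogeneous 1 := by
    refine MvPolynomial.IsHomogeneous.add (MvPolynomial.IsHomogeneous.add ?_ ?_) (iot_hom hl)
    · have := (iot_hom (MvPolynomial.isHomogeneous_C (Fin d) a)).mul
        (MvPolynomial.isHomogeneous_X k (1 : Fin (d + 2)))
      simpa using this
    · have := (iot_hom (MvPolynomial.isHomogeneous_C (Fin d) b)).mul
        (MvPolynomial.isHomogeneous_X k (0 : Fin (d + 2)))
      simpa using this
  generalize iot k d (MvPolynomial.C a) * MvPolynomial.X 1 +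
        iot k d (MvPolynomial.C b) * MvPolynomial.X 0 + iot k d l = ℓ at hℓ
  obtain ⟨p, hp, h0⟩ := hintg.isIntegral (π ℓ)
  rw [hev, hker] at h0
  obtain ⟨H, h1, h2, h3⟩ := lin_core hJ hℓ hp h0
  exact ⟨H, h1, h2, by rw [hev, hker]; exact h3⟩

theorem coord_W [IsAlgClosed k] {f g h : MvPolynomial (Fin (d + 2)) k}
    (hf : f.IsHomogeneous 3) (hg : g.IsHomogeneous 3) (hh : h.IsHomogeneous 3)
    {h' u : (MvPolynomial (Fin d) k)[X][X]} {δ : (MvPolynomial (Fin d) k)[X]}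
    (D : DualData (sig k d f) (sig k d g) h' u δ)
    {W : Type} [CommRing W] [Algebra (MvPolynomial (Fin d) k) W]
    (π : MvPolynomial (Fin (d + 2)) k →+* W) (hπ : Function.Surjective π)
    (hker : ∀ p, π p = 0 ↔ p ∈ Ideal.span {f, g, h})
    (hA : ∀ a, algebraMap _ W a = π (iot k d a))
    (hr : ∀ (r : ℕ) (w : Fin r → MvPolynomial (Fin (d + 2)) k),
      (∀ c : Fin r → MvPolynomial (Fin d) k, ∑ i, iot k d (c i) * w i ∈ Ideal.span {f, g, h} → c = 0) → r ≤ 3) :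
    pdLE (MvPolynomial (Fin (d + 2)) k) (MvPolynomial (Fin (d + 2)) k ⧸ Ideal.span {f, g, h}) 4 := by
  apply final_generic (sig k d) f g h D π hπ hker (fun a => by rw [sig_symm_CC, hA])
  have hz : ∀ p ∈ Ideal.span {f, g, h}, aevalAeval (π (MvPolynomial.X 1)) (π (MvPolynomial.X 0)) (sig k d p) = 0 := by
    intro p hp
    rw [sig_aev π hA, RingEquiv.symm_apply_apply, hker]; exact hp
  have hfm : f ∈ Ideal.span {f, g, h} := Ideal.subset_span (by simp)
  have hgm : g ∈ Ideal.span {f, g, h} := Ideal.subset_span (by simp)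
  have hhm : h ∈ Ideal.span {f, g, h} := Ideal.subset_span (by simp)
  have hsurj : Function.Surjective (aevalAeval (π (MvPolynomial.X 1)) (π (MvPolynomial.X 0)) :
      (MvPolynomial (Fin d) k)[X][X] →ₐ[_] W) := by
    intro w
    obtain ⟨r, rfl⟩ := hπ w
    exact ⟨sig k d r, by rw [sig_aev π hA, RingEquiv.symm_apply_apply]⟩
  have hδ : aeval (π (MvPolynomial.X 1)) δ = 0 := by
    have h1 : aevalAeval (π (MvPolynomial.X 1)) (π (MvPolynomial.X 0)) (C δ) = 0 := by
      rw [D.rel, map_add, map_mul, map_mul, hz f hfm, hz g hgm, mul_zero, mul_zero, add_zero]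
    rwa [aevalAeval_C] at h1
  have hintg := integral_abs _ _ (surj_adjoin _ _ hsurj) D.hf (hz f hfm) D.hδ hδ
  refine core_proj D (sig_cubic hf) (sig_cubic hg) (sig_cubic hh) _ _ hsurj (hz f hfm) (hz g hgm)
    (hz h hhm) ?_ (coord_linH (homId_span f g h hf hg hh) π hker hA hintg) ?_
  · intro P hP
    rw [sig_aev π hA, hker, Ideal.mem_span_insert] at hP
    obtain ⟨a, z, hz, e⟩ := hP
    rw [Ideal.mem_span_pair] at hz
    obtain ⟨b, c, rfl⟩ := hz
    refine ⟨sig k d a, sig k d b, sig k d c, ?_⟩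
    rw [RingEquiv.symm_apply_eq] at e
    rw [e, map_add, map_add, map_mul, map_mul, map_mul, add_assoc]
  · apply finrank_tens
    intro r w hw
    choose v hv using fun i => hπ (w i)
    apply hr r v
    intro c hc
    rw [Fintype.linearIndependent_iff] at hw
    funext i
    apply hw c
    rw [← hker, map_sum] at hc
    rw [← hc]
    apply Finset.sum_congr rfl
    intro i _
    rw [map_mul, hv, ← hA, Algebra.smul_def]

theorem coord_final [IsAlgClosed k] {f g h : MvPolynomial (Fin (d + 2)) k}
    (hf : f.IsHomogeneous 3) (hg : g.IsHomogeneous 3) (hh : h.IsHomogeneous 3)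
    {h' u : (MvPolynomial (Fin d) k)[X][X]} {δ : (MvPolynomial (Fin d) k)[X]}
    (D : DualData (sig k d f) (sig k d g) h' u δ)
    (hr : ∀ (r : ℕ) (w : Fin r → MvPolynomial (Fin (d + 2)) k),
      (∀ c : Fin r → MvPolynomial (Fin d) k, ∑ i, iot k d (c i) * w i ∈ Ideal.span {f, g, h} → c = 0) → r ≤ 3) :
    pdLE (MvPolynomial (Fin (d + 2)) k) (MvPolynomial (Fin (d + 2)) k ⧸ Ideal.span {f, g, h}) 4 := by
  letI : Algebra (MvPolynomial (Fin d) k) (MvPolynomial (Fin (d + 2)) k ⧸ Ideal.span {f, g, h}) :=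
    ((Ideal.Quotient.mk _).comp (iot k d).toRingHom).toAlgebra
  exact coord_W hf hg hh D (Ideal.Quotient.mk (Ideal.span {f, g, h})) Ideal.Quotient.mk_surjective
    (fun p => Ideal.Quotient.eq_zero_iff_mem) (fun a => rfl) hr
end coord
end S8
end

section
namespace S8
section rankbound
variable {k : Type} [Field k] {d : ℕ}

theorem finrank_rtd (d D : ℕ) :
    (D + 1) ^ d ≤ d.factorial * Module.finrank k (MvPolynomial.restrictTotalDegree (Fin d) k D) := by
  have h1 : Module.finrank k (MvPolynomial.restrictTotalDegree (Fin d) k D) =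
      Nat.card {n : Fin d →₀ ℕ | (n.sum fun _ e => e) ≤ D} :=
    Module.finrank_eq_nat_card_basis (MvPolynomial.basisRestrictSupport k _)
  have hfin : Finite {n : Fin d →₀ ℕ | (n.sum fun _ e => e) ≤ D} :=
    Module.Finite.finite_basis (R := k) (M := MvPolynomial.restrictTotalDegree (Fin d) k D)
      (MvPolynomial.basisRestrictSupport k _)
  have h2 : (D + d).choose d ≤ Nat.card {n : Fin d →₀ ℕ | (n.sum fun _ e => e) ≤ D} := by
    have hc := Finset.card_finsuppAntidiag_nat_eq_choose (s := (Finset.univ : Finset (Fin (d+1)))) D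
    rw [Finset.card_univ, Fintype.card_fin] at hc
    have e1 : (d + 1 + D - 1).choose D = (D + d).choose d := by
      rw [show d + 1 + D - 1 = D + d by omega]
      exact Nat.choose_symm_add
    rw [← e1, ← hc, ← Nat.card_eq_finsetCard]
    have key : ∀ x : Fin (d+1) →₀ ℕ, x ∈ Finset.finsuppAntidiag Finset.univ D →
        x 0 + (x.tail.sum fun _ e => e) = D := by
      intro x hx
      rw [Finset.mem_finsuppAntidiag] at hx
      rw [← hx.1, Fin.sum_univ_succ, Finsupp.sum_fintype _ _ (fun _ => rfl)]
      rfl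
    refine Nat.card_le_card_of_injective
      (fun x : (Finset.finsuppAntidiag (Finset.univ : Finset (Fin (d+1))) D) =>
        (⟨x.1.tail, by have := key x.1 x.2; simp only [Set.mem_setOf_eq]; omega⟩ :
          {n : Fin d →₀ ℕ | (n.sum fun _ e => e) ≤ D})) ?_
    intro x y hxy
    have ht : x.1.tail = y.1.tail := congrArg Subtype.val hxy
    have hx := key x.1 x.2
    have hy := key y.1 y.2
    rw [ht] at hx
    apply Subtype.ext
    rw [← Finsupp.cons_tail x.1, ← Finsupp.cons_tail y.1, ht]
    congr 1
    omega
  rw [h1]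
  calc (D+1)^d ≤ (D+1).ascFactorial d := Nat.pow_succ_le_ascFactorial (D+1) d
    _ = d.factorial * (D + d).choose d := Nat.ascFactorial_eq_factorial_mul_choose _ _
    _ ≤ _ := Nat.mul_le_mul_left _ h2

theorem mem_of_low {N : ℕ} {J : Ideal (MvPolynomial (Fin N) k)} (hJ : HomId J) {n : ℕ}
    {p : MvPolynomial (Fin N) k} (hp : p.totalDegree < n)
    (h : p ∈ J ⊔ (Ideal.span (Set.range (MvPolynomial.X : Fin N → MvPolynomial (Fin N) k))) ^ n) :
    p ∈ J := by
  obtain ⟨j, hj, m, hm, rfl⟩ := Submodule.mem_sup.1 h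
  have hm' := (MvPolynomial.mem_pow_idealOfVars_iff' n m).1 hm
  rw [← MvPolynomial.sum_homogeneousComponent (j + m)]
  refine Ideal.sum_mem _ fun i hi => ?_
  have hi' : i < n := by
    have := Finset.mem_range.1 hi
    omega
  have : MvPolynomial.homogeneousComponent i m = 0 := by
    ext x
    rw [MvPolynomial.coeff_homogeneousComponent]
    split_ifs with hx
    · rw [hm' x (by omega)]; simp
    · simp
  rw [map_add, this, add_zero]
  exact hJ j hj i

theorem fin_quot {N : ℕ} (J : Ideal (MvPolynomial (Fin N) k)) (n : ℕ) :
    Module.Finite k (MvPolynomial (Fin N) k ⧸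
      (J ⊔ (Ideal.span (Set.range (MvPolynomial.X : Fin N → MvPolynomial (Fin N) k))) ^ n)) := by
  set K := (J ⊔ (Ideal.span (Set.range (MvPolynomial.X : Fin N → MvPolynomial (Fin N) k))) ^ n)
  let φ : MvPolynomial.restrictTotalDegree (Fin N) k n →ₗ[k] (MvPolynomial (Fin N) k ⧸ K) :=
    (Ideal.Quotient.mkₐ k K).toLinearMap.comp (Submodule.subtype _)
  refine Module.Finite.of_surjective φ ?_
  intro y
  obtain ⟨p, rfl⟩ := Ideal.Quotient.mk_surjective y
  let q := ∑ i ∈ Finset.range n, MvPolynomial.homogeneousComponent i p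
  have hq : q.totalDegree ≤ n := by
    refine (MvPolynomial.totalDegree_finsetSum_le fun i hi => ?_)
    refine (MvPolynomial.homogeneousComponent_isHomogeneous i p).totalDegree_le.trans ?_
    exact (Finset.mem_range.1 hi).le
  refine ⟨⟨q, (MvPolynomial.mem_restrictTotalDegree _ _ _).2 hq⟩, ?_⟩
  show Ideal.Quotient.mk K q = Ideal.Quotient.mk K p
  rw [Ideal.Quotient.eq]
  refine Ideal.mem_sup_right ?_
  refine (MvPolynomial.mem_pow_idealOfVars_iff' n _).2 fun x hx => ?_
  rw [MvPolynomial.coeff_sub, MvPolynomial.coeff_sum, sub_eq_zero]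
  simp only [MvPolynomial.coeff_homogeneousComponent]
  rw [Finset.sum_ite_eq]
  simp [hx]

theorem rank_ineq {J : Ideal (MvPolynomial (Fin (d+2)) k)} (hJ : HomId J) {r : ℕ}
    (w : Fin r → MvPolynomial (Fin (d + 2)) k)
    (hw : ∀ c : Fin r → MvPolynomial (Fin d) k, ∑ i, iot k d (c i) * w i ∈ J → c = 0) :
    ∃ c : ℕ, ∀ n, c < n → r * (n - c) ^ d ≤ d.factorial * Module.finrank k
      (MvPolynomial (Fin (d+2)) k ⧸
      (J ⊔ (Ideal.span (Set.range (MvPolynomial.X : Fin (d+2) → MvPolynomial (Fin (d+2)) k))) ^ n)) := by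
  refine ⟨Finset.univ.sup fun i => (w i).totalDegree, fun n hn => ?_⟩
  set c := Finset.univ.sup fun i => (w i).totalDegree with hc
  set K := (J ⊔ (Ideal.span (Set.range (MvPolynomial.X : Fin (d+2) → MvPolynomial (Fin (d+2)) k))) ^ n)
    with hK
  have hfin : Module.Finite k (MvPolynomial (Fin (d+2)) k ⧸ K) := fin_quot J n
  let φ : (Fin r → MvPolynomial.restrictTotalDegree (Fin d) k (n - 1 - c)) →ₗ[k]
      (MvPolynomial (Fin (d+2)) k ⧸ K) :=
    (Ideal.Quotient.mkₐ k K).toLinearMap.comp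
      (∑ i, (LinearMap.mulRight k (w i)).comp ((iot k d).toLinearMap.comp
        ((Submodule.subtype _).comp (LinearMap.proj i))))
  have hφ : ∀ a, φ a = Ideal.Quotient.mk K (∑ i, iot k d (a i).1 * w i) := by
    intro a
    simp [φ, LinearMap.sum_apply]
  have hinj : Function.Injective φ := by
    rw [injective_iff_map_eq_zero]
    intro a ha
    rw [hφ, Ideal.Quotient.eq_zero_iff_mem] at ha
    have hdeg : (∑ i, iot k d (a i).1 * w i).totalDegree < n := by
      refine lt_of_le_of_lt (MvPolynomial.totalDegree_finsetSum_le (d := n - 1) fun i _ => ?_) (by omega)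
      have h1 : (iot k d (a i).1).totalDegree ≤ n - 1 - c :=
        (MvPolynomial.totalDegree_rename_le _ _).trans
          ((MvPolynomial.mem_restrictTotalDegree _ _ _).1 (a i).2)
      have h2 : (w i).totalDegree ≤ c := Finset.le_sup (f := fun i => (w i).totalDegree) (Finset.mem_univ i)
      have := MvPolynomial.totalDegree_mul (iot k d (a i).1) (w i)
      omega
    have h0 := hw (fun i => (a i).1) (mem_of_low hJ hdeg ha)
    funext i
    exact Subtype.ext (congrFun h0 i)
  have hle := LinearMap.finrank_le_finrank_of_injective hinj
  rw [Module.finrank_pi_fintype, Finset.sum_const, Finset.card_univ, Fintype.card_fin, smul_eq_mul] at hle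
  have h3 := finrank_rtd (k := k) d (n - 1 - c)
  rw [show n - 1 - c + 1 = n - c by omega] at h3
  calc r * (n-c)^d ≤ r * (d.factorial * _) := Nat.mul_le_mul_left _ h3
    _ = d.factorial * (r * _) := by ring
    _ ≤ _ := Nat.mul_le_mul_left _ hle

theorem rank_le {J : Ideal (MvPolynomial (Fin (d+2)) k)} (hJ : HomId J) {e : ℕ}
    (he : Filter.Tendsto (fun n : ℕ => (Nat.factorial d : ℝ) * (Module.finrank k
      (MvPolynomial (Fin (d+2)) k ⧸
      (J ⊔ (Ideal.span (Set.range (MvPolynomial.X : Fin (d+2) → MvPolynomial (Fin (d+2)) k))) ^ n)) : ℝ)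
        / (n : ℝ) ^ d) Filter.atTop (nhds (e : ℝ)))
    (r : ℕ) (w : Fin r → MvPolynomial (Fin (d + 2)) k)
    (hw : ∀ c : Fin r → MvPolynomial (Fin d) k, ∑ i, iot k d (c i) * w i ∈ J → c = 0) : r ≤ e := by
  obtain ⟨c, hc⟩ := rank_ineq hJ w hw
  have h1 : Filter.Tendsto (fun n : ℕ => (r : ℝ) * (1 - (c : ℝ) / (n : ℝ)) ^ d) Filter.atTop
      (nhds ((r : ℝ) * (1 - 0) ^ d)) :=
    ((tendsto_const_nhds.sub (tendsto_const_div_atTop_nhds_zero_nat (c : ℝ))).pow d).const_mul _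
  have h2 : (r : ℝ) * (1 - 0) ^ d ≤ e := by
    refine le_of_tendsto_of_tendsto h1 he ?_
    filter_upwards [Filter.eventually_gt_atTop c] with n hn
    have hn0 : (0 : ℝ) < n := by exact_mod_cast (by omega : 0 < n)
    rw [le_div_iff₀ (by positivity), mul_assoc, ← mul_pow, sub_mul, one_mul, div_mul_cancel₀ _ hn0.ne']
    have := hc n hn
    have h4 : ((r * (n - c) ^ d : ℕ) : ℝ) ≤ _ := Nat.cast_le.2 this
    push_cast [Nat.cast_sub hn.le] at h4
    exact h4
  simp only [sub_zero, one_pow, mul_one] at h2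
  exact_mod_cast h2

end rankbound
end S8
end

section
namespace S8
section coprime

theorem relprime_of_height {R : Type} [CommRing R] [IsDomain R] [UniqueFactorizationMonoid R]
    (f g : R) (h : (⨅ p ∈ {p : {q : Ideal R // q.IsPrime} | Ideal.span {f, g} ≤ p.1}, Order.height p) = 2) :
    IsRelPrime f g := by
  intro c hcf hcg
  by_contra hc
  have key : ∀ p : {q : Ideal R // q.IsPrime}, Ideal.span {f, g} ≤ p.1 → 1 < Order.height p := by
    intro p hp
    have h1 : (2 : ℕ∞) ≤ Order.height p := h ▸ iInf₂_le p hp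
    exact lt_of_lt_of_le (by norm_num) h1
  have hbot : Order.height (⟨⊥, Ideal.isPrime_bot⟩ : {q : Ideal R // q.IsPrime}) = 0 := by
    rw [Order.height_eq_zero]
    intro b _
    exact bot_le (a := b.1)
  have hs : Ideal.span {f, g} ≤ Ideal.span {c} := by
    rw [Ideal.span_le]
    rintro x (rfl | rfl)
    · exact Ideal.mem_span_singleton.2 hcf
    · exact Ideal.mem_span_singleton.2 hcg
  by_cases hc0 : c = 0
  · subst hc0
    have := key ⟨⊥, Ideal.isPrime_bot⟩ (hs.trans (by simp))
    rw [hbot] at this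
    exact absurd this (by simp)
  · obtain ⟨π, hπ, hπc⟩ := WfDvdMonoid.exists_irreducible_factor hc hc0
    have hpp : Prime π := hπ.prime
    have hP : (Ideal.span {π}).IsPrime := (Ideal.span_singleton_prime hpp.ne_zero).2 hpp
    have h1 := key ⟨Ideal.span {π}, hP⟩ (hs.trans (Ideal.span_singleton_le_span_singleton.2 hπc))
    refine absurd h1 (not_lt.2 ?_)
    have : Order.height (⟨Ideal.span {π}, hP⟩ : {q : Ideal R // q.IsPrime}) ≤ ((1 : ℕ) : ℕ∞) := by
      rw [Order.height_le_coe_iff]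
      intro y hy
      have hy0 : y.1 = ⊥ := by
        by_contra hne
        obtain ⟨q, hq, hqp⟩ := Ideal.IsPrime.exists_mem_prime_of_ne_bot y.2 hne
        have hqπ : π ∣ q := Ideal.mem_span_singleton.1 (hy.le hq)
        have hass : Associated π q := (hπ.dvd_irreducible_iff_associated hqp.irreducible).1 hqπ
        refine absurd hy.le (fun _ => hy.not_ge ?_)
        show Ideal.span {π} ≤ y.1
        rw [Ideal.span_singleton_le_iff_mem]
        exact Ideal.mem_of_dvd _ hass.symm.dvd hq
      have : y = ⟨⊥, Ideal.isPrime_bot⟩ := Subtype.ext hy0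
      rw [this, hbot]
      norm_num
    exact this

theorem two_le {k : Type} [Field k] {N : ℕ} {f g : MvPolynomial (Fin N) k} {n : ℕ} (hn : n ≠ 0)
    (hf : f.IsHomogeneous n) (hg : g.IsHomogeneous n) (hfg : IsRelPrime f g) : 2 ≤ N := by
  match N with
  | 0 =>
    rw [hom_zero hn hf, hom_zero hn hg] at hfg
    exact absurd hfg not_isRelPrime_zero_zero
  | 1 =>
    have hX : ∀ p : MvPolynomial (Fin 1) k, p.IsHomogeneous n → (MvPolynomial.X 0) ∣ p := by
      intro p hp
      rw [hom_one hp]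
      exact Dvd.dvd.mul_left (dvd_pow_self _ hn) _
    have := hfg (hX f hf) (hX g hg)
    have h2 := this.map (MvPolynomial.eval (0 : Fin 1 → k))
    simp at h2
  | (N+2) => omega
end coprime

section transp
variable {k : Type} [Field k] {N : ℕ}

theorem lin_hom (Ψ : MvPolynomial (Fin N) k →ₐ[k] MvPolynomial (Fin N) k)
    (hΨ : ∀ i, (Ψ (MvPolynomial.X i)).IsHomogeneous 1) {p : MvPolynomial (Fin N) k} {n : ℕ}
    (hp : p.IsHomogeneous n) : (Ψ p).IsHomogeneous n := by
  have := hp.aeval (fun i => Ψ (MvPolynomial.X i)) hΨ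
  rw [one_mul] at this
  have e : MvPolynomial.aeval (fun i => Ψ (MvPolynomial.X i)) = Ψ := (MvPolynomial.aeval_unique Ψ).symm
  rwa [e] at this

theorem lin_mem (Ψ : MvPolynomial (Fin N) k →ₐ[k] MvPolynomial (Fin N) k)
    (hΨ : ∀ i, (Ψ (MvPolynomial.X i)).IsHomogeneous 1) :
    (Ideal.span (Set.range (MvPolynomial.X : Fin N → MvPolynomial (Fin N) k))).map Ψ ≤
      Ideal.span (Set.range (MvPolynomial.X : Fin N → MvPolynomial (Fin N) k)) := by
  rw [Ideal.map_span, Ideal.span_le]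
  rintro _ ⟨_, ⟨i, rfl⟩, rfl⟩
  have := (MvPolynomial.mem_pow_idealOfVars_iff' 1 (Ψ (MvPolynomial.X i))).2 (by
    intro x hx
    apply (hΨ i).coeff_eq_zero
    omega)
  rw [pow_one] at this
  exact this

theorem hs_transp (Ψ : MvPolynomial (Fin N) k ≃ₐ[k] MvPolynomial (Fin N) k)
    (hΨ : ∀ i, (Ψ (MvPolynomial.X i)).IsHomogeneous 1)
    (hΨ' : ∀ i, (Ψ.symm (MvPolynomial.X i)).IsHomogeneous 1) (J J' : Ideal (MvPolynomial (Fin N) k))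
    (hJ : J' = J.map Ψ.toAlgHom) (n : ℕ) :
    Module.finrank k (MvPolynomial (Fin N) k ⧸
      (J' ⊔ (Ideal.span (Set.range (MvPolynomial.X : Fin N → MvPolynomial (Fin N) k))) ^ n)) =
    Module.finrank k (MvPolynomial (Fin N) k ⧸
      (J ⊔ (Ideal.span (Set.range (MvPolynomial.X : Fin N → MvPolynomial (Fin N) k))) ^ n)) := by
  have hm : (Ideal.span (Set.range (MvPolynomial.X : Fin N → MvPolynomial (Fin N) k))).map Ψ.toAlgHom =
      Ideal.span (Set.range (MvPolynomial.X : Fin N → MvPolynomial (Fin N) k)) := by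
    apply le_antisymm (lin_mem Ψ.toAlgHom hΨ)
    intro x hx
    have h1 := lin_mem Ψ.symm.toAlgHom hΨ' (Ideal.mem_map_of_mem Ψ.symm.toAlgHom hx)
    have h2 := Ideal.mem_map_of_mem Ψ.toAlgHom h1
    have e : Ψ.toAlgHom (Ψ.symm.toAlgHom x) = x := Ψ.apply_symm_apply x
    rwa [e] at h2
  refine (LinearEquiv.finrank_eq (Ideal.quotientEquivAlg _ _ Ψ ?_).toLinearEquiv).symm
  show _ = Ideal.map Ψ.toAlgHom _
  rw [Ideal.map_sup, Ideal.map_pow, hm, hJ]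
end transp
end S8
end

section
namespace S8
section elim
open Polynomial

theorem elim {A : Type} [CommRing A] [IsDomain A] [UniqueFactorizationMonoid A] {f g : A[X]}
    (hf : f.Monic) (hfg : IsRelPrime f g) : ∃ δ : A, δ ≠ 0 ∧ C δ ∈ Ideal.span {f, g} := by
  have hfin : Module.Finite A (AdjoinRoot f) := hf.finite_adjoinRoot
  obtain ⟨p, hp, hp0⟩ := Algebra.IsIntegral.isIntegral (R := A) (AdjoinRoot.mk f g)
  obtain ⟨i, hi, hmem⟩ := Ideal.exists_coeff_ne_zero_mem_comap_of_non_zero_divisor_root_mem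
    (f := algebraMap A (AdjoinRoot f)) (I := Ideal.span {AdjoinRoot.mk f g})
    (r := AdjoinRoot.mk f g) (by
      intro x hx
      obtain ⟨a, rfl⟩ := AdjoinRoot.mk_surjective x
      rw [← map_mul, AdjoinRoot.mk_eq_zero] at hx
      rw [AdjoinRoot.mk_eq_zero]
      exact hfg.dvd_of_dvd_mul_right hx)
    (Ideal.mem_span_singleton_self _) hp.ne_zero hp0
  refine ⟨p.coeff i, hi, ?_⟩
  rw [Ideal.mem_comap, Ideal.mem_span_singleton] at hmem
  obtain ⟨b, hb⟩ := hmem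
  obtain ⟨b, rfl⟩ := AdjoinRoot.mk_surjective b
  have h2 : AdjoinRoot.mk f (C (p.coeff i)) = AdjoinRoot.mk f (g * b) := by
    rw [map_mul, ← hb]; rfl
  rw [AdjoinRoot.mk_eq_mk] at h2
  obtain ⟨q, hq⟩ := h2
  rw [Ideal.mem_span_pair]
  exact ⟨q, b, by linear_combination -hq⟩
end elim

section lead
open Polynomial
variable {k : Type} [Field k] {d : ℕ}

theorem hom_eval_zero {m n : ℕ} {p : MvPolynomial (Fin m) k} (hp : p.IsHomogeneous n) (hn : n ≠ 0) :
    MvPolynomial.eval 0 p = 0 := by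
  have h := congrFun (MvPolynomial.constantCoeff_eq (R := k) (σ := Fin m)) p
  rw [hp.coeff_eq_zero (by simpa using hn.symm)] at h
  rw [← h]
  rw [MvPolynomial.eval_zero]

theorem lead_coeff {n : ℕ} {p : MvPolynomial (Fin (d+1)) k} (hp : p.IsHomogeneous n) :
    (MvPolynomial.finSuccEquiv k d p).coeff n =
      MvPolynomial.C (MvPolynomial.eval (Pi.single 0 1) p) := by
  have h0 := hp.finSuccEquiv_coeff_isHomogeneous n 0 (by simp)
  have h1 : (MvPolynomial.finSuccEquiv k d p).coeff n =
      MvPolynomial.C (MvPolynomial.coeff 0 ((MvPolynomial.finSuccEquiv k d p).coeff n)) :=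
    MvPolynomial.totalDegree_eq_zero_iff_eq_C.1 (Nat.le_zero.1 h0.totalDegree_le)
  have e : (Pi.single 0 1 : Fin (d+1) → k) = Fin.cons 1 0 := by
    funext i
    refine Fin.cases ?_ (fun j => ?_) i
    · simp
    · simp [Pi.single_apply, Fin.succ_ne_zero]
  rw [e, MvPolynomial.eval_eq_eval_mv_eval']
  have hd : (Polynomial.map (MvPolynomial.eval (0 : Fin d → k)) (MvPolynomial.finSuccEquiv k d p)).natDegree < n + 1 :=
    Nat.lt_succ_of_le (natDegree_map_le.trans (fse_natDegree_le hp))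
  rw [Polynomial.eval_eq_sum_range' hd, Finset.sum_range_succ, Finset.sum_eq_zero, zero_add]
  · rw [one_pow, mul_one, coeff_map]
    rw [h1]
    simp
  · intro i hi
    have hi := Finset.mem_range.1 hi
    rw [coeff_map, hom_eval_zero (hp.finSuccEquiv_coeff_isHomogeneous i (n - i) (by omega)) (by omega),
      zero_mul]

theorem make_lead [Infinite k] {n : ℕ} (hn : n ≠ 0) {p : MvPolynomial (Fin (d+1)) k}
    (hp : p.IsHomogeneous n) (h0 : p ≠ 0) :
    ∃ (e : (Fin (d+1) → k) ≃ₗ[k] (Fin (d+1) → k)) (c : k), c ≠ 0 ∧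
      (MvPolynomial.C c⁻¹ * linSub e p).IsHomogeneous n ∧
      (MvPolynomial.finSuccEquiv k d (MvPolynomial.C c⁻¹ * linSub e p)).Monic ∧
      (MvPolynomial.finSuccEquiv k d (MvPolynomial.C c⁻¹ * linSub e p)).natDegree = n := by
  obtain ⟨y, hy⟩ : ∃ y, MvPolynomial.eval y p ≠ 0 := by
    by_contra hcon
    push Not at hcon
    exact h0 (MvPolynomial.funext fun x => by rw [hcon x, map_zero])
  have hy0 : y ≠ 0 := by
    rintro rfl
    exact hy (hom_eval_zero hp hn)
  obtain ⟨e, he⟩ := exists_linEquiv y hy0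
  have hh : (MvPolynomial.C (MvPolynomial.eval y p)⁻¹ * linSub e p).IsHomogeneous n := by
    have := (MvPolynomial.isHomogeneous_C (Fin (d+1)) (MvPolynomial.eval y p)⁻¹).mul (linSub_hom e hp)
    rwa [zero_add] at this
  have hc := lead_coeff hh
  rw [map_mul (MvPolynomial.eval _), MvPolynomial.eval_C, eval_linSub, he, inv_mul_cancel₀ hy, map_one] at hc
  have hle := fse_natDegree_le hh
  refine ⟨e, _, hy, hh, monic_of_natDegree_le_of_coeff_eq_one n hle hc, ?_⟩
  exact le_antisymm hle (le_natDegree_of_ne_zero (by rw [hc]; exact one_ne_zero))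

end lead
end S8
end

section
namespace S8
section asm
open Polynomial
variable {k : Type} [Field k] {d : ℕ}

/-- the hypothesis on the Hilbert-Samuel function -/
def HSlim {N : ℕ} (d e : ℕ) (J : Ideal (MvPolynomial (Fin N) k)) : Prop :=
  Filter.Tendsto (fun n : ℕ => (Nat.factorial d : ℝ) * (Module.finrank k
      (MvPolynomial (Fin N) k ⧸
      (J ⊔ (Ideal.span (Set.range (MvPolynomial.X : Fin N → MvPolynomial (Fin N) k))) ^ n)) : ℝ)
        / (n : ℝ) ^ d) Filter.atTop (nhds (e : ℝ))

theorem map_span3 {R S F : Type} [CommRing R] [CommRing S] [FunLike F R S] [RingHomClass F R S] (φ : F) (f g h : R) :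
    Ideal.span {φ f, φ g, φ h} = (Ideal.span {f, g, h}).map φ := by
  rw [Ideal.map_span, Set.image_insert_eq, Set.image_insert_eq, Set.image_singleton]

theorem transp_gen {R R' : Type} [CommRing R] [CommRing R'] (e : R ≃+* R') (f g h : R) (n : ℕ)
    (H : pdLE R' (R' ⧸ Ideal.span {e f, e g, e h}) n) : pdLE R (R ⧸ Ideal.span {f, g, h}) n :=
  pdLE_of_ringEquiv e _ (Ideal.span {e f, e g, e h}) (map_span3 (e : R →+* R') f g h) n H

theorem transp {N : ℕ} (Ψ : MvPolynomial (Fin N) k ≃ₐ[k] MvPolynomial (Fin N) k)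
    (f g h : MvPolynomial (Fin N) k) (n : ℕ)
    (H : pdLE (MvPolynomial (Fin N) k) (MvPolynomial (Fin N) k ⧸ Ideal.span {Ψ f, Ψ g, Ψ h}) n) :
    pdLE (MvPolynomial (Fin N) k) (MvPolynomial (Fin N) k ⧸ Ideal.span {f, g, h}) n :=
  transp_gen Ψ.toRingEquiv f g h n H

theorem HSlim_transp {N : ℕ} (Ψ : MvPolynomial (Fin N) k ≃ₐ[k] MvPolynomial (Fin N) k)
    (hΨ : ∀ i, (Ψ (MvPolynomial.X i)).IsHomogeneous 1)
    (hΨ' : ∀ i, (Ψ.symm (MvPolynomial.X i)).IsHomogeneous 1)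
    (f g h : MvPolynomial (Fin N) k) (d e : ℕ) (H : HSlim d e (Ideal.span {f, g, h})) :
    HSlim d e (Ideal.span {Ψ f, Ψ g, Ψ h}) := by
  unfold HSlim at *
  have hsp : Ideal.span {Ψ f, Ψ g, Ψ h} = (Ideal.span {f, g, h}).map Ψ.toAlgHom :=
    map_span3 Ψ.toAlgHom f g h
  have hh := fun n => hs_transp Ψ hΨ hΨ' _ _ hsp n
  refine H.congr fun n => ?_
  rw [hh n]

theorem relprime_equiv {R S : Type} [CommRing R] [CommRing S] (e : R ≃+* S) {f g : R}
    (h : IsRelPrime f g) : IsRelPrime (e f) (e g) := by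
  intro c hcf hcg
  have h1 := h (d := e.symm c) (by simpa using map_dvd e.symm hcf) (by simpa using map_dvd e.symm hcg)
  simpa using h1.map e

theorem stepB [IsAlgClosed k] {f g h : MvPolynomial (Fin (d + 2)) k}
    (hf : f.IsHomogeneous 3) (hg : g.IsHomogeneous 3) (hh : h.IsHomogeneous 3)
    (hs : HSlim d 3 (Ideal.span {f, g, h}))
    (hfm : (MvPolynomial.finSuccEquiv k (d+1) f).Monic)
    (hfd : (MvPolynomial.finSuccEquiv k (d+1) f).natDegree = 3)
    {δ : MvPolynomial (Fin (d+1)) k} (hδ : (MvPolynomial.finSuccEquiv k d δ).Monic)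
    (hδd : 1 ≤ (MvPolynomial.finSuccEquiv k d δ).natDegree)
    {u h' : (MvPolynomial (Fin (d+1)) k)[X]}
    (hmem : u * MvPolynomial.finSuccEquiv k (d+1) f + h' * MvPolynomial.finSuccEquiv k (d+1) g = C δ) :
    pdLE (MvPolynomial (Fin (d + 2)) k) (MvPolynomial (Fin (d + 2)) k ⧸ Ideal.span {f, g, h}) 4 := by
  let ρ := (MvPolynomial.finSuccEquiv k d).toRingEquiv.toRingHom
  have D : DualData (sig k d f) (sig k d g) (h'.map ρ) (u.map ρ) (MvPolynomial.finSuccEquiv k d δ) := by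
    refine ⟨?_, ?_, hδ, hδd, ?_⟩
    · rw [sig_apply]; exact hfm.map _
    · rw [sig_apply, hfm.natDegree_map, hfd]; norm_num
    · rw [sig_apply, sig_apply, ← Polynomial.map_mul, ← Polynomial.map_mul, ← Polynomial.map_add, hmem,
        Polynomial.map_C]
      rfl
  exact coord_final hf hg hh D (rank_le (homId_span f g h hf hg hh) hs)

/-- extending an automorphism -/
noncomputable def extA (φ : MvPolynomial (Fin d) k ≃ₐ[k] MvPolynomial (Fin d) k) :
    MvPolynomial (Fin (d+1)) k ≃ₐ[k] MvPolynomial (Fin (d+1)) k :=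
  ((MvPolynomial.finSuccEquiv k d).trans (Polynomial.mapAlgEquiv φ)).trans
    (MvPolynomial.finSuccEquiv k d).symm

theorem extA_fse (φ : MvPolynomial (Fin d) k ≃ₐ[k] MvPolynomial (Fin d) k) (p) :
    MvPolynomial.finSuccEquiv k d (extA φ p) =
      (MvPolynomial.finSuccEquiv k d p).map (φ : MvPolynomial (Fin d) k →+* MvPolynomial (Fin d) k) := by
  simp [extA]

theorem extA_X (φ : MvPolynomial (Fin d) k ≃ₐ[k] MvPolynomial (Fin d) k)
    (hφ : ∀ i, (φ (MvPolynomial.X i)).IsHomogeneous 1) (i) :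
    (extA φ (MvPolynomial.X i)).IsHomogeneous 1 := by
  refine Fin.cases ?_ (fun j => ?_) i
  · have : extA φ (MvPolynomial.X 0) = MvPolynomial.X 0 := by
      apply (MvPolynomial.finSuccEquiv k d).injective
      rw [extA_fse, MvPolynomial.finSuccEquiv_X_zero, Polynomial.map_X]
    rw [this]
    exact MvPolynomial.isHomogeneous_X _ _
  · have : extA φ (MvPolynomial.X j.succ) = MvPolynomial.rename Fin.succ (φ (MvPolynomial.X j)) := by
      apply (MvPolynomial.finSuccEquiv k d).injective
      rw [extA_fse, MvPolynomial.finSuccEquiv_X_succ, Polynomial.map_C, finSuccEquiv_rename]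
      rfl
    rw [this]
    exact (hφ j).rename_isHomogeneous

theorem extA_symm (φ : MvPolynomial (Fin d) k ≃ₐ[k] MvPolynomial (Fin d) k) :
    (extA φ).symm = extA φ.symm := by
  apply AlgEquiv.ext
  intro p
  rw [AlgEquiv.symm_apply_eq]
  apply (MvPolynomial.finSuccEquiv k d).injective
  rw [extA_fse, extA_fse, Polynomial.map_map]
  ext i
  simp

theorem exists_delta {f g : MvPolynomial (Fin (d + 2)) k}
    (hf : f.IsHomogeneous 3) (hg : g.IsHomogeneous 3)
    (hfm : (MvPolynomial.finSuccEquiv k (d+1) f).Monic) (hfg : IsRelPrime f g) :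
    ∃ (n : ℕ) (δ : MvPolynomial (Fin (d+1)) k) (u h' : (MvPolynomial (Fin (d+1)) k)[X]),
      n ≠ 0 ∧ δ ≠ 0 ∧ δ.IsHomogeneous n ∧
      u * MvPolynomial.finSuccEquiv k (d+1) f + h' * MvPolynomial.finSuccEquiv k (d+1) g = C δ := by
  obtain ⟨δ, hδ, hmem⟩ := elim hfm
    (relprime_equiv (MvPolynomial.finSuccEquiv k (d+1)).toRingEquiv hfg)
  obtain ⟨a, b, hab⟩ := Ideal.mem_span_pair.1 hmem
  have hJ := homId_span f g g hf hg hg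
  have hr : MvPolynomial.rename Fin.succ δ ∈ Ideal.span {f, g, g} := by
    have : MvPolynomial.rename Fin.succ δ = (MvPolynomial.finSuccEquiv k (d+1)).symm a * f +
        (MvPolynomial.finSuccEquiv k (d+1)).symm b * g := by
      apply (MvPolynomial.finSuccEquiv k (d+1)).injective
      rw [finSuccEquiv_rename, map_add, map_mul, map_mul, AlgEquiv.apply_symm_apply,
        AlgEquiv.apply_symm_apply]
      exact hab.symm
    rw [this]
    exact Ideal.add_mem _ (Ideal.mul_mem_left _ _ (Ideal.subset_span (by simp)))
      (Ideal.mul_mem_left _ _ (Ideal.subset_span (by simp)))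
  obtain ⟨n, hn⟩ : ∃ n, MvPolynomial.homogeneousComponent n δ ≠ 0 := by
    by_contra hcon
    push Not at hcon
    apply hδ
    rw [← MvPolynomial.sum_homogeneousComponent δ]
    exact Finset.sum_eq_zero fun i _ => hcon i
  have hm := hJ _ hr n
  rw [← MvPolynomial.rename_homogeneousComponent] at hm
  have hhom := MvPolynomial.homogeneousComponent_isHomogeneous n δ
  generalize MvPolynomial.homogeneousComponent n δ = η at *
  have hm2 : MvPolynomial.rename Fin.succ η ∈ Ideal.span {f, g} := by
    simpa using hm
  obtain ⟨u, v, huv⟩ := Ideal.mem_span_pair.1 hm2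
  refine ⟨n, η, MvPolynomial.finSuccEquiv k (d+1) u, MvPolynomial.finSuccEquiv k (d+1) v, ?_, hn, hhom, ?_⟩
  · rintro rfl
    have h1 : η = MvPolynomial.C (MvPolynomial.coeff 0 η) :=
      MvPolynomial.totalDegree_eq_zero_iff_eq_C.1 (Nat.le_zero.1 hhom.totalDegree_le)
    have h2 := congrArg (MvPolynomial.eval 0) huv
    rw [map_add, map_mul, map_mul, hom_eval_zero hf (by norm_num), hom_eval_zero hg (by norm_num),
      mul_zero, mul_zero, add_zero, h1, MvPolynomial.rename_C, MvPolynomial.eval_C] at h2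
    rw [← h2, map_zero] at h1
    exact hn h1
  · rw [← finSuccEquiv_rename, ← huv, map_add, map_mul, map_mul]

theorem stepC [IsAlgClosed k] {f g h : MvPolynomial (Fin (d + 2)) k}
    (hf : f.IsHomogeneous 3) (hg : g.IsHomogeneous 3) (hh : h.IsHomogeneous 3)
    (hs : HSlim d 3 (Ideal.span {f, g, h}))
    (hfm : (MvPolynomial.finSuccEquiv k (d+1) f).Monic)
    (hfd : (MvPolynomial.finSuccEquiv k (d+1) f).natDegree = 3) (hfg : IsRelPrime f g) :
    pdLE (MvPolynomial (Fin (d + 2)) k) (MvPolynomial (Fin (d + 2)) k ⧸ Ideal.span {f, g, h}) 4 := by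
  have : Infinite k := IsAlgClosed.instInfinite
  obtain ⟨n, δ, u, v, hn, hδ, hδn, huv⟩ := exists_delta hf hg hfm hfg
  obtain ⟨e, c, hc, h1, h2, h3⟩ := make_lead hn hδn hδ
  let Ψ := extA (linSub e)
  have hΨ : ∀ i, (Ψ (MvPolynomial.X i)).IsHomogeneous 1 :=
    extA_X _ fun i => linSub_hom e (MvPolynomial.isHomogeneous_X _ _)
  have hΨ' : ∀ i, (Ψ.symm (MvPolynomial.X i)).IsHomogeneous 1 := by
    rw [show Ψ.symm = extA (linSub e.symm) from (extA_symm _)]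
    exact extA_X _ fun i => linSub_hom e.symm (MvPolynomial.isHomogeneous_X _ _)
  apply transp Ψ
  refine stepB (lin_hom Ψ.toAlgHom hΨ hf) (lin_hom Ψ.toAlgHom hΨ hg) (lin_hom Ψ.toAlgHom hΨ hh)
    (HSlim_transp Ψ hΨ hΨ' f g h d 3 hs) (by rw [extA_fse]; exact hfm.map _)
    (by rw [extA_fse, hfm.natDegree_map, hfd]) h2 (by omega)
    (u := C (MvPolynomial.C c⁻¹) * u.map (linSub e : MvPolynomial (Fin (d+1)) k →+* _))
    (h' := C (MvPolynomial.C c⁻¹) * v.map (linSub e : MvPolynomial (Fin (d+1)) k →+* _)) ?_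
  rw [extA_fse, extA_fse, mul_assoc, mul_assoc, ← mul_add, ← Polynomial.map_mul, ← Polynomial.map_mul,
    ← Polynomial.map_add, huv, Polynomial.map_C, ← C_mul]
  rfl

theorem stepD [IsAlgClosed k] {f g h : MvPolynomial (Fin (d + 2)) k}
    (hf : f.IsHomogeneous 3) (hg : g.IsHomogeneous 3) (hh : h.IsHomogeneous 3)
    (hs : HSlim d 3 (Ideal.span {f, g, h})) (hfg : IsRelPrime f g) (hf0 : f ≠ 0) :
    pdLE (MvPolynomial (Fin (d + 2)) k) (MvPolynomial (Fin (d + 2)) k ⧸ Ideal.span {f, g, h}) 4 := by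
  have : Infinite k := IsAlgClosed.instInfinite
  obtain ⟨e, c, hc, h1, h2, h3⟩ := make_lead (by norm_num) hf hf0
  have hΨ : ∀ i, (linSub e (MvPolynomial.X i)).IsHomogeneous 1 :=
    fun i => linSub_hom e (MvPolynomial.isHomogeneous_X _ _)
  have hΨ' : ∀ i, ((linSub e).symm (MvPolynomial.X i)).IsHomogeneous 1 :=
    fun i => linSub_hom e.symm (MvPolynomial.isHomogeneous_X _ _)
  have hu : IsUnit (MvPolynomial.C c⁻¹ : MvPolynomial (Fin (d+2)) k) :=
    (isUnit_iff_ne_zero.2 (inv_ne_zero hc)).map MvPolynomial.C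
  apply transp (linSub e)
  have hsp : Ideal.span {linSub e f, linSub e g, linSub e h} =
      Ideal.span {MvPolynomial.C c⁻¹ * linSub e f, linSub e g, linSub e h} := by
    rw [Ideal.span_insert, Ideal.span_insert (MvPolynomial.C c⁻¹ * linSub e f),
      Ideal.span_singleton_mul_left_unit hu]
  have hs' := HSlim_transp (linSub e) hΨ hΨ' f g h d 3 hs
  rw [hsp] at hs' ⊢
  refine stepC h1 (linSub_hom e hg) (linSub_hom e hh) hs' h2 h3 ?_
  exact (isRelPrime_mul_unit_left_left hu).2 (relprime_equiv (linSub e).toRingEquiv hfg)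

theorem main_thm [IsAlgClosed k] {N : ℕ} {f g h : MvPolynomial (Fin N) k}
    (hf : f.IsHomogeneous 3) (hg : g.IsHomogeneous 3) (hh : h.IsHomogeneous 3)
    (hht : (⨅ p ∈ {p : {q : Ideal (MvPolynomial (Fin N) k) // q.IsPrime} |
      Ideal.span {f, g} ≤ p.1}, Order.height p) = 2)
    (hs : HSlim (N - 2) 3 (Ideal.span {f, g, h})) :
    pdLE (MvPolynomial (Fin N) k) (MvPolynomial (Fin N) k ⧸ Ideal.span {f, g, h}) 4 := by
  have hfg := relprime_of_height f g hht
  obtain ⟨d, rfl⟩ : ∃ d, N = d + 2 := ⟨N - 2, by have := two_le (by norm_num) hf hg hfg; omega⟩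
  refine stepD hf hg hh hs hfg ?_
  rintro rfl
  have h1 : IsUnit g := hfg (dvd_zero g) dvd_rfl
  have h2 := h1.map (MvPolynomial.eval (0 : Fin (d+2) → k))
  rw [hom_eval_zero hg (by norm_num)] at h2
  exact not_isUnit_zero h2
end asm
end S8
end

noncomputable section

open MvPolynomial Filter CategoryTheory

theorem statement_8
    {k : Type} [Field k] [IsAlgClosed k] {N : ℕ}
    (f₁ f₂ f₃ : MvPolynomial (Fin N) k)
    (hf₁ : f₁.IsHomogeneous 3) (hf₂ : f₂.IsHomogeneous 3) (hf₃ : f₃.IsHomogeneous 3)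
    (hIht : idealHeight (Ideal.span {f₁, f₂, f₃}) = 2)
    (hht₁₂ : idealHeight (Ideal.span {f₁, f₂}) = 2)
    (hht₁₃ : idealHeight (Ideal.span {f₁, f₃}) = 2)
    (hht₂₃ : idealHeight (Ideal.span {f₂, f₃}) = 2)
    (he : HasMultiplicity (Ideal.span {f₁, f₂, f₃}) (N - 2) 3) :
    pdQuotLE (Ideal.span {f₁, f₂, f₃}) 4 := by
  have h := S8.main_thm hf₁ hf₂ hf₃ hht₁₂ he
  exact S8.exists_resolution _ _ h

end
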